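/- Schmüdgen's Positivstellensatz for trace polynomials: Let S ∪ {a} be a finite subset of Sym TT_n. If K_S is a compact subset of (M_n(ℝ))^g (with its Euclidean topology) and a(X) is positive definite for every X ∈ K_S, then a ∈ T_S^tr. -/

import Mathlib

noncomputable section

open Matrix

/-- The polynomial ring ℝ[ξ] in the g·n² commuting variables ξ_{jıȷ}. -/
abbrev PolyRing (n g : ℕ) : Type := MvPolynomial (Fin g × Fin n × Fin n) ℝ

/-- n×n matrices over ℝ[ξ]. -/
abbrev MatP (n g : ℕ) : Type := Matrix (Fin n) (Fin n) (PolyRing n g)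

/-- The generic matrices Ξ_j = (ξ_{jıȷ})_{ıȷ}. -/
def genMat (n g : ℕ) (j : Fin g) : MatP n g :=
  Matrix.of fun a b => MvPolynomial.X (j, a, b)

/-- The set of generic matrices together with their transposes. -/
def genSet (n g : ℕ) : Set (MatP n g) :=
  Set.range (genMat n g) ∪ Set.range (fun j => (genMat n g j)ᵀ)

/-- The trace ring TT_n: the ℝ-subalgebra of M_n(ℝ[ξ]) generated by the Ξ_j, their
transposes, and the scalar matrices tr(w)·1 for all products w of the Ξ_j, Ξ_jᵀ. -/
def traceRing (n g : ℕ) : Subalgebra ℝ (MatP n g) :=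
  Algebra.adjoin ℝ
    (genSet n g ∪
      {m | ∃ w ∈ Submonoid.closure (genSet n g), m = (Matrix.trace w) • (1 : MatP n g)})

/-- The center C_n of the trace ring: the scalar matrices in TT_n. -/
def centerSet (n g : ℕ) : Set (MatP n g) :=
  {c | c ∈ traceRing n g ∧ ∃ p : PolyRing n g, c = p • (1 : MatP n g)}

/-- Evaluation of a matrix of polynomials at a g-tuple X of n×n real matrices. -/
def evalMat (n g : ℕ) (X : Fin g → Matrix (Fin n) (Fin n) ℝ) (h : MatP n g) :
    Matrix (Fin n) (Fin n) ℝ :=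
  h.map (MvPolynomial.eval fun v => X v.1 v.2.1 v.2.2)

/-- The semialgebraic set K_S determined by S. -/
def KSet (n g : ℕ) (S : Set (MatP n g)) : Set (Fin g → Matrix (Fin n) (Fin n) ℝ) :=
  {X | ∀ s ∈ S, (evalMat n g X s).PosSemidef}

/-- Cyclic quadratic module in Sym TT_n. -/
def IsCyclicQM (n g : ℕ) (Q : Set (MatP n g)) : Prop :=
  (∀ q ∈ Q, q ∈ traceRing n g ∧ qᵀ = q) ∧
  (1 : MatP n g) ∈ Q ∧
  (∀ a ∈ Q, ∀ b ∈ Q, a + b ∈ Q) ∧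
  (∀ h ∈ traceRing n g, ∀ q ∈ Q, h * q * hᵀ ∈ Q) ∧
  (∀ q ∈ Q, (Matrix.trace q) • (1 : MatP n g) ∈ Q)

/-- Cyclic preordering: a cyclic quadratic module whose intersection with the center
is closed under multiplication. -/
def IsCyclicPreordering (n g : ℕ) (T : Set (MatP n g)) : Prop :=
  IsCyclicQM n g T ∧
  ∀ a ∈ T ∩ centerSet n g, ∀ b ∈ T ∩ centerSet n g, a * b ∈ T

/-- The smallest cyclic preordering T_S^tr containing S. -/
def TtrS (n g : ℕ) (S : Set (MatP n g)) : Set (MatP n g) :=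
  {a | ∀ T : Set (MatP n g), IsCyclicPreordering n g T → S ⊆ T → a ∈ T}

section Preordering

variable {R : Type*} [CommRing R]

/-- The preordering obtained by adjoining `a` to `P`, if it does not contain `-1`. -/
def RingPreordering.adjoinElem (P : RingPreordering R) (a : R)
    (h : ∀ p ∈ P, ∀ q ∈ P, -1 ≠ p + a * q) : RingPreordering R :=
  RingPreordering.mk' {x | ∃ p ∈ P, ∃ q ∈ P, x = p + a * q}
    (by
      rintro x y ⟨p, hp, q, hq, rfl⟩ ⟨p', hp', q', hq', rfl⟩
      exact ⟨p + p', add_mem hp hp', q + q', add_mem hq hq', by ring⟩)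
    (by
      rintro x y ⟨p, hp, q, hq, rfl⟩ ⟨p', hp', q', hq', rfl⟩
      exact ⟨p * p' + a * a * (q * q'),
        add_mem (mul_mem hp hp') (mul_mem (P.mul_self_mem a) (mul_mem hq hq')),
        p * q' + q * p', add_mem (mul_mem hp hq') (mul_mem hq hp'), by ring⟩)
    (fun x => ⟨x * x, P.mul_self_mem x, 0, zero_mem P, by ring⟩)
    (by
      rintro ⟨p, hp, q, hq, h'⟩
      exact h p hp q hq h')

theorem RingPreordering.exists_le_isOrdering (P : RingPreordering R) :
    ∃ O : RingPreordering R, P ≤ O ∧ O.IsOrdering := by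
  obtain ⟨O, hPO, hO⟩ := zorn_le_nonempty_Ici₀ P (fun c _ hchain y hy => by
    refine ⟨RingPreordering.mk' {x | ∃ Q ∈ c, x ∈ Q} ?_ ?_ ?_ ?_, ?_⟩
    · rintro u v ⟨A, hA, hu⟩ ⟨B, hB, hv⟩
      rcases hchain.total hA hB with h | h
      · exact ⟨B, hB, add_mem (h hu) hv⟩
      · exact ⟨A, hA, add_mem hu (h hv)⟩
    · rintro u v ⟨A, hA, hu⟩ ⟨B, hB, hv⟩
      rcases hchain.total hA hB with h | h
      · exact ⟨B, hB, mul_mem (h hu) hv⟩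
      · exact ⟨A, hA, mul_mem hu (h hv)⟩
    · exact fun x => ⟨y, hy, y.mul_self_mem x⟩
    · rintro ⟨A, _, hA⟩
      exact A.neg_one_notMem hA
    · exact fun z hz x hx => ⟨z, hz, hx⟩) P le_rfl
  refine ⟨O, hPO, RingPreordering.isOrdering_iff.2 fun a b hab => ?_⟩
  have key : ∀ a, a ∉ O → ∃ p ∈ O, ∃ q ∈ O, -1 = p + a * q := by
    intro a ha
    by_contra! hcon
    refine ha (hO (b := O.adjoinElem a hcon) ?_ ?_)
    · exact fun x hx => ⟨x, hx, 0, zero_mem O, by ring⟩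
    · exact ⟨0, zero_mem O, 1, one_mem O, by ring⟩
  by_contra! hcon
  obtain ⟨p, hp, q, hq, h1⟩ := key a hcon.1
  obtain ⟨p', hp', q', hq', h2⟩ := key b hcon.2
  have h3 : -1 = p + p' + p * p' + (-(a * b)) * (q * q') := by
    linear_combination (-b * q') * h1 + (1 + p) * h2
  refine O.neg_one_notMem ?_
  rw [h3]
  exact add_mem (add_mem (add_mem hp hp') (mul_mem hp hp')) (mul_mem hab (mul_mem hq hq'))

theorem RingPreordering.exists_linearOrder {E : Type*} [Field E] (P : RingPreordering E) :
    ∃ (_ : LinearOrder E) (_ : IsStrictOrderedRing E), ∀ x ∈ P, 0 ≤ x := by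
  classical
  obtain ⟨O, hPO, hO⟩ := P.exists_le_isOrdering
  let C : RingCone E :=
    { O.toSubsemiring with
      eq_zero_of_mem_of_neg_mem' := fun h h2 => RingPreordering.eq_zero_of_mem_of_neg_mem h h2 }
  have : HasMemOrNegMem C := ⟨fun x => mem_or_neg_mem O x⟩
  let _ : DecidablePred (· ∈ C) := Classical.decPred _
  let ord : LinearOrder E := LinearOrder.mkOfAddGroupCone C
  have h1 : @IsOrderedRing E _ ord.toPartialOrder := IsOrderedRing.mkOfCone C
  refine ⟨ord, IsOrderedRing.toIsStrictOrderedRing E, fun x hx => ?_⟩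
  change x - 0 ∈ O
  simpa using hPO hx

end Preordering

section RealClosure

universe u

open Polynomial

/-- The sums of squares of polynomials with nonnegative weights. -/
def weightedSquares (F : Type*) [Field F] [LinearOrder F] [IsStrictOrderedRing F] :
    Submonoid F[X] where
  carrier := {p | ∃ c : F, 0 ≤ c ∧ ∃ g : F[X], p = C c * g ^ 2}
  one_mem' := ⟨1, zero_le_one, 1, by simp⟩
  mul_mem' := by
    rintro _ _ ⟨c, hc, g, rfl⟩ ⟨d, hd, h, rfl⟩
    exact ⟨c * d, mul_nonneg hc hd, g * h, by rw [C_mul]; ring⟩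

/-- Every irreducible polynomial of degree at least two divides `1 + s` for a sum `s` of squares
with nonnegative weights. -/
def NoRealExtension (F : Type*) [Field F] [LinearOrder F] [IsStrictOrderedRing F] : Prop :=
  ∀ μ : F[X], Irreducible μ → 2 ≤ μ.natDegree →
    ∃ s ∈ (weightedSquares F).subsemiringClosure, μ ∣ 1 + s

/-- The intermediate value property for polynomials. -/
def PolyIVT (F : Type*) [Field F] [LinearOrder F] : Prop :=
  ∀ (f : F[X]) (a b : F), a < b → f.eval a * f.eval b < 0 → ∃ c, a < c ∧ c < b ∧ f.eval c = 0

theorem RingPreordering.exists_noRealExtension {K : Type u} [Field K] (Q : RingPreordering K) :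
    ∃ (F : Type u) (_ : Field F) (_ : LinearOrder F) (_ : IsStrictOrderedRing F) (i : K →+* F),
      (∀ q ∈ Q, 0 ≤ i q) ∧ NoRealExtension F := by
  let Ω := AlgebraicClosure K
  let gens : IntermediateField K Ω → Set Ω := fun L =>
    (algebraMap K Ω '' (Q : Set K)) ∪ {x | ∃ e ∈ L, x = e * e}
  have gens_mono : ∀ {L L'}, L ≤ L' → gens L ⊆ gens L' := by
    rintro L L' h x (hx | ⟨e, he, rfl⟩)
    · exact Or.inl hx
    · exact Or.inr ⟨e, h he, rfl⟩
  let cone : IntermediateField K Ω → Subsemiring Ω := fun L => Subsemiring.closure (gens L)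
  have hbot : -1 ∉ cone ⊥ := by
    intro h
    have hle : cone ⊥ ≤ Q.toSubsemiring.map (algebraMap K Ω) := by
      refine Subsemiring.closure_le.2 ?_
      rintro x (⟨q, hq, rfl⟩ | ⟨e, he, rfl⟩)
      · exact ⟨q, hq, rfl⟩
      · obtain ⟨y, rfl⟩ := IntermediateField.mem_bot.1 he
        exact ⟨y * y, Q.mul_self_mem y, by simp⟩
    obtain ⟨q, hq, hq'⟩ := hle h
    have : q = -1 := (algebraMap K Ω).injective (by simpa using hq')
    exact Q.neg_one_notMem (this ▸ hq)
  obtain ⟨L, -, hL⟩ := zorn_le_nonempty₀ {L : IntermediateField K Ω | -1 ∉ cone L}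
    (fun c hc hchain y hy => by
      have hne : c.Nonempty := ⟨y, hy⟩
      have : Nonempty c := hne.to_subtype
      have hdir : Directed (· ≤ ·) (fun L : c => (L : IntermediateField K Ω)) :=
        hchain.directedOn.directed_val
      refine ⟨⨆ L : c, (L : IntermediateField K Ω), ?_, fun z hz => le_iSup (fun L : c =>
        (L : IntermediateField K Ω)) ⟨z, hz⟩⟩
      intro h
      have hle : cone (⨆ L : c, (L : IntermediateField K Ω)) ≤ ⨆ L : c, cone L := by
        refine Subsemiring.closure_le.2 ?_
        rintro x (hx | ⟨e, he, rfl⟩)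
        · exact (le_iSup (fun L : c => cone L) ⟨y, hy⟩)
            (Subsemiring.subset_closure (Or.inl hx))
        · have he' : e ∈ (⋃ L : c, ((L : IntermediateField K Ω) : Set Ω)) := by
            rw [← IntermediateField.coe_iSup_of_directed hdir]; exact he
          obtain ⟨M, hM⟩ := Set.mem_iUnion.1 he'
          exact (le_iSup (fun L : c => cone L) M)
            (Subsemiring.subset_closure (Or.inr ⟨e, hM, rfl⟩))
      have hdir' : Directed (· ≤ ·) (fun L : c => cone L) := by
        intro A B
        obtain ⟨D, hA, hB⟩ := hdir A B
        exact ⟨D, Subsemiring.closure_mono (gens_mono hA),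
          Subsemiring.closure_mono (gens_mono hB)⟩
      obtain ⟨M, hM⟩ := (Subsemiring.mem_iSup_of_directed hdir').1 (hle h)
      exact hc M.2 hM) ⊥ hbot
  have hLmem : -1 ∉ cone L := hL.prop
  let P : RingPreordering L :=
    { (cone L).comap (algebraMap L Ω) with
      mem_of_isSquare' := by
        rintro x ⟨y, rfl⟩
        exact Subsemiring.subset_closure (Or.inr ⟨y, y.2, by simp⟩)
      neg_one_notMem' := by
        intro h
        apply hLmem
        have : (algebraMap L Ω) (-1) ∈ cone L := h
        simpa using this }
  obtain ⟨ord, sord, hP⟩ := P.exists_linearOrder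
  have hQ : ∀ q ∈ Q, 0 ≤ algebraMap K L q := fun q hq => hP _ (by
    change algebraMap L Ω (algebraMap K L q) ∈ cone L
    exact Subsemiring.subset_closure (Or.inl ⟨q, hq, rfl⟩))
  refine ⟨L, inferInstance, ord, sord, algebraMap K L, hQ, ?_⟩
  intro μ hμ hdeg
  obtain ⟨θ, hθ⟩ := IsAlgClosed.exists_aeval_eq_zero Ω μ (by
    intro h; rw [Polynomial.degree_eq_natDegree hμ.ne_zero] at h
    have : μ.natDegree = 0 := by exact_mod_cast h
    omega)
  have hdvd : ∀ p : L[X], aeval θ p = 0 → μ ∣ p := fun p hp =>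
    ((minpoly.irreducible (Algebra.IsIntegral.isIntegral θ)).dvd_symm hμ
      (minpoly.dvd L θ hθ)).trans (minpoly.dvd L θ hp)
  have hθL : θ ∉ L := by
    intro h
    have h1 : μ ∣ X - C (⟨θ, h⟩ : L) := hdvd _ (by
      simp only [map_sub, aeval_X, aeval_C, sub_eq_zero]; rfl)
    have h2 := natDegree_le_of_dvd h1 (X_sub_C_ne_zero _)
    rw [natDegree_X_sub_C] at h2
    omega
  let L' : IntermediateField K Ω := (IntermediateField.adjoin L {θ}).restrictScalars K
  have hLL' : L ≤ L' := fun x hx => (IntermediateField.adjoin L {θ}).algebraMap_mem ⟨x, hx⟩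
  have hθL' : θ ∈ L' := IntermediateField.mem_adjoin_simple_self L θ
  have hcone : -1 ∈ cone L' := by
    by_contra h
    exact hθL (hL.le_of_ge (y := L') h hLL' hθL')
  have hsub : cone L' ≤ (weightedSquares L).subsemiringClosure.map
      (aeval θ : L[X] →ₐ[L] Ω).toRingHom := by
    refine Subsemiring.closure_le.2 ?_
    rintro x (⟨q, hq, rfl⟩ | ⟨e, he, rfl⟩)
    · refine ⟨C (algebraMap K L q), AddSubmonoid.subset_closure
        ⟨algebraMap K L q, hQ q hq, 1, by rw [one_pow, mul_one]⟩, ?_⟩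
      exact (aeval_C θ (algebraMap K L q)).trans (IsScalarTower.algebraMap_apply K L Ω q).symm
    · have he' : e ∈ (IntermediateField.adjoin L {θ}).toSubalgebra := he
      rw [IntermediateField.adjoin_simple_toSubalgebra_of_isAlgebraic
        (Algebra.IsAlgebraic.isAlgebraic θ), Algebra.adjoin_singleton_eq_range_aeval] at he'
      obtain ⟨g, rfl⟩ := he'
      exact ⟨g ^ 2, AddSubmonoid.subset_closure ⟨1, zero_le_one, g, by simp⟩, by simp [pow_two]⟩
  obtain ⟨s, hs, hs'⟩ := hsub hcone
  refine ⟨s, hs, hdvd _ ?_⟩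
  have hs'' : aeval θ s = -1 := hs'
  rw [map_add, map_one, hs'', add_neg_cancel]

section IVT

variable {F : Type*} [Field F] [LinearOrder F] [IsStrictOrderedRing F]

theorem eval_nonneg_of_mem_weightedSquares {s : F[X]}
    (hs : s ∈ (weightedSquares F).subsemiringClosure) (x : F) : 0 ≤ s.eval x := by
  induction hs using AddSubmonoid.closure_induction with
  | mem s hs =>
    obtain ⟨c, hc, g, rfl⟩ := hs
    simp only [eval_mul, eval_C, eval_pow]
    positivity
  | zero => simp
  | add s t _ _ hs ht => rw [eval_add]; exact add_nonneg hs ht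

theorem exists_reduced_weightedSquares {g s : F[X]} (hg : 0 < g.natDegree)
    (hs : s ∈ (weightedSquares F).subsemiringClosure) :
    ∃ t ∈ (weightedSquares F).subsemiringClosure, g ∣ s - t ∧
      t.natDegree ≤ 2 * (g.natDegree - 1) := by
  induction hs using AddSubmonoid.closure_induction with
  | mem s hs =>
    obtain ⟨c, hc, f, rfl⟩ := hs
    refine ⟨C c * (f % g) ^ 2, AddSubmonoid.subset_closure ⟨c, hc, _, rfl⟩, ?_, ?_⟩
    · refine ⟨C c * (f / g) * (f + f % g), ?_⟩
      linear_combination (C c * (f + f % g)) * (-(EuclideanDomain.div_add_mod f g))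
    · have h1 : (f % g).natDegree < g.natDegree := natDegree_mod_lt f hg.ne'
      calc (C c * (f % g) ^ 2).natDegree ≤ ((f % g) ^ 2).natDegree := natDegree_C_mul_le _ _
        _ ≤ 2 * (f % g).natDegree := natDegree_pow_le
        _ ≤ _ := by omega
  | zero => exact ⟨0, zero_mem _, by simp, by simp⟩
  | add s s' _ _ hs hs' =>
    obtain ⟨t, ht, h1, h2⟩ := hs
    obtain ⟨t', ht', h1', h2'⟩ := hs'
    refine ⟨t + t', add_mem ht ht', ?_, (natDegree_add_le _ _).trans (max_le h2 h2')⟩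
    rw [add_sub_add_comm]
    exact dvd_add h1 h1'

theorem not_dvd_one_add_of_sign_change {a b : F} (n : ℕ) : ∀ g : F[X], g.natDegree ≤ n →
    g.eval a * g.eval b < 0 → ∀ s ∈ (weightedSquares F).subsemiringClosure, ¬ g ∣ 1 + s := by
  induction n using Nat.strong_induction_on with
  | _ n ih =>
  intro g hgn hg s hs hdvd
  have hpos : 0 < g.natDegree := by
    by_contra h
    rw [eq_C_of_natDegree_eq_zero (Nat.eq_zero_of_not_pos h)] at hg
    simp only [eval_C] at hg
    exact absurd hg (not_lt.2 (mul_self_nonneg _))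
  obtain ⟨t, ht, hst, hdeg⟩ := exists_reduced_weightedSquares hpos hs
  have hdvd' : g ∣ 1 + t := by
    have := dvd_sub hdvd hst
    rwa [show 1 + s - (s - t) = 1 + t by ring] at this
  obtain ⟨h, hh⟩ := hdvd'
  have hev : ∀ x, 0 < g.eval x * h.eval x := fun x => by
    rw [← eval_mul, ← hh, eval_add, eval_one]
    have := eval_nonneg_of_mem_weightedSquares ht x
    linarith
  have hsign : h.eval a * h.eval b < 0 := by
    have h1 := mul_pos (hev a) (hev b)
    by_contra hcon
    have := mul_nonpos_of_nonpos_of_nonneg hg.le (not_lt.1 hcon)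
    linarith
  have hg0 : g ≠ 0 := by rintro rfl; simp at hpos
  have hh0 : h ≠ 0 := by rintro rfl; simp at hsign
  have hdh : g.natDegree + h.natDegree ≤ 2 * (g.natDegree - 1) := by
    rw [← natDegree_mul hg0 hh0, ← hh]
    refine (natDegree_add_le _ _).trans (max_le (by simp) hdeg)
  exact ih h.natDegree (by omega) h le_rfl hsign t ht ⟨g, by rw [hh, mul_comm]⟩

theorem NoRealExtension.polyIVT (hF : NoRealExtension F) : PolyIVT F := by
  intro f a b hab
  induction hn : f.natDegree using Nat.strong_induction_on generalizing f with
  | _ n ih =>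
  intro hf
  have hf0 : f ≠ 0 := by rintro rfl; simp at hf
  have hfu : ¬ IsUnit f := by
    intro hu
    obtain ⟨c, -, rfl⟩ := Polynomial.isUnit_iff.1 hu
    simp only [eval_C] at hf
    exact absurd hf (not_lt.2 (mul_self_nonneg _))
  obtain ⟨p, hp, h, rfl⟩ := WfDvdMonoid.exists_irreducible_factor hfu hf0
  have hh0 : h ≠ 0 := right_ne_zero_of_mul hf0
  simp only [eval_mul] at hf ⊢
  rcases lt_or_ge (p.eval a * p.eval b) 0 with hlt | hge
  · have hdeg : p.natDegree ≤ 1 := by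
      by_contra hd
      obtain ⟨s, hs, hps⟩ := hF p hp (by omega)
      exact not_dvd_one_add_of_sign_change _ p le_rfl hlt s hs hps
    obtain ⟨α, β, rfl⟩ := exists_eq_X_add_C_of_natDegree_le_one hdeg
    simp only [eval_add, eval_mul, eval_C, eval_X] at hlt ⊢
    have hα : α ≠ 0 := by
      rintro rfl
      simp only [zero_mul, zero_add] at hlt
      exact absurd hlt (not_lt.2 (mul_self_nonneg _))
    have hroot : α * (-β / α) + β = 0 := by field_simp; ring
    refine ⟨-β / α, ?_, ?_, by rw [hroot, zero_mul]⟩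
    · by_contra hcon
      push Not at hcon
      have h2 : (α * a + β) * (α * b + β) = α ^ 2 * ((a - -β / α) * (b - -β / α)) := by
        field_simp; ring
      have h3 : 0 ≤ (a - -β / α) * (b - -β / α) :=
        mul_nonneg (by linarith) (by linarith)
      have := mul_nonneg (sq_nonneg α) h3
      linarith
    · by_contra hcon
      push Not at hcon
      have h2 : (α * a + β) * (α * b + β) = α ^ 2 * ((-β / α - a) * (-β / α - b)) := by
        field_simp; ring
      have h3 : 0 ≤ (-β / α - a) * (-β / α - b) :=
        mul_nonneg (by linarith) (by linarith)
      have := mul_nonneg (sq_nonneg α) h3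
      linarith
  · have hsign : h.eval a * h.eval b < 0 := by
      by_contra hcon
      have := mul_nonneg hge (not_lt.1 hcon)
      have h2 : p.eval a * h.eval a * (p.eval b * h.eval b) =
        p.eval a * p.eval b * (h.eval a * h.eval b) := by ring
      linarith
    have hpd : 0 < p.natDegree := hp.natDegree_pos
    have hdeg : (p * h).natDegree = p.natDegree + h.natDegree := natDegree_mul hp.ne_zero hh0
    obtain ⟨c, h1, h2, h3⟩ := ih h.natDegree (by omega) h rfl hsign
    exact ⟨c, h1, h2, by rw [h3, mul_zero]⟩

theorem PolyIVT.exists_sqrt (hF : PolyIVT F) {a : F} (ha : 0 ≤ a) : ∃ b, 0 ≤ b ∧ b * b = a := by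
  rcases ha.eq_or_lt with rfl | ha
  · exact ⟨0, le_rfl, by simp⟩
  obtain ⟨c, h1, -, h3⟩ := hF (X ^ 2 - C a) 0 (a + 1) (by linarith) (by
    simp only [eval_sub, eval_pow, eval_X, eval_C]
    have : 0 < a * (a ^ 2 + a + 1) := by positivity
    linarith)
  refine ⟨c, h1.le, ?_⟩
  simp only [eval_sub, eval_pow, eval_X, eval_C] at h3
  linear_combination h3

end IVT

end RealClosure

section RealRoots

open Polynomial

variable {K : Type*} [Field K] [LinearOrder K] [IsStrictOrderedRing K]

theorem PolyIVT.exists_root_of_sign_ne (hK : PolyIVT K) (p : K[X]) {a b : K} (hab : a ≤ b)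
    (h : SignType.sign (p.eval a) ≠ SignType.sign (p.eval b)) :
    ∃ c, a ≤ c ∧ c ≤ b ∧ p.eval c = 0 := by
  rcases eq_or_ne (p.eval a) 0 with ha | ha
  · exact ⟨a, le_rfl, hab, ha⟩
  rcases eq_or_ne (p.eval b) 0 with hb | hb
  · exact ⟨b, hab, le_rfl, hb⟩
  rcases hab.eq_or_lt with rfl | hab
  · exact absurd rfl h
  obtain ⟨c, h1, h2, h3⟩ := hK p a b hab (by
    rcases lt_or_gt_of_ne ha with ha | ha <;> rcases lt_or_gt_of_ne hb with hb | hb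
    · simp [sign_neg ha, sign_neg hb] at h
    · exact mul_neg_of_neg_of_pos ha hb
    · exact mul_neg_of_pos_of_neg ha hb
    · simp [sign_pos ha, sign_pos hb] at h)
  exact ⟨c, h1.le, h2.le, h3⟩

theorem PolyIVT.rolle (hK : PolyIVT K) (p : K[X]) {a b : K} (hab : a < b)
    (ha : p.eval a = 0) (hb : p.eval b = 0) :
    ∃ c, a < c ∧ c < b ∧ (derivative p).eval c = 0 := by
  rcases eq_or_ne p 0 with rfl | hp
  · obtain ⟨c, h1, h2⟩ := exists_between hab
    exact ⟨c, h1, h2, by simp⟩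
  obtain ⟨b', hb', hmin⟩ := Finset.exists_min_image (p.roots.toFinset.filter (fun x => a < x)) id
    ⟨b, by simp [hp, hb, hab]⟩
  simp only [Finset.mem_filter, Multiset.mem_toFinset, mem_roots hp, IsRoot.def, id] at hb' hmin
  have hb'b : b' ≤ b := hmin b ⟨hb, hab⟩
  have hab' : a < b' := hb'.2
  obtain ⟨q, hq, hqa⟩ := exists_eq_pow_rootMultiplicity_mul_and_not_dvd p hp a
  have hq0 : q ≠ 0 := by rintro rfl; simp at hqa
  obtain ⟨r, hr, hrb⟩ := exists_eq_pow_rootMultiplicity_mul_and_not_dvd q hq0 b'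
  have hk : 0 < p.rootMultiplicity a := (rootMultiplicity_pos hp).2 ha
  have hqb : q.eval b' = 0 := by
    have h1 := hb'.1
    rw [hq, eval_mul, eval_pow, eval_sub, eval_X, eval_C] at h1
    exact (mul_eq_zero.1 h1).resolve_left (pow_ne_zero _ (sub_ne_zero.2 hab'.ne'))
  have hl : 0 < q.rootMultiplicity b' := (rootMultiplicity_pos hq0).2 hqb
  generalize p.rootMultiplicity a = k at *
  generalize q.rootMultiplicity b' = l at *
  obtain ⟨k, rfl⟩ := Nat.exists_eq_succ_of_ne_zero hk.ne'
  obtain ⟨l, rfl⟩ := Nat.exists_eq_succ_of_ne_zero hl.ne'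
  have hra : r.eval a ≠ 0 := by
    intro h
    exact hqa (dvd_iff_isRoot.2 (by rw [hr]; simp [h]))
  have hrb : r.eval b' ≠ 0 := fun h => hrb (dvd_iff_isRoot.2 h)
  have hpr : p = (X - C a) ^ (k + 1) * ((X - C b') ^ (l + 1) * r) := by rw [← hr]; exact hq
  have hnoroot : ∀ c, a < c → c < b' → r.eval c ≠ 0 := by
    intro c h1 h2 h3
    refine absurd (hmin c ⟨?_, h1⟩) (not_le.2 h2)
    rw [hpr]; simp [h3]
  have hsign : 0 < r.eval a * r.eval b' := by
    by_contra hcon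
    have hlt : r.eval a * r.eval b' < 0 :=
      lt_of_le_of_ne (not_lt.1 hcon) (mul_ne_zero hra hrb)
    obtain ⟨c, h1, h2, h3⟩ := hK r a b' hab' hlt
    exact hnoroot c h1 h2 h3
  let w : K[X] := (C ((k : K) + 1) * (X - C b') + C ((l : K) + 1) * (X - C a)) * r +
    (X - C a) * (X - C b') * derivative r
  have hder : derivative p = (X - C a) ^ k * (X - C b') ^ l * w := by
    rw [hpr]
    simp only [derivative_mul, derivative_X_sub_C_pow, w]
    push_cast
    simp only [map_add, map_natCast, map_one]
    ring
  obtain ⟨c, h1, h2, h3⟩ := hK w a b' hab' (by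
    simp only [w, eval_add, eval_mul, eval_sub, eval_X, eval_C, sub_self, mul_zero, zero_mul,
      add_zero, zero_add]
    have h4 : ((k : K) + 1) * (a - b') * r.eval a * (((l : K) + 1) * (b' - a) * r.eval b') =
      - (((k : K) + 1) * ((l : K) + 1) * (b' - a) ^ 2 * (r.eval a * r.eval b')) := by ring
    rw [h4]
    have h5 : 0 < b' - a := sub_pos.2 hab'
    have : 0 < ((k : K) + 1) * ((l : K) + 1) * (b' - a) ^ 2 * (r.eval a * r.eval b') := by
      positivity
    linarith)
  exact ⟨c, h1, h2.trans_le hb'b, by rw [hder, eval_mul, h3, mul_zero]⟩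

/-- A root that is the only critical point-free root in an interval is a sign change. -/
theorem PolyIVT.sign_change_of_root (hK : PolyIVT K) (p : K[X]) {a b x : K} (hax : a < x)
    (hxb : x < b) (hx : p.eval x = 0) (h : ∀ c, a < c → c < b → (derivative p).eval c ≠ 0) :
    p.eval a * p.eval b < 0 := by
  obtain ⟨q, rfl⟩ := dvd_iff_isRoot.2 hx
  have hqx : q.eval x ≠ 0 := by
    have := h x hax hxb
    simpa using this
  have hroots : ∀ z, a ≤ z → z ≤ b → q.eval z ≠ 0 := by
    intro z h1 h2 h3
    rcases lt_trichotomy z x with hlt | rfl | hlt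
    · obtain ⟨c, h4, h5, h6⟩ := hK.rolle ((X - C x) * q) hlt (by simp [h3]) (by simp)
      exact h c (h1.trans_lt h4) (h5.trans hxb) h6
    · exact hqx h3
    · obtain ⟨c, h4, h5, h6⟩ := hK.rolle ((X - C x) * q) hlt (by simp) (by simp [h3])
      exact h c (hax.trans h4) (h5.trans_le h2) h6
  have hab : a < b := hax.trans hxb
  have hpos : 0 < q.eval a * q.eval b := by
    by_contra hcon
    obtain ⟨c, h1, h2, h3⟩ := hK q a b hab (lt_of_le_of_ne (not_lt.1 hcon)
      (mul_ne_zero (hroots a le_rfl hab.le) (hroots b hab.le le_rfl)))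
    exact hroots c h1.le h2.le h3
  simp only [eval_mul, eval_sub, eval_X, eval_C]
  have : 0 < (x - a) * (b - x) * (q.eval a * q.eval b) :=
    mul_pos (mul_pos (sub_pos.2 hax) (sub_pos.2 hxb)) hpos
  linarith

theorem exists_forall_ge_eval_ge (n : ℕ) : ∀ p : K[X], p.natDegree = n → 0 < p.leadingCoeff →
    ∃ M δ : K, 0 < δ ∧ ∀ x, M ≤ x → δ ≤ p.eval x := by
  induction n with
  | zero =>
    intro p hp hl
    refine ⟨0, p.leadingCoeff, hl, fun x _ => ?_⟩
    rw [leadingCoeff, hp, eq_C_of_natDegree_eq_zero hp, eval_C, coeff_C_zero]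
  | succ n ih =>
    intro p hp hl
    have hdeg : p.divX.natDegree = n := by rw [natDegree_divX_eq_natDegree_tsub_one, hp]; rfl
    have hlead : p.divX.leadingCoeff = p.leadingCoeff := by
      rw [leadingCoeff, hdeg, coeff_divX, leadingCoeff, hp]
    obtain ⟨M, δ, hδ, hM⟩ := ih p.divX hdeg (hlead ▸ hl)
    refine ⟨max M (max 0 ((δ + |p.coeff 0|) / δ)), δ, hδ, fun x hx => ?_⟩
    have h1 : M ≤ x := (le_max_left _ _).trans hx
    have h0 : 0 ≤ x := ((le_max_left _ _).trans (le_max_right _ _)).trans hx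
    have h2 : (δ + |p.coeff 0|) / δ ≤ x := ((le_max_right _ _).trans (le_max_right _ _)).trans hx
    rw [div_le_iff₀ hδ] at h2
    have h3 : p.eval x = p.divX.eval x * x + p.coeff 0 := by
      conv_lhs => rw [← divX_mul_X_add p]
      simp
    have h4 := mul_le_mul_of_nonneg_right (hM x h1) h0
    have h5 := neg_abs_le (p.coeff 0)
    rw [h3]
    linarith

theorem exists_forall_ge_sign_eval_eq (p : K[X]) :
    ∃ M : K, ∀ x, M ≤ x → SignType.sign (p.eval x) = SignType.sign p.leadingCoeff := by
  rcases lt_trichotomy p.leadingCoeff 0 with h | h | h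
  · obtain ⟨M, δ, hδ, hM⟩ := exists_forall_ge_eval_ge _ (-p) rfl (by simpa using h)
    refine ⟨M, fun x hx => ?_⟩
    have := hM x hx
    rw [eval_neg] at this
    rw [sign_neg h, sign_neg (by linarith)]
  · exact ⟨0, fun x _ => by rw [leadingCoeff_eq_zero.1 h]; simp⟩
  · obtain ⟨M, δ, hδ, hM⟩ := exists_forall_ge_eval_ge _ p rfl h
    exact ⟨M, fun x hx => by rw [sign_pos h, sign_pos (hδ.trans_le (hM x hx))]⟩

theorem exists_forall_le_neg_sign_eval_eq (p : K[X]) :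
    ∃ M : K, ∀ x, x ≤ -M → SignType.sign (p.eval x) =
      SignType.sign ((-1 : K) ^ p.natDegree * p.leadingCoeff) := by
  obtain ⟨M, hM⟩ := exists_forall_ge_sign_eval_eq (p.comp (-X))
  refine ⟨M, fun x hx => ?_⟩
  have := hM (-x) (by linarith)
  rw [eval_comp, eval_neg, eval_X, neg_neg] at this
  rw [this, leadingCoeff_comp (by rw [natDegree_neg, natDegree_X]; exact one_ne_zero)]
  simp [mul_comm]

end RealRoots

section SignMatching

open Polynomial

variable {A R F : Type*} [LinearOrder R] [LinearOrder F]

/-- `x` and `y` have the same position relative to the pairs in `G`. -/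
def SamePos (G : Finset (R × F)) (x : R) (y : F) : Prop :=
  ∀ g ∈ G, (g.1 < x ↔ g.2 < y) ∧ (x < g.1 ↔ y < g.2)

variable {G : Finset (R × F)}

theorem SamePos.symm {x : R} {y : F} (h : SamePos G x y) :
    SamePos (G.image Prod.swap) y x := by
  intro g hg
  obtain ⟨g', hg', rfl⟩ := Finset.mem_image.1 hg
  exact ⟨(h g' hg').1.symm, (h g' hg').2.symm⟩

theorem image_swap_swap (G : Finset (R × F)) : (G.image Prod.swap).image Prod.swap = G := by
  rw [Finset.image_image]; simp

variable [CommRing A] [Field R] [Field F]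

/-- The graph `G` of a finite partial order isomorphism such that the signs of the polynomials
in `𝓟` at corresponding positions agree. -/
structure SignMatch (u : A →+* R) (v : A →+* F) (𝓟 : Finset A[X]) (G : Finset (R × F)) :
    Prop where
  compat : ∀ g ∈ G, SamePos G g.1 g.2
  sign_eq : ∀ x y, SamePos G x y → ∀ p ∈ 𝓟,
    SignType.sign ((p.map u).eval x) = SignType.sign ((p.map v).eval y)

variable {u : A →+* R} {v : A →+* F} {𝓟 𝓠 : Finset A[X]}

theorem SignMatch.symm (h : SignMatch u v 𝓟 G) : SignMatch v u 𝓟 (G.image Prod.swap) := by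
  refine ⟨fun g hg => ?_, fun y x hyx p hp => ?_⟩
  · obtain ⟨g', hg', rfl⟩ := Finset.mem_image.1 hg
    exact (h.compat g' hg').symm
  · have := hyx.symm
    rw [image_swap_swap] at this
    exact (h.sign_eq x y this p hp).symm

theorem exists_samePos [IsStrictOrderedRing F] (hG : ∀ g ∈ G, SamePos G g.1 g.2) (x : R) :
    ∃ y, SamePos G x y := by
  by_cases hx : ∃ g ∈ G, g.1 = x
  · obtain ⟨g, hg, rfl⟩ := hx
    exact ⟨g.2, hG g hg⟩
  push Not at hx
  obtain ⟨y, h1, h2⟩ := Order.exists_between_finsets ((G.filter (fun g => g.1 < x)).image Prod.snd)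
    ((G.filter (fun g => x < g.1)).image Prod.snd) (by
      simp only [Finset.mem_image, Finset.mem_filter]
      rintro _ ⟨a, ⟨ha, hax⟩, rfl⟩ _ ⟨b, ⟨hb, hxb⟩, rfl⟩
      exact ((hG b hb) a ha).1.1 (hax.trans hxb))
  simp only [Finset.mem_image, Finset.mem_filter] at h1 h2
  refine ⟨y, fun g hg => ?_⟩
  rcases lt_or_gt_of_ne (hx g hg) with h | h
  · have h3 := h1 g.2 ⟨g, ⟨hg, h⟩, rfl⟩
    exact ⟨iff_of_true h h3, iff_of_false h.not_gt h3.not_gt⟩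
  · have h3 := h2 g.2 ⟨g, ⟨hg, h⟩, rfl⟩
    exact ⟨iff_of_false h.not_gt h3.not_gt, iff_of_true h h3⟩

variable [IsStrictOrderedRing R] [IsStrictOrderedRing F]

theorem SignMatch.exists_mem_of_root (h : SignMatch u v 𝓟 G) {p : A[X]} (hp : p ∈ 𝓟)
    (hpu : p.map u ≠ 0) {z : R} (hz : (p.map u).eval z = 0) : ∃ g ∈ G, g.1 = z := by
  by_contra! hcon
  obtain ⟨y, hy⟩ := exists_samePos h.compat z
  obtain ⟨a, ha1, ha2⟩ := Order.exists_between_finsets ((G.filter (fun g => g.1 < z)).image Prod.fst)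
    {z} (by
      simp only [Finset.mem_image, Finset.mem_filter, Finset.mem_singleton]
      rintro _ ⟨a, ⟨ha, hax⟩, rfl⟩ _ rfl
      exact hax)
  obtain ⟨b, hb1, hb2⟩ := Order.exists_between_finsets {z}
    ((G.filter (fun g => z < g.1)).image Prod.fst) (by
      simp only [Finset.mem_image, Finset.mem_filter, Finset.mem_singleton]
      rintro _ rfl _ ⟨a, ⟨ha, hax⟩, rfl⟩
      exact hax)
  simp only [Finset.mem_image, Finset.mem_filter, Finset.mem_singleton, forall_eq] at ha1 ha2 hb1 hb2
  refine hpu (eq_zero_of_infinite_isRoot _ ((Set.Ioo_infinite (ha2.trans hb1)).mono ?_))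
  rintro x ⟨hax, hxb⟩
  have hx : SamePos G x y := by
    intro g hg
    have h1 := hy g hg
    rcases lt_or_gt_of_ne (hcon g hg) with h | h
    · have h3 := (ha1 g.1 ⟨g, ⟨hg, h⟩, rfl⟩).trans hax
      rw [← h1.1, ← h1.2]
      exact ⟨iff_of_true h3 h, iff_of_false h3.not_gt h.not_gt⟩
    · have h3 := hxb.trans (hb2 g.1 ⟨g, ⟨hg, h⟩, rfl⟩)
      rw [← h1.1, ← h1.2]
      exact ⟨iff_of_false h3.not_gt h.not_gt, iff_of_true h3 h⟩
  have h2 := h.sign_eq z y hy p hp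
  rw [hz, sign_zero, ← h.sign_eq x y hx p hp] at h2
  exact sign_eq_zero_iff.1 h2.symm

theorem SignMatch.map_eq_zero (h : SignMatch u v 𝓟 G) {p : A[X]} (hp : p ∈ 𝓟)
    (hpu : p.map u = 0) : p.map v = 0 := by
  by_contra hpv
  refine hpv (eq_zero_of_infinite_isRoot _ (Set.infinite_univ.mono fun y _ => ?_))
  obtain ⟨x, hx⟩ := exists_samePos h.symm.compat y
  have := h.symm.sign_eq y x hx p hp
  rw [hpu, eval_zero, sign_zero] at this
  exact sign_eq_zero_iff.1 this

theorem SignMatch.shrink (hR : PolyIVT R) (h : SignMatch u v 𝓟 G) (hQ : 𝓠 ⊆ 𝓟) :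
    ∃ G' ⊆ G, SignMatch u v 𝓠 G' ∧ ∀ g ∈ G', ∃ q ∈ 𝓠, q.map u ≠ 0 ∧ q.map v ≠ 0 ∧
      (q.map u).eval g.1 = 0 ∧ (q.map v).eval g.2 = 0 := by
  classical
  refine ⟨G.filter fun g => ∃ q ∈ 𝓠, q.map u ≠ 0 ∧ (q.map u).eval g.1 = 0,
    Finset.filter_subset _ _, ⟨?_, ?_⟩, ?_⟩
  · intro g hg g' hg'
    exact h.compat g (Finset.mem_filter.1 hg).1 g' (Finset.mem_filter.1 hg').1
  · intro x y hxy q hq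
    obtain ⟨x₀, hx₀⟩ := exists_samePos h.symm.compat y
    replace hx₀ := hx₀.symm
    rw [image_swap_swap] at hx₀
    rw [← h.sign_eq x₀ y hx₀ q (hQ hq)]
    by_cases hqu : q.map u = 0
    · simp [hqu]
    have key : ∀ z, ((x ≤ z ∧ z ≤ x₀) ∨ (x₀ ≤ z ∧ z ≤ x)) → (q.map u).eval z = 0 →
        x = x₀ := by
      intro z hz hz0
      obtain ⟨g, hg, rfl⟩ := h.exists_mem_of_root (hQ hq) hqu hz0
      have h1 := hxy g (Finset.mem_filter.2 ⟨hg, q, hq, hqu, hz0⟩)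
      have h2 := hx₀ g hg
      have h3 := h1.1.trans h2.1.symm
      have h4 := h1.2.trans h2.2.symm
      rcases hz with hz | hz
      · have h5 : ¬ g.1 < x := not_lt.2 hz.1
        have h6 : ¬ x₀ < g.1 := not_lt.2 hz.2
        rw [h3] at h5; rw [← h4] at h6
        exact le_antisymm (hz.1.trans hz.2) ((not_lt.1 h5).trans (not_lt.1 h6))
      · have h5 : ¬ g.1 < x₀ := not_lt.2 hz.1
        have h6 : ¬ x < g.1 := not_lt.2 hz.2
        rw [← h3] at h5; rw [h4] at h6
        exact le_antisymm ((not_lt.1 h5).trans (not_lt.1 h6)) (hz.1.trans hz.2)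
    by_contra hne
    rcases le_total x x₀ with hle | hle
    · obtain ⟨z, h1, h2, h3⟩ := hR.exists_root_of_sign_ne _ hle hne
      exact hne (by rw [key z (Or.inl ⟨h1, h2⟩) h3])
    · obtain ⟨z, h1, h2, h3⟩ := hR.exists_root_of_sign_ne _ hle (Ne.symm hne)
      exact hne (by rw [key z (Or.inr ⟨h1, h2⟩) h3])
  · intro g hg
    obtain ⟨hg, q, hq, hqu, h0⟩ := Finset.mem_filter.1 hg
    refine ⟨q, hq, hqu, fun hqv => hqu (h.symm.map_eq_zero (hQ hq) hqv), h0, ?_⟩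
    have := h.sign_eq g.1 g.2 (h.compat g hg) q (hQ hq)
    rw [h0, sign_zero] at this
    exact sign_eq_zero_iff.1 this.symm

theorem exists_bounds_of_leadingCoeff_ne_zero {K : Type*} [Field K] [LinearOrder K]
    [IsStrictOrderedRing K] (w : A →+* K) (p : A[X]) (Z : Finset K) (hw : w p.leadingCoeff ≠ 0) :
    ∃ lo hi : K, lo < hi ∧ (∀ z ∈ Z, lo < z ∧ z < hi) ∧
      (∀ x, hi ≤ x → SignType.sign ((p.map w).eval x) = SignType.sign (w p.leadingCoeff)) ∧
      (∀ x, x ≤ lo → SignType.sign ((p.map w).eval x) =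
        (-1) ^ p.natDegree * SignType.sign (w p.leadingCoeff)) := by
  classical
  obtain ⟨M, hM⟩ := exists_forall_ge_sign_eval_eq (p.map w)
  obtain ⟨M', hM'⟩ := exists_forall_le_neg_sign_eval_eq (p.map w)
  obtain ⟨B, hB⟩ := (Z ∪ {0}).exists_le
  obtain ⟨B', hB'⟩ := (Z ∪ {0}).bddBelow
  replace hB' : ∀ z ∈ Z ∪ {0}, B' ≤ z := fun z hz => hB' hz
  simp only [Finset.mem_union, Finset.mem_singleton] at hB hB'
  have h0 := hB 0 (Or.inr rfl)
  have h0' := hB' 0 (Or.inr rfl)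
  refine ⟨min (B' - 1) (-M'), max (B + 1) M, ?_, ?_, ?_, ?_⟩
  · exact ((min_le_left _ _).trans_lt (by linarith)).trans_le (le_max_left _ _)
  · intro z hz
    exact ⟨(min_le_left _ _).trans_lt (by linarith [hB' z (Or.inl hz)]),
      lt_of_lt_of_le (by linarith [hB z (Or.inl hz)]) (le_max_left _ _)⟩
  · intro x hx
    rw [hM x ((le_max_right _ _).trans hx), leadingCoeff_map_of_leadingCoeff_ne_zero _ hw]
  · intro x hx
    rw [hM' x (hx.trans (min_le_right _ _)), leadingCoeff_map_of_leadingCoeff_ne_zero _ hw,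
      natDegree_map_of_leadingCoeff_ne_zero _ hw, sign_mul, sign_pow, Left.sign_neg, sign_one]

/-- Adding to `G` pairs of points beyond which the sign of `p` is known. -/
theorem SignMatch.exists_bounds (h : SignMatch u v 𝓟 G) {p : A[X]}
    (hu : u p.leadingCoeff ≠ 0)
    (hl : SignType.sign (u p.leadingCoeff) = SignType.sign (v p.leadingCoeff))
    (hG : ∀ g ∈ G, SignType.sign ((p.map u).eval g.1) = SignType.sign ((p.map v).eval g.2)) :
    ∃ G', SignMatch u v 𝓟 G' ∧
      (∀ g ∈ G', SignType.sign ((p.map u).eval g.1) = SignType.sign ((p.map v).eval g.2)) ∧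
      ∀ x y, SamePos G' x y → ((∀ g ∈ G', g.1 < x) ∨ (∀ g ∈ G', x < g.1)) →
        SignType.sign ((p.map u).eval x) = SignType.sign ((p.map v).eval y) ∧
        (p.map u).eval x ≠ 0 := by
  classical
  have hv : v p.leadingCoeff ≠ 0 := by
    rw [← sign_ne_zero] at hu ⊢
    rwa [← hl]
  obtain ⟨a, b, hab, hZ, hb, ha⟩ :=
    exists_bounds_of_leadingCoeff_ne_zero u p (G.image Prod.fst) hu
  obtain ⟨a', b', hab', hZ', hb', ha'⟩ :=
    exists_bounds_of_leadingCoeff_ne_zero v p (G.image Prod.snd) hv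
  simp only [Finset.mem_image, forall_exists_index, and_imp, forall_apply_eq_imp_iff₂] at hZ hZ'
  have nonzero : ∀ x, x ≤ a ∨ b ≤ x → (p.map u).eval x ≠ 0 := by
    rintro x hx h0
    have h1 : SignType.sign (u p.leadingCoeff) ≠ 0 := sign_ne_zero.2 hu
    rcases hx with hx | hx
    · have h2 := ha x hx
      rw [h0, sign_zero] at h2
      rcases neg_one_pow_eq_or SignType p.natDegree with h3 | h3
      · rw [h3, one_mul] at h2; exact h1 h2.symm
      · rw [h3, neg_one_mul] at h2; exact h1 (by rw [← neg_neg (SignType.sign _), ← h2]; rfl)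
    · have h2 := hb x hx
      rw [h0, sign_zero] at h2
      exact h1 h2.symm
  refine ⟨insert (a, a') (insert (b, b') G), ⟨?_, ?_⟩, ?_, ?_⟩
  · intro g hg g' hg'
    simp only [Finset.mem_insert] at hg hg'
    rcases hg with rfl | rfl | hg <;> rcases hg' with rfl | rfl | hg'
    · simp
    · simp [hab, hab', hab.not_gt, hab'.not_gt]
    · have h1 := hZ g' hg'; have h2 := hZ' g' hg'
      simp [h1.1, h2.1, h1.1.not_gt, h2.1.not_gt]
    · simp [hab, hab', hab.not_gt, hab'.not_gt]
    · simp
    · have h1 := hZ g' hg'; have h2 := hZ' g' hg'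
      simp [h1.2, h2.2, h1.2.not_gt, h2.2.not_gt]
    · have h1 := hZ g hg; have h2 := hZ' g hg
      simp [h1.1, h2.1, h1.1.not_gt, h2.1.not_gt]
    · have h1 := hZ g hg; have h2 := hZ' g hg
      simp [h1.2, h2.2, h1.2.not_gt, h2.2.not_gt]
    · exact h.compat g hg g' hg'
  · intro x y hxy q hq
    exact h.sign_eq x y (fun g hg => hxy g (by simp [hg])) q hq
  · intro g hg
    simp only [Finset.mem_insert] at hg
    rcases hg with rfl | rfl | hg
    · rw [ha _ le_rfl, ha' _ le_rfl, hl]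
    · rw [hb _ le_rfl, hb' _ le_rfl, hl]
    · exact hG g hg
  · rintro x y hxy (hx | hx)
    · have h1 : b < x := hx (b, b') (by simp)
      have h2 : b' < y := (hxy (b, b') (by simp)).1.1 h1
      exact ⟨by rw [hb _ h1.le, hb' _ h2.le, hl], nonzero x (Or.inr h1.le)⟩
    · have h1 : x < a := hx (a, a') (by simp)
      have h2 : y < a' := (hxy (a, a') (by simp)).2.1 h1
      exact ⟨by rw [ha _ h1.le, ha' _ h2.le, hl], nonzero x (Or.inl h1.le)⟩

end SignMatching

section SignMatchingStep

open Polynomial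

variable {A R F : Type*} [LinearOrder R] [LinearOrder F] {G : Finset (R × F)}

theorem exists_neighbors {x : R} (h1 : ∃ g ∈ G, g.1 < x) (h2 : ∃ g ∈ G, x < g.1)
    (hx : ∀ g ∈ G, g.1 ≠ x) : ∃ a ∈ G, ∃ b ∈ G, a.1 < x ∧ x < b.1 ∧
      ∀ g ∈ G, g.1 ≤ a.1 ∨ b.1 ≤ g.1 := by
  obtain ⟨g₁, hg₁, hg₁x⟩ := h1
  obtain ⟨g₂, hg₂, hg₂x⟩ := h2
  obtain ⟨a, ha, hamax⟩ := Finset.exists_max_image (G.filter (fun g => g.1 < x)) (fun g => g.1)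
    ⟨g₁, Finset.mem_filter.2 ⟨hg₁, hg₁x⟩⟩
  obtain ⟨b, hb, hbmin⟩ := Finset.exists_min_image (G.filter (fun g => x < g.1)) (fun g => g.1)
    ⟨g₂, Finset.mem_filter.2 ⟨hg₂, hg₂x⟩⟩
  rw [Finset.mem_filter] at ha hb
  refine ⟨a, ha.1, b, hb.1, ha.2, hb.2, fun g hg => ?_⟩
  rcases lt_or_gt_of_ne (hx g hg) with h | h
  · exact Or.inl (hamax g (Finset.mem_filter.2 ⟨hg, h⟩))
  · exact Or.inr (hbmin g (Finset.mem_filter.2 ⟨hg, h⟩))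

theorem le_iff_le_of_compat (hG : ∀ g ∈ G, SamePos G g.1 g.2) {g g' : R × F} (hg : g ∈ G)
    (hg' : g' ∈ G) : g.1 ≤ g'.1 ↔ g.2 ≤ g'.2 := by
  rw [← not_lt, ← not_lt, (hG g hg g' hg').1]

theorem samePos_of_gap (hG : ∀ g ∈ G, SamePos G g.1 g.2) {a b : R × F} (ha : a ∈ G) (hb : b ∈ G)
    (hgap : ∀ g ∈ G, g.1 ≤ a.1 ∨ b.1 ≤ g.1) {x : R} {y : F} (hax : a.1 < x) (hxb : x < b.1)
    (hay : a.2 < y) (hyb : y < b.2) : SamePos G x y := by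
  intro g hg
  rcases hgap g hg with h | h
  · have h1 := h.trans_lt hax
    have h2 := ((le_iff_le_of_compat hG hg ha).1 h).trans_lt hay
    exact ⟨iff_of_true h1 h2, iff_of_false h1.not_gt h2.not_gt⟩
  · have h1 := hxb.trans_le h
    have h2 := hyb.trans_le ((le_iff_le_of_compat hG hb hg).1 h)
    exact ⟨iff_of_false h1.not_gt h2.not_gt, iff_of_true h1 h2⟩

variable [CommRing A] [Field R] [IsStrictOrderedRing R] [Field F] [IsStrictOrderedRing F]
  {u : A →+* R} {v : A →+* F} {𝓟 : Finset A[X]} {p : A[X]}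

theorem SignMatch.exists_between_roots (hR : PolyIVT R) (h : SignMatch u v 𝓟 G)
    (hp : derivative p ∈ 𝓟) (hu : (derivative p).map u ≠ 0) {x x' : R} (hxx' : x < x')
    (hx : (p.map u).eval x = 0) (hx' : (p.map u).eval x' = 0) :
    ∃ g ∈ G, x < g.1 ∧ g.1 < x' := by
  obtain ⟨c, h1, h2, h3⟩ := hR.rolle _ hxx' hx hx'
  rw [derivative_map] at h3
  obtain ⟨g, hg, rfl⟩ := h.exists_mem_of_root hp hu h3
  exact ⟨g, hg, h1, h2⟩

theorem SignMatch.exists_root_in_gap (hR : PolyIVT R) (hF : PolyIVT F) (h : SignMatch u v 𝓟 G)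
    (hp : derivative p ∈ 𝓟) (hu : (derivative p).map u ≠ 0)
    (hG : ∀ g ∈ G, SignType.sign ((p.map u).eval g.1) = SignType.sign ((p.map v).eval g.2))
    {a b : R × F} (ha : a ∈ G) (hb : b ∈ G) (hgap : ∀ g ∈ G, g.1 ≤ a.1 ∨ b.1 ≤ g.1)
    {x : R} (hax : a.1 < x) (hxb : x < b.1) (hx : (p.map u).eval x = 0) :
    ∃ y, a.2 < y ∧ y < b.2 ∧ (p.map v).eval y = 0 := by
  have hlt := hR.sign_change_of_root (p.map u) hax hxb hx (by
    intro c hac hcb hc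
    rw [derivative_map] at hc
    obtain ⟨g, hg, rfl⟩ := h.exists_mem_of_root hp hu hc
    rcases hgap g hg with h1 | h1
    · exact absurd hac (not_lt.2 h1)
    · exact absurd hcb (not_lt.2 h1))
  refine hF _ _ _ ((h.compat b hb a ha).1.1 (hax.trans hxb)) ?_
  rwa [← sign_eq_neg_one_iff, sign_mul, ← hG a ha, ← hG b hb, ← sign_mul, sign_eq_neg_one_iff]

theorem SignMatch.lt_of_root_pairs (hR : PolyIVT R) (h : SignMatch u v 𝓟 G)
    (hp : derivative p ∈ 𝓟) (hu : (derivative p).map u ≠ 0) {x x' : R} {y y' : F}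
    (hx : (p.map u).eval x = 0) (hx' : (p.map u).eval x' = 0)
    (hxy : SamePos G x y) (hxy' : SamePos G x' y') (hlt : x < x') : y < y' := by
  obtain ⟨g, hg, h1, h2⟩ := h.exists_between_roots hR hp hu hlt hx hx'
  exact ((hxy g hg).2.1 h1).trans ((hxy' g hg).1.1 h2)

theorem SignMatch.sign_eq_left_or_right (hR : PolyIVT R) (h : SignMatch u v 𝓟 G)
    (hp : derivative p ∈ 𝓟) (hu : (derivative p).map u ≠ 0)
    {a b : R × F} (hgap : ∀ g ∈ G, g.1 ≤ a.1 ∨ b.1 ≤ g.1) {x : R} (hax : a.1 < x) (hxb : x < b.1)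
    (hx : (p.map u).eval x ≠ 0) :
    SignType.sign ((p.map u).eval x) = SignType.sign ((p.map u).eval a.1) ∨
    SignType.sign ((p.map u).eval x) = SignType.sign ((p.map u).eval b.1) := by
  by_contra! hcon
  obtain ⟨z, h1, h2, h3⟩ := hR.exists_root_of_sign_ne _ hax.le hcon.1.symm
  obtain ⟨z', h1', h2', h3'⟩ := hR.exists_root_of_sign_ne _ hxb.le hcon.2
  have h4 : z ≠ x := by rintro rfl; exact hx h3
  have h4' : z' ≠ x := by rintro rfl; exact hx h3'
  obtain ⟨g, hg, h5, h6⟩ := h.exists_between_roots hR hp hu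
    ((lt_of_le_of_ne h2 h4).trans (lt_of_le_of_ne h1' h4'.symm)) h3 h3'
  rcases hgap g hg with h7 | h7
  · exact absurd (h1.trans_lt h5) (not_lt.2 h7)
  · exact absurd (h6.trans_le h2') (not_lt.2 h7)

theorem SignMatch.sign_left_right_aux (hR : PolyIVT R) (hF : PolyIVT F) (h : SignMatch u v 𝓟 G)
    (hp : derivative p ∈ 𝓟) (hu : (derivative p).map u ≠ 0) (hv : (derivative p).map v ≠ 0)
    (hG : ∀ g ∈ G, SignType.sign ((p.map u).eval g.1) = SignType.sign ((p.map v).eval g.2))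
    {a b : R × F} (ha : a ∈ G) (hb : b ∈ G) (hgap : ∀ g ∈ G, g.1 ≤ a.1 ∨ b.1 ≤ g.1)
    {x : R} {y : F} (hax : a.1 < x) (hxb : x < b.1) (hay : a.2 < y) (hyb : y < b.2)
    (hx : (p.map u).eval x ≠ 0) (hy : (p.map v).eval y ≠ 0)
    (hpair : ∀ x' y', (p.map u).eval x' = 0 → (p.map v).eval y' = 0 → SamePos G x' y' →
      (x < x' ↔ y < y'))
    (h1 : SignType.sign ((p.map u).eval x) = SignType.sign ((p.map u).eval a.1))
    (h2 : SignType.sign ((p.map v).eval y) = SignType.sign ((p.map v).eval b.2)) :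
    SignType.sign ((p.map u).eval x) = SignType.sign ((p.map v).eval y) := by
  by_contra hne
  obtain ⟨z, hxz, hzb, hz⟩ := hR.exists_root_of_sign_ne (p.map u) hxb.le (by
    rwa [hG b hb, ← h2])
  obtain ⟨w, haw, hwy, hw⟩ := hF.exists_root_of_sign_ne (p.map v) hay.le (by
    rwa [← hG a ha, ← h1])
  have hxz' : x < z := lt_of_le_of_ne hxz (by rintro rfl; exact hx hz)
  have hwy' : w < y := lt_of_le_of_ne hwy (by rintro rfl; exact hy hw)
  have hzb' : z < b.1 := by
    refine lt_of_le_of_ne hzb ?_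
    rintro rfl
    have h3 := hG b hb
    rw [hz, sign_zero, ← h2] at h3
    exact hy (sign_eq_zero_iff.1 h3.symm)
  obtain ⟨y', h3, h4, h5⟩ := h.exists_root_in_gap hR hF hp hu hG ha hb hgap (hax.trans hxz') hzb' hz
  have h6 := (hpair z y' hz h5
    (samePos_of_gap h.compat ha hb hgap (hax.trans hxz') hzb' h3 h4)).1 hxz'
  obtain ⟨g, hg, h7, h8⟩ := h.symm.exists_between_roots hF hp hv (hwy'.trans h6) hw h5
  obtain ⟨g, hg', rfl⟩ := Finset.mem_image.1 hg
  simp only [Prod.fst_swap] at h7 h8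
  rcases hgap g hg' with h9 | h9
  · rw [le_iff_le_of_compat h.compat hg' ha] at h9
    exact absurd (haw.trans_lt h7) (not_lt.2 h9)
  · rw [le_iff_le_of_compat h.compat hb hg'] at h9
    exact absurd (h8.trans h4) (not_lt.2 h9)

theorem SignMatch.insert_of_bounds (hR : PolyIVT R) (hF : PolyIVT F) (h : SignMatch u v 𝓟 G)
    (hp : derivative p ∈ 𝓟) (hu : (derivative p).map u ≠ 0)
    (hG : ∀ g ∈ G, SignType.sign ((p.map u).eval g.1) = SignType.sign ((p.map v).eval g.2))
    (hout : ∀ x y, SamePos G x y → ((∀ g ∈ G, g.1 < x) ∨ (∀ g ∈ G, x < g.1)) →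
        SignType.sign ((p.map u).eval x) = SignType.sign ((p.map v).eval y)) 
    [DecidableEq A[X]] :
    ∃ G', SignMatch u v (insert p 𝓟) G' := by
  classical
  have hv : (derivative p).map v ≠ 0 := fun hv => hu (h.symm.map_eq_zero hp hv)
  have hpu : p.map u ≠ 0 := by rintro h0; rw [← derivative_map, h0] at hu; simp at hu
  have hpv : p.map v ≠ 0 := by rintro h0; rw [← derivative_map, h0] at hv; simp at hv
  let Z : Finset (R × F) := ((p.map u).roots.toFinset ×ˢ (p.map v).roots.toFinset).filter
    (fun g => SamePos G g.1 g.2)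
  have hZ : ∀ g, g ∈ Z ↔ (p.map u).eval g.1 = 0 ∧ (p.map v).eval g.2 = 0 ∧ SamePos G g.1 g.2 := by
    intro g
    simp [Z, hpu, hpv, and_assoc]
  have hGs : ∀ g ∈ G.image Prod.swap,
      SignType.sign ((p.map v).eval g.1) = SignType.sign ((p.map u).eval g.2) := by
    intro g hg
    obtain ⟨g', hg', rfl⟩ := Finset.mem_image.1 hg
    exact (hG g' hg').symm
  have hlt : ∀ g ∈ Z, ∀ g' ∈ Z, g.1 < g'.1 ↔ g.2 < g'.2 := by
    intro g hg g' hg'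
    rw [hZ] at hg hg'
    exact ⟨h.lt_of_root_pairs hR hp hu hg.1 hg'.1 hg.2.2 hg'.2.2,
      h.symm.lt_of_root_pairs hF hp hv hg.2.1 hg'.2.1 hg.2.2.symm hg'.2.2.symm⟩
  refine ⟨G ∪ Z, ⟨?_, ?_⟩⟩
  · intro g hg g' hg'
    rcases Finset.mem_union.1 hg with hg | hg <;> rcases Finset.mem_union.1 hg' with hg' | hg'
    · exact h.compat g hg g' hg'
    · exact (((hZ g').1 hg').2.2 g hg).symm
    · exact (((hZ g).1 hg).2.2 g' hg')
    · exact ⟨hlt g' hg' g hg, hlt g hg g' hg'⟩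
  · intro x y hxy q hq
    have hxyG : SamePos G x y := fun g hg => hxy g (Finset.mem_union_left _ hg)
    rcases Finset.mem_insert.1 hq with rfl | hq
    swap
    · exact h.sign_eq x y hxyG q hq
    by_cases hx : ∃ g ∈ G ∪ Z, g.1 = x
    · obtain ⟨g, hg, rfl⟩ := hx
      have h1 := hxy g hg
      have hy : g.2 = y := le_antisymm (not_lt.1 fun h2 => lt_irrefl _ (h1.2.2 h2))
        (not_lt.1 fun h2 => lt_irrefl _ (h1.1.2 h2))
      subst hy
      rcases Finset.mem_union.1 hg with hg | hg
      · exact hG g hg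
      · rw [hZ] at hg
        rw [hg.1, hg.2.1, sign_zero, sign_zero]
    push Not at hx
    by_cases hlo : ∀ g ∈ G, g.1 < x
    · exact hout x y hxyG (Or.inl hlo)
    by_cases hhi : ∀ g ∈ G, x < g.1
    · exact hout x y hxyG (Or.inr hhi)
    push Not at hlo hhi
    have hxG : ∀ g ∈ G, g.1 ≠ x := fun g hg => hx g (Finset.mem_union_left _ hg)
    obtain ⟨g₁, hg₁, hg₁x⟩ := hlo
    obtain ⟨g₂, hg₂, hg₂x⟩ := hhi
    obtain ⟨a, ha, b, hb, hax, hxb, hgap⟩ := exists_neighbors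
      ⟨g₂, hg₂, lt_of_le_of_ne hg₂x (hxG g₂ hg₂)⟩ ⟨g₁, hg₁, lt_of_le_of_ne hg₁x (hxG g₁ hg₁).symm⟩ hxG
    have hay := (hxyG a ha).1.1 hax
    have hyb := (hxyG b hb).2.1 hxb
    have ha' : a.swap ∈ G.image Prod.swap := Finset.mem_image_of_mem _ ha
    have hb' : b.swap ∈ G.image Prod.swap := Finset.mem_image_of_mem _ hb
    have hgap' : ∀ g ∈ G.image Prod.swap, g.1 ≤ a.swap.1 ∨ b.swap.1 ≤ g.1 := by
      intro g hg
      obtain ⟨g', hg', rfl⟩ := Finset.mem_image.1 hg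
      simp only [Prod.fst_swap]
      rw [← le_iff_le_of_compat h.compat hg' ha, ← le_iff_le_of_compat h.compat hb hg']
      exact hgap g' hg'
    have hx0 : (q.map u).eval x ≠ 0 := by
      intro h0
      obtain ⟨y', h1, h2, h3⟩ := h.exists_root_in_gap hR hF hp hu hG ha hb hgap hax hxb h0
      exact hx (x, y') (Finset.mem_union_right _ ((hZ _).2 ⟨h0, h3,
        samePos_of_gap h.compat ha hb hgap hax hxb h1 h2⟩)) rfl
    have hy0 : (q.map v).eval y ≠ 0 := by
      intro h0
      obtain ⟨x', h1, h2, h3⟩ := h.symm.exists_root_in_gap hF hR hp hv hGs ha' hb' hgap' hay hyb h0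
      have h4 : (x', y) ∈ G ∪ Z := Finset.mem_union_right _ ((hZ _).2 ⟨h3, h0,
        samePos_of_gap h.compat ha hb hgap h1 h2 hay hyb⟩)
      have h5 := hxy _ h4
      rcases lt_or_gt_of_ne (hx _ h4) with h6 | h6
      · exact lt_irrefl _ (h5.1.1 h6)
      · exact lt_irrefl _ (h5.2.1 h6)
    have hpair : ∀ x' y', (q.map u).eval x' = 0 → (q.map v).eval y' = 0 → SamePos G x' y' →
        (x < x' ↔ y < y') := fun x' y' h1 h2 h3 =>
      (hxy (x', y') (Finset.mem_union_right _ ((hZ _).2 ⟨h1, h2, h3⟩))).2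
    have hpair' : ∀ y' x', (q.map v).eval y' = 0 → (q.map u).eval x' = 0 →
        SamePos (G.image Prod.swap) y' x' → (y < y' ↔ x < x') := fun y' x' h1 h2 h3 => by
      have h4 := h3.symm
      rw [image_swap_swap] at h4
      exact (hpair x' y' h2 h1 h4).symm
    rcases h.sign_eq_left_or_right hR hp hu hgap hax hxb hx0 with h1 | h1 <;>
      rcases h.symm.sign_eq_left_or_right hF hp hv hgap' hay hyb hy0 with h2 | h2
    · rw [h1, h2, hG a ha]; rfl
    · exact h.sign_left_right_aux hR hF hp hu hv hG ha hb hgap hax hxb hay hyb hx0 hy0 hpair h1 h2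
    · exact (h.symm.sign_left_right_aux hF hR hp hv hu hGs ha' hb' hgap' hay hyb hax hxb hy0 hx0
        hpair' h2 h1).symm
    · rw [h1, h2, hG b hb]; rfl

end SignMatchingStep

section SignElimination

open Polynomial

variable {A : Type*} [CommRing A] [IsDomain A]

theorem exists_pseudo_division (q : A[X]) (hq : q ≠ 0) (p : A[X]) :
    ∃ (k : ℕ) (s r : A[X]), C (q.leadingCoeff ^ k) * p = q * s + r ∧ r.degree < q.degree := by
  induction hm : p.degree using WellFoundedLT.induction generalizing p with
  | ind m ih =>
    subst hm
    by_cases hd : p.degree < q.degree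
    · exact ⟨0, 0, p, by simp, hd⟩
    push Not at hd
    have hp : p ≠ 0 := by
      rintro rfl
      rw [degree_zero, le_bot_iff, degree_eq_bot] at hd
      exact hq hd
    have hlq : q.leadingCoeff ≠ 0 := leadingCoeff_ne_zero.2 hq
    have hlp : p.leadingCoeff ≠ 0 := leadingCoeff_ne_zero.2 hp
    have hdeg : (C q.leadingCoeff * p).degree = p.degree := degree_C_mul hlq
    have hlt : (C q.leadingCoeff * p - C p.leadingCoeff * X ^ (p.natDegree - q.natDegree) * q).degree
        < p.degree := by
      rw [← hdeg]
      apply degree_sub_lt_left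
      · rw [hdeg, mul_assoc, degree_C_mul hlp, degree_mul, degree_X_pow, degree_eq_natDegree hp,
          degree_eq_natDegree hq, ← Nat.cast_add, Nat.sub_add_cancel (natDegree_le_natDegree hd)]
      · exact mul_ne_zero (C_ne_zero.2 hlq) hp
      · rw [leadingCoeff_mul, leadingCoeff_mul, leadingCoeff_mul, leadingCoeff_C, leadingCoeff_C,
          leadingCoeff_X_pow, mul_one, mul_comm]
    obtain ⟨k, s, r, h1, h2⟩ := ih _ hlt _ rfl
    refine ⟨k + 1, s + C (q.leadingCoeff ^ k) * (C p.leadingCoeff *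
      X ^ (p.natDegree - q.natDegree)), r, ?_, h2⟩
    rw [pow_succ, C_mul]
    linear_combination h1

variable {R F : Type*} [Field R] [LinearOrder R] [IsStrictOrderedRing R]
  [Field F] [LinearOrder F] [IsStrictOrderedRing F]

theorem map_eraseLead_eq {S : Type*} [CommRing S] (w : A →+* S) {q : A[X]}
    (h : w q.leadingCoeff = 0) : q.eraseLead.map w = q.map w := by
  have h1 := congrArg (Polynomial.map w) (eraseLead_add_C_mul_X_pow q)
  rw [Polynomial.map_add, Polynomial.map_mul, map_C, h, C_0, zero_mul, add_zero] at h1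
  exact h1

theorem sign_eval_of_pseudo_division {p q s r : A[X]} {k : ℕ}
    (h1 : C (q.leadingCoeff ^ k) * p = q * s + r) (w : A →+* R) (z : R)
    (hw : w q.leadingCoeff ≠ 0) (hz : (q.map w).eval z = 0) :
    SignType.sign ((p.map w).eval z) =
      SignType.sign (((C (q.leadingCoeff ^ k) * r).map w).eval z) := by
  have h4 := congrArg (fun f => (f.map w).eval z) h1
  simp only [Polynomial.map_mul, Polynomial.map_add, eval_mul, eval_add, hz, zero_mul,
    zero_add, map_C, eval_C] at h4
  rw [Polynomial.map_mul, eval_mul, map_C, eval_C, ← h4, ← mul_assoc, sign_mul (_ * _) _,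
    sign_pos (mul_self_pos.2 (by rw [map_pow]; exact pow_ne_zero _ hw)), one_mul]

/-- Reduce the sign of `p` at roots of `q` to the sign of a polynomial of smaller degree. -/
theorem exists_remainder (v : A →+* F) (p : A[X]) {D : ℕ} (q : A[X]) (hq : q.natDegree ≤ D + 1) :
    ∃ (𝓠 : Finset A) (r : A[X]), r.natDegree ≤ D ∧ ∀ u : A →+* R,
      (∀ c ∈ 𝓠, SignType.sign (u c) = SignType.sign (v c)) → ∀ x y, q.map u ≠ 0 →
      (q.map u).eval x = 0 → (q.map v).eval y = 0 →
      SignType.sign ((p.map u).eval x) = SignType.sign ((r.map u).eval x) ∧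
      SignType.sign ((p.map v).eval y) = SignType.sign ((r.map v).eval y) := by
  classical
  induction hm : q.support.card using Nat.strong_induction_on generalizing q with
  | _ m ih =>
    subst hm
    by_cases hq0 : q = 0
    · refine ⟨∅, 0, by simp, fun u _ x y h => absurd (by simp [hq0]) h⟩
    by_cases hv : v q.leadingCoeff = 0
    · obtain ⟨𝓠, r, hr, h⟩ := ih _ (eraseLead_support_card_lt hq0) q.eraseLead
        ((eraseLead_natDegree_le_aux).trans hq) rfl
      refine ⟨insert q.leadingCoeff 𝓠, r, hr, fun u hu => ?_⟩
      have hu0 : u q.leadingCoeff = 0 := by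
        have := hu _ (Finset.mem_insert_self _ _)
        rwa [hv, sign_zero, sign_eq_zero_iff] at this
      rw [← map_eraseLead_eq u hu0, ← map_eraseLead_eq v hv]
      exact h u fun c hc => hu c (Finset.mem_insert_of_mem hc)
    · obtain ⟨k, s, r, h1, h2⟩ := exists_pseudo_division q hq0 p
      refine ⟨{q.leadingCoeff}, C (q.leadingCoeff ^ k) * r, ?_, fun u hu x y _ hx hy => ?_⟩
      · have h3 : (C (q.leadingCoeff ^ k) * r).natDegree ≤ r.natDegree := natDegree_C_mul_le _ _
        by_cases hr : r = 0
        · simp [hr]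
        · have := natDegree_lt_natDegree hr h2
          omega
      have hu0 : u q.leadingCoeff ≠ 0 := by
        intro h0
        have := hu _ (Finset.mem_singleton_self _)
        rw [h0, sign_zero, eq_comm, sign_eq_zero_iff] at this
        exact hv this
      exact ⟨sign_eval_of_pseudo_division h1 u x hu0 hx, sign_eval_of_pseudo_division h1 v y hv hy⟩

theorem exists_signMatch (hR : PolyIVT R) (hF : PolyIVT F) (v : A →+* F) (D : ℕ)
    (𝓟 : Finset A[X]) (hD : ∀ p ∈ 𝓟, p.natDegree ≤ D) :
    ∃ 𝓠 : Finset A, ∀ u : A →+* R,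
      (∀ c ∈ 𝓠, SignType.sign (u c) = SignType.sign (v c)) → ∃ G, SignMatch u v 𝓟 G := by
  classical
  induction D generalizing 𝓟 with
  | zero =>
    refine ⟨𝓟.image fun p => p.coeff 0, fun u hu => ⟨∅, by simp, fun x y _ p hp => ?_⟩⟩
    rw [eq_C_of_natDegree_le_zero (hD p hp)]
    simpa using hu _ (Finset.mem_image_of_mem _ hp)
  | succ D ihD =>
    suffices H : ∀ 𝓗 𝓛 : Finset A[X], (∀ p ∈ 𝓗, p.natDegree ≤ D + 1) → (∀ p ∈ 𝓛, p.natDegree ≤ D) →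
        ∃ 𝓠 : Finset A, ∀ u : A →+* R,
          (∀ c ∈ 𝓠, SignType.sign (u c) = SignType.sign (v c)) → ∃ G, SignMatch u v (𝓗 ∪ 𝓛) G by
      simpa using H 𝓟 ∅ hD (by simp)
    intro 𝓗
    induction 𝓗 using Finset.induction_on with
    | empty => intro 𝓛 _ h; simpa using ihD 𝓛 h
    | insert p 𝓗 _ ih =>
      intro 𝓛 hH hL
      have hH' := fun q hq => hH q (Finset.mem_insert_of_mem hq)
      have hpD := hH p (Finset.mem_insert_self _ _)
      by_cases hlt : p.natDegree ≤ D
      · obtain ⟨𝓠, h⟩ := ih (insert p 𝓛) hH' (by simpa using ⟨hlt, hL⟩)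
        refine ⟨𝓠, fun u hu => ?_⟩
        rw [Finset.insert_union, ← Finset.union_insert]
        exact h u hu
      have hpD' : p.natDegree = D + 1 := by omega
      by_cases hv : v p.leadingCoeff = 0
      · obtain ⟨𝓠, h⟩ := ih (insert p.eraseLead 𝓛) hH' (by
          simp only [Finset.mem_insert, forall_eq_or_imp]
          exact ⟨(eraseLead_natDegree_le p).trans (by omega), hL⟩)
        refine ⟨insert p.leadingCoeff 𝓠, fun u hu => ?_⟩
        obtain ⟨G, hG⟩ := h u fun c hc => hu c (Finset.mem_insert_of_mem hc)
        have hu0 : u p.leadingCoeff = 0 := by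
          have := hu _ (Finset.mem_insert_self _ _)
          rwa [hv, sign_zero, sign_eq_zero_iff] at this
        refine ⟨G, hG.compat, fun x y hxy q hq => ?_⟩
        rw [Finset.insert_union, Finset.mem_insert] at hq
        rcases hq with rfl | hq
        · rw [← map_eraseLead_eq u hu0, ← map_eraseLead_eq v hv]
          exact hG.sign_eq x y hxy _ (by simp)
        · exact hG.sign_eq x y hxy q (by
            rw [Finset.union_insert]; exact Finset.mem_insert_of_mem hq)
      have hder : (derivative p).natDegree ≤ D := by
        have := natDegree_derivative_lt (p := p) (by omega)
        omega
      choose! 𝓔 r hr hrem using fun (q : A[X]) (hq : q.natDegree ≤ D + 1) =>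
        exists_remainder (R := R) v p q hq
      have h𝓕 : ∀ q ∈ 𝓗 ∪ insert (derivative p) 𝓛, q.natDegree ≤ D + 1 := by
        intro q hq
        rcases Finset.mem_union.1 hq with hq | hq
        · exact hH' q hq
        · rcases Finset.mem_insert.1 hq with rfl | hq
          · omega
          · exact (hL q hq).trans (by omega)
      obtain ⟨𝓠, h⟩ := ih (insert (derivative p) 𝓛 ∪
          (𝓗 ∪ insert (derivative p) 𝓛).image r) hH' (by
        intro q hq
        rcases Finset.mem_union.1 hq with hq | hq
        · rcases Finset.mem_insert.1 hq with rfl | hq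
          · exact hder
          · exact hL q hq
        · obtain ⟨q', hq', rfl⟩ := Finset.mem_image.1 hq
          exact hr q' (h𝓕 q' hq'))
      refine ⟨insert p.leadingCoeff (𝓠 ∪ (𝓗 ∪ insert (derivative p) 𝓛).biUnion 𝓔), fun u hu => ?_⟩
      have hsl := hu _ (Finset.mem_insert_self _ _)
      have hu0 : u p.leadingCoeff ≠ 0 := by
        intro h0
        rw [h0, sign_zero, eq_comm, sign_eq_zero_iff] at hsl
        exact hv hsl
      obtain ⟨G, hG⟩ := h u fun c hc => hu c (Finset.mem_insert_of_mem (Finset.mem_union_left _ hc))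
      obtain ⟨G₁, hsub, hG₁, hroots⟩ := hG.shrink hR (𝓠 := 𝓗 ∪ insert (derivative p) 𝓛) (by
        rw [← Finset.union_assoc]; exact Finset.subset_union_left)
      have hp₁ : ∀ g ∈ G₁, SignType.sign ((p.map u).eval g.1) =
          SignType.sign ((p.map v).eval g.2) := by
        intro g hg
        obtain ⟨q, hq, hqu, hqv, e1, e2⟩ := hroots g hg
        obtain ⟨h1, h2⟩ := hrem q (h𝓕 q hq) u (fun c hc => hu c (Finset.mem_insert_of_mem
          (Finset.mem_union_right _ (Finset.mem_biUnion.2 ⟨q, hq, hc⟩)))) g.1 g.2 hqu e1 e2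
        rw [h1, h2]
        refine hG.sign_eq _ _ (hG.compat g (hsub hg)) _ (Finset.mem_union_right _
          (Finset.mem_union_right _ (Finset.mem_image_of_mem _ hq)))
      obtain ⟨G₂, hG₂, hp₂, hout⟩ := hG₁.exists_bounds hu0 hsl hp₁
      have hder0 : (derivative p).map u ≠ 0 := by
        intro h0
        have h1 := congrArg (fun f => f.coeff D) h0
        simp only [coeff_map, coeff_derivative, coeff_zero, map_mul, ← hpD', map_add, map_natCast,
          map_one] at h1
        exact mul_ne_zero hu0 (by positivity) h1
      obtain ⟨G₃, hG₃⟩ := hG₂.insert_of_bounds hR hF (by simp) hder0 hp₂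
        fun x y hxy h => (hout x y hxy h).1
      refine ⟨G₃, hG₃.compat, fun x y hxy q hq => hG₃.sign_eq x y hxy q ?_⟩
      simp only [Finset.mem_insert, Finset.mem_union] at hq ⊢
      tauto

end SignElimination

section ArtinLang

theorem polyIVT_real : PolyIVT ℝ := by
  intro f a b hab hf
  have hc : ContinuousOn (fun x => f.eval x) (Set.Icc a b) := f.continuous.continuousOn
  rcases mul_neg_iff.1 hf with ⟨h1, h2⟩ | ⟨h1, h2⟩
  · obtain ⟨c, hc, h⟩ := intermediate_value_Ioo' hab.le hc ⟨h2, h1⟩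
    exact ⟨c, hc.1, hc.2, h⟩
  · obtain ⟨c, hc, h⟩ := intermediate_value_Ioo hab.le hc ⟨h1, h2⟩
    exact ⟨c, hc.1, hc.2, h⟩

variable {F : Type*} [Field F] [LinearOrder F] [IsStrictOrderedRing F]

theorem map_real_nonneg (i : ℝ →+* F) {r : ℝ} (hr : 0 ≤ r) : 0 ≤ i r := by
  rw [← Real.mul_self_sqrt hr, map_mul]
  exact mul_self_nonneg _

theorem map_real_strictMono (i : ℝ →+* F) : StrictMono i := fun a b h => by
  have h1 := map_real_nonneg i (sub_nonneg.2 h.le)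
  rw [map_sub, sub_nonneg] at h1
  exact lt_of_le_of_ne h1 fun h2 => h.ne (i.injective h2)

theorem sign_map_real (i : ℝ →+* F) (r : ℝ) : SignType.sign (i r) = SignType.sign r := by
  rcases lt_trichotomy r 0 with h | h | h
  · rw [sign_neg h, sign_neg (by simpa using map_real_strictMono i h)]
  · simp [h]
  · rw [sign_pos h, sign_pos (by simpa using map_real_strictMono i h)]

theorem eval₂_eq_eval_map_finSuccEquiv (i : ℝ →+* F) {m : ℕ} (x : Fin (m + 1) → F)
    (p : MvPolynomial (Fin (m + 1)) ℝ) :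
    MvPolynomial.eval₂ i x p = Polynomial.eval (x 0) (Polynomial.map
      (MvPolynomial.eval₂Hom i fun j => x j.succ) (MvPolynomial.finSuccEquiv ℝ m p)) := by
  induction p using MvPolynomial.induction_on with
  | C a => simp [MvPolynomial.finSuccEquiv_apply]
  | add p q hp hq => simp [hp, hq]
  | mul_X p j hp =>
    rw [MvPolynomial.eval₂_mul, hp, map_mul, Polynomial.map_mul, Polynomial.eval_mul]
    congr 1
    refine Fin.cases ?_ (fun k => ?_) j
    · rw [MvPolynomial.eval₂_X, MvPolynomial.finSuccEquiv_X_zero, Polynomial.map_X, Polynomial.eval_X]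
    · rw [MvPolynomial.eval₂_X, MvPolynomial.finSuccEquiv_X_succ, Polynomial.map_C, Polynomial.eval_C,
        MvPolynomial.coe_eval₂Hom, MvPolynomial.eval₂_X]

theorem exists_real_point_fin (hF : PolyIVT F) (i : ℝ →+* F) (m : ℕ)
    (𝓟 : Finset (MvPolynomial (Fin m) ℝ)) (x : Fin m → F) : ∃ y : Fin m → ℝ, ∀ p ∈ 𝓟,
    SignType.sign (MvPolynomial.eval y p) = SignType.sign (MvPolynomial.eval₂ i x p) := by
  classical
  induction m with
  | zero =>
    refine ⟨Fin.elim0, fun p _ => ?_⟩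
    obtain ⟨c, rfl⟩ := MvPolynomial.C_surjective (Fin 0) p
    simp [sign_map_real]
  | succ m ih =>
    set v : MvPolynomial (Fin m) ℝ →+* F := MvPolynomial.eval₂Hom i fun j => x j.succ with hv
    obtain ⟨𝓠, h𝓠⟩ := exists_signMatch polyIVT_real hF v _
      (𝓟.image (MvPolynomial.finSuccEquiv ℝ m)) fun p hp =>
        Finset.le_sup (f := Polynomial.natDegree) hp
    obtain ⟨y, hy⟩ := ih 𝓠 fun j => x j.succ
    obtain ⟨G, hG⟩ := h𝓠 (MvPolynomial.eval y) hy
    obtain ⟨y₀, hy₀⟩ := exists_samePos hG.symm.compat (x 0)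
    have hs := hy₀.symm
    rw [image_swap_swap] at hs
    refine ⟨Fin.cons y₀ y, fun p hp => ?_⟩
    rw [eval₂_eq_eval_map_finSuccEquiv, MvPolynomial.eval_eq_eval_mv_eval']
    exact hG.sign_eq _ _ hs _ (Finset.mem_image_of_mem _ hp)

/-- A transfer principle for finitely many polynomial sign conditions. -/
theorem exists_real_point (hF : PolyIVT F) (i : ℝ →+* F) {σ : Type*} [Finite σ]
    (𝓟 : Finset (MvPolynomial σ ℝ)) (x : σ → F) : ∃ y : σ → ℝ, ∀ p ∈ 𝓟,
    SignType.sign (MvPolynomial.eval y p) = SignType.sign (MvPolynomial.eval₂ i x p) := by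
  classical
  obtain ⟨m, ⟨e⟩⟩ := Finite.exists_equiv_fin σ
  obtain ⟨y, hy⟩ := exists_real_point_fin hF i m (𝓟.image (MvPolynomial.rename e)) (x ∘ e.symm)
  refine ⟨y ∘ e, fun p hp => ?_⟩
  have := hy _ (Finset.mem_image_of_mem _ hp)
  rw [MvPolynomial.eval_rename, MvPolynomial.eval₂_rename] at this
  rw [this]
  congr 2
  ext j; simp

end ArtinLang

section DiagonalForm

variable {ι : Type*} [Fintype ι] [DecidableEq ι]

theorem exists_eq_transpose_diagonal_mul {K : Type*} [Field K] [CharZero K] (G : Matrix ι ι K)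
    (hG : Gᵀ = G) : ∃ (W : Matrix ι ι K) (d : ι → K), G = Wᵀ * diagonal d * W ∧
      ∀ k, ∃ x : ι → K, d k = x ⬝ᵥ G *ᵥ x := by
  let _ : Invertible (2 : K) := invertibleOfNonzero two_ne_zero
  have hB : LinearMap.IsSymm (Matrix.toBilin' G) := by
    refine ⟨fun x y => ?_⟩
    rw [Matrix.toBilin'_apply', Matrix.toBilin'_apply', dotProduct_mulVec, ← mulVec_transpose, hG,
      dotProduct_comm, RingHom.id_apply]
  obtain ⟨b', hb'⟩ := LinearMap.BilinForm.exists_orthogonal_basis hB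
  let b := b'.reindex (Fintype.equivOfCardEq (by simp) : Fin (Module.finrank K (ι → K)) ≃ ι)
  have hb : ∀ i j, i ≠ j → b i ⬝ᵥ G *ᵥ b j = 0 := by
    intro i j hij
    rw [← Matrix.toBilin'_apply']
    simp only [b, Module.Basis.reindex_apply]
    exact hb' (fun h => hij (Equiv.injective _ h))
  let V : Matrix ι ι K := Matrix.of fun i j => b j i
  have hV : V = (Pi.basisFun K ι).toMatrix b := by
    ext i j; simp [V, Module.Basis.toMatrix_apply]
  let W := b.toMatrix (Pi.basisFun K ι)
  have hVW : V * W = 1 := by rw [hV]; exact Module.Basis.toMatrix_mul_toMatrix_flip _ _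
  let d : ι → K := fun k => b k ⬝ᵥ G *ᵥ b k
  have hD : Vᵀ * G * V = diagonal d := by
    ext i j
    have h1 : (Vᵀ * G * V) i j = b i ⬝ᵥ G *ᵥ b j := by
      rw [Matrix.mul_assoc]
      simp [Matrix.mul_apply, dotProduct, mulVec, V]
    rw [h1, diagonal_apply]
    split_ifs with h
    · rw [h]
    · exact hb i j h
  refine ⟨W, d, ?_, fun k => ⟨b k, rfl⟩⟩
  calc G = (V * W)ᵀ * G * (V * W) := by rw [hVW]; simp
    _ = Wᵀ * (Vᵀ * G * V) * W := by rw [transpose_mul]; simp only [Matrix.mul_assoc]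
    _ = _ := by rw [hD]

theorem dotProduct_diagonal_form {K : Type*} [CommRing K] (W : Matrix ι ι K) (d x : ι → K) :
    x ⬝ᵥ (Wᵀ * diagonal d * W) *ᵥ x = ∑ k, d k * ((W *ᵥ x) k * (W *ᵥ x) k) := by
  rw [Matrix.mul_assoc, ← mulVec_mulVec, dotProduct_mulVec, ← mulVec_transpose, transpose_transpose,
    ← mulVec_mulVec]
  simp only [dotProduct, mulVec_diagonal]
  exact Finset.sum_congr rfl fun k _ => by ring

end DiagonalForm

section FieldOfPreordering

universe u

/-- A preordering of a commutative ring gives a homomorphism to a real closed field. -/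
theorem RingPreordering.exists_ringHom {C : Type u} [CommRing C] (P : RingPreordering C) :
    ∃ (F : Type u) (_ : Field F) (_ : LinearOrder F) (_ : IsStrictOrderedRing F) (φ : C →+* F),
      (∀ p ∈ P, 0 ≤ φ p) ∧ NoRealExtension F ∧
      ∀ (m : ℕ) (G : Matrix (Fin m) (Fin m) C), Gᵀ = G → (∀ c, c ⬝ᵥ G *ᵥ c ∈ P) →
        ∀ x : Fin m → F, 0 ≤ x ⬝ᵥ G.map φ *ᵥ x := by
  obtain ⟨O, hPO, hO⟩ := P.exists_le_isOrdering
  let K := FractionRing (C ⧸ O.support)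
  let ψ : C →+* K := (algebraMap (C ⧸ O.support) K).comp (Ideal.Quotient.mk O.support)
  have hψ0 : ∀ c, ψ c = 0 ↔ c ∈ O.support := fun c => by
    simp [ψ, Ideal.Quotient.eq_zero_iff_mem]
  have hψfrac : ∀ x : K, ∃ c b, ψ b ≠ 0 ∧ x * ψ b = ψ c := by
    intro x
    obtain ⟨c, b, hb, rfl⟩ := IsFractionRing.div_surjective (A := C ⧸ O.support) x
    obtain ⟨c, rfl⟩ := Ideal.Quotient.mk_surjective c
    obtain ⟨b, rfl⟩ := Ideal.Quotient.mk_surjective b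
    have hb' : ψ b ≠ 0 := by
      simpa [ψ] using nonZeroDivisors.ne_zero hb
    exact ⟨c, b, hb', div_mul_cancel₀ _ hb'⟩
  let Q : RingPreordering K := RingPreordering.mk' {x | ∃ p ∈ O, ∃ b, ψ b ≠ 0 ∧ x * (ψ b * ψ b) = ψ p}
    (by
      rintro x y ⟨p, hp, b, hb, h⟩ ⟨p', hp', b', hb', h'⟩
      refine ⟨p * (b' * b') + p' * (b * b), add_mem (mul_mem hp (O.mul_self_mem _))
        (mul_mem hp' (O.mul_self_mem _)), b * b', ?_, ?_⟩
      · rw [map_mul]; exact mul_ne_zero hb hb'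
      · simp only [map_mul, map_add, ← h, ← h']; ring)
    (by
      rintro x y ⟨p, hp, b, hb, h⟩ ⟨p', hp', b', hb', h'⟩
      refine ⟨p * p', mul_mem hp hp', b * b', ?_, ?_⟩
      · rw [map_mul]; exact mul_ne_zero hb hb'
      · simp only [map_mul, ← h, ← h']; ring)
    (by
      intro x
      obtain ⟨c, b, hb, h⟩ := hψfrac x
      exact ⟨c * c, O.mul_self_mem c, b, hb, by rw [map_mul, ← h]; ring⟩)
    (by
      rintro ⟨p, hp, b, hb, h⟩
      have h1 : ψ (p + b * b) = 0 := by rw [map_add, map_mul, ← h]; ring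
      rw [hψ0] at h1
      have h2 : b * b ∈ O.support := by
        refine ⟨O.mul_self_mem b, ?_⟩
        have := add_mem hp h1.2
        rwa [show p + -(p + b * b) = -(b * b) by ring] at this
      exact hb ((hψ0 b).2 ((hO.toIsPrime.mem_or_mem h2).elim id id)))
  have hQ : ∀ p ∈ O, ψ p ∈ Q := fun p hp => ⟨p, hp, 1, by simp, by simp⟩
  obtain ⟨F, _, _, _, i, hi, hF⟩ := Q.exists_noRealExtension
  refine ⟨F, _, _, _, i.comp ψ, fun p hp => hi _ (hQ p (hPO hp)), hF, fun m G hG hGP x => ?_⟩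
  have : CharZero K := ⟨fun a b h => by
    have h' := congrArg i h
    rwa [map_natCast, map_natCast, Nat.cast_inj] at h'⟩
  obtain ⟨W, d, h1, h2⟩ := exists_eq_transpose_diagonal_mul (G.map ψ) (by rw [← transpose_map, hG])
  have hd : ∀ k, d k ∈ Q := by
    intro k
    obtain ⟨y, hy⟩ := h2 k
    choose c b hb hcb using fun j => hψfrac (y j)
    let e : C := ∏ j, b j
    have he : ψ e ≠ 0 := by
      simp only [e, map_prod]; exact Finset.prod_ne_zero_iff.2 fun j _ => hb j
    let c' : Fin m → C := fun j => c j * ∏ l ∈ Finset.univ.erase j, b l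
    have hc' : ∀ j, ψ (c' j) = y j * ψ e := fun j => by
      simp only [c', e, map_mul]
      rw [← hcb, ← Finset.mul_prod_erase Finset.univ b (Finset.mem_univ j), map_mul]; ring
    refine ⟨c' ⬝ᵥ G *ᵥ c', hPO (hGP c'), e, he, ?_⟩
    rw [hy]
    simp only [dotProduct, mulVec, map_sum, map_mul, hc', Finset.mul_sum, Finset.sum_mul, map_apply]
    exact Finset.sum_congr rfl fun j _ => Finset.sum_congr rfl fun l _ => by ring
  have h3 : G.map (i.comp ψ) = (W.map i)ᵀ * diagonal (fun k => i (d k)) * W.map i := by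
    rw [RingHom.coe_comp, ← Matrix.map_map, h1, Matrix.map_mul, Matrix.map_mul, transpose_map]
    rw [diagonal_map (map_zero i)]
  rw [h3, dotProduct_diagonal_form]
  exact Finset.sum_nonneg fun k _ => mul_nonneg (hi _ (hd k)) (mul_self_nonneg _)

end FieldOfPreordering

section SkewDeterminant

theorem apply_eq_neg_of_skew {K κ : Type*} [Ring K] {T : Matrix κ κ K} (hT : Tᵀ = -T) (i j : κ) :
    T i j = -T j i := by
  have := congrFun (congrFun hT j) i
  simpa using this

theorem exists_det_eq_mul_self_of_skew {K : Type*} [Field K] [CharZero K] (n : ℕ) :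
    ∀ {ι : Type*} [Fintype ι] [DecidableEq ι], Fintype.card ι = n →
    ∀ S : Matrix ι ι K, Sᵀ = -S → ∃ y, S.det = y * y := by
  induction n using Nat.strong_induction_on with
  | _ n ih =>
  intro ι _ _ hn S hS
  by_cases h0 : S = 0
  · subst h0
    rcases isEmpty_or_nonempty ι with h | h
    · exact ⟨1, by simp⟩
    · exact ⟨0, by simp [Matrix.det_zero]⟩
  obtain ⟨i, j, hij⟩ : ∃ i j, S i j ≠ 0 := by
    by_contra! hcon
    exact h0 (by ext i j; exact hcon i j)
  have hne : i ≠ j := by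
    rintro rfl
    have := apply_eq_neg_of_skew hS i i
    exact hij (self_eq_neg.1 this)
  let e := Equiv.sumCompl fun k => k = i ∨ k = j
  have hcard : Fintype.card {k // k = i ∨ k = j} = 2 := by
    rw [Fintype.card_subtype]
    have : (Finset.univ.filter fun k => k = i ∨ k = j) = {i, j} := by ext; simp
    rw [this, Finset.card_pair hne]
  set T := S.submatrix e e with hT
  have hTs : Tᵀ = -T := by rw [hT, transpose_submatrix, hS]; rfl
  have hdet : S.det = T.det := (det_submatrix_equiv_self e S).symm
  have hblock : T = fromBlocks T.toBlocks₁₁ T.toBlocks₁₂ T.toBlocks₂₁ T.toBlocks₂₂ :=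
    (fromBlocks_toBlocks T).symm
  set A := T.toBlocks₁₁ with hA
  set B := T.toBlocks₁₂ with hB
  set Cc := T.toBlocks₂₁ with hC
  set D := T.toBlocks₂₂ with hD
  have hAs : Aᵀ = -A := by ext k l; exact congrFun (congrFun hTs (Sum.inl k)) (Sum.inl l)
  have hDs : Dᵀ = -D := by ext k l; exact congrFun (congrFun hTs (Sum.inr k)) (Sum.inr l)
  have hBs : Bᵀ = -Cc := by ext k l; exact congrFun (congrFun hTs (Sum.inr k)) (Sum.inl l)
  have hCs : Ccᵀ = -B := by ext k l; exact congrFun (congrFun hTs (Sum.inl k)) (Sum.inr l)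
  obtain ⟨y, hy⟩ : ∃ y, A.det = y * y := by
    let f : Fin 2 ≃ {k // k = i ∨ k = j} := Fintype.equivOfCardEq (by simp [hcard])
    have hs : (A.submatrix f f)ᵀ = -(A.submatrix f f) := by rw [transpose_submatrix, hAs]; rfl
    refine ⟨A.submatrix f f 0 1, ?_⟩
    rw [← det_submatrix_equiv_self f A, det_fin_two, apply_eq_neg_of_skew hs 1 0,
      self_eq_neg.1 (apply_eq_neg_of_skew hs 0 0)]
    ring
  have hA0 : A.det ≠ 0 := by
    let f : Fin 2 ≃ {k // k = i ∨ k = j} := Fintype.equivOfCardEq (by simp [hcard])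
    have hs : (A.submatrix f f)ᵀ = -(A.submatrix f f) := by rw [transpose_submatrix, hAs]; rfl
    rw [← det_submatrix_equiv_self f A, det_fin_two, apply_eq_neg_of_skew hs 1 0,
      self_eq_neg.1 (apply_eq_neg_of_skew hs 0 0)]
    intro h
    have h01 : A.submatrix f f 0 1 = 0 := by
      have : A.submatrix f f 0 1 * A.submatrix f f 0 1 = 0 := by linear_combination h
      simpa using this
    have hz : A.submatrix f f = 0 := by
      ext k l
      fin_cases k <;> fin_cases l
      · exact self_eq_neg.1 (apply_eq_neg_of_skew hs 0 0)
      · exact h01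
      · have := apply_eq_neg_of_skew hs 1 0
        rw [h01, neg_zero] at this
        exact this
      · exact self_eq_neg.1 (apply_eq_neg_of_skew hs 1 1)
    have h1 := congrFun (congrFun hz (f.symm ⟨i, Or.inl rfl⟩)) (f.symm ⟨j, Or.inr rfl⟩)
    simp only [submatrix_apply, Equiv.apply_symm_apply, Matrix.zero_apply] at h1
    exact hij h1
  let _ : Invertible A := A.invertibleOfIsUnitDet (isUnit_iff_ne_zero.2 hA0)
  have hsch : (D - Cc * ⅟A * B)ᵀ = -(D - Cc * ⅟A * B) := by
    rw [transpose_sub, transpose_mul, transpose_mul, hDs, hBs, hCs, invOf_eq_nonsing_inv,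
      transpose_nonsing_inv, hAs, Matrix.inv_eq_right_inv (A := -A) (B := -A⁻¹)
      (by rw [neg_mul_neg, Matrix.mul_nonsing_inv _ (isUnit_iff_ne_zero.2 hA0)])]
    simp only [Matrix.neg_mul, Matrix.mul_neg, neg_neg, Matrix.mul_assoc]
    abel
  have hlt : Fintype.card {k // ¬ (k = i ∨ k = j)} < n := by
    rw [Fintype.card_subtype_compl, hcard, ← hn]
    have : 0 < Fintype.card ι := Fintype.card_pos_iff.2 ⟨i⟩
    omega
  obtain ⟨z, hz⟩ := ih _ hlt rfl _ hsch
  refine ⟨y * z, ?_⟩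
  rw [hdet, hblock, det_fromBlocks₁₁, hy, hz]
  ring

end SkewDeterminant

section NewtonDeterminant

open Polynomial

variable {R : Type*} [CommRing R] {ι : Type*} [Fintype ι] [DecidableEq ι]

theorem derivative_det (M : Matrix ι ι R[X]) :
    derivative M.det = trace (M.adjugate * M.map derivative) := by
  have h1 : ∀ i, (M.adjugate * M.map derivative) i i =
      (M.updateCol i fun j => derivative (M j i)).det := by
    intro i
    rw [← cramer_apply, cramer_eq_adjugate_mulVec]
    rfl
  simp only [trace, diag_apply, h1]
  rw [det_apply]
  simp only [det_apply, map_sum]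
  rw [Finset.sum_comm]
  refine Finset.sum_congr rfl fun σ _ => ?_
  rw [Units.smul_def, map_zsmul, derivative_prod_finset, Finset.smul_sum]
  refine Finset.sum_congr rfl fun i _ => ?_
  rw [Units.smul_def]
  congr 1
  rw [← Finset.prod_erase_mul _ _ (Finset.mem_univ i)]
  congr 1
  · refine Finset.prod_congr rfl fun j hj => ?_
    rw [updateCol_ne (Finset.ne_of_mem_erase hj)]
  · rw [updateCol_self]

/-- The elementary symmetric functions of the eigenvalues of `M`. -/
def detCoeff (M : Matrix ι ι R) (k : ℕ) : R := (det (1 + (X : R[X]) • M.map C)).coeff k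

theorem detCoeff_zero (M : Matrix ι ι R) : detCoeff M 0 = 1 := by
  rw [detCoeff, coeff_zero_eq_eval_zero, ← coe_evalRingHom, RingHom.map_det]
  convert det_one (n := ι) (R := R)
  ext i j
  rcases eq_or_ne i j with rfl | h
  · simp
  · simp [h]

theorem natDegree_det_one_add_le (M : Matrix ι ι R) :
    (det (1 + (X : R[X]) • M.map C)).natDegree ≤ Fintype.card ι := by
  have := natDegree_det_X_add_C_le M 1
  rwa [Matrix.map_one C C_0 C_1, add_comm] at this

theorem detCoeff_eq_zero (M : Matrix ι ι R) {k : ℕ} (hk : Fintype.card ι < k) :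
    detCoeff M k = 0 :=
  coeff_eq_zero_of_natDegree_lt ((natDegree_det_one_add_le M).trans_lt hk)

theorem detCoeff_succ (M : Matrix ι ι R) (k : ℕ) :
    (k + 1 : R) * detCoeff M (k + 1) =
      ∑ i ∈ Finset.range (k + 1), (-1) ^ i * detCoeff M (k - i) * trace (M ^ (i + 1)) := by
  set P : Matrix ι ι R[X] := 1 + (X : R[X]) • M.map C with hP
  set N : ℕ → Matrix ι ι R := fun k => P.adjugate.map fun f => f.coeff k with hN
  have hPN : P * P.adjugate = P.det • 1 := mul_adjugate P
  have h1 : P.adjugate + (X : R[X]) • (M.map C * P.adjugate) = P.det • 1 := by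
    rw [← hPN, hP, add_mul, one_mul, smul_mul_assoc]
  have hmul : ∀ k, (M.map C * P.adjugate).map (fun f => f.coeff k) = M * N k := by
    intro k
    ext i j
    simp [Matrix.mul_apply, hN]
  have hN0 : N 0 = detCoeff M 0 • 1 := by
    ext i j
    have := congrArg (fun f => f.coeff 0) (congrFun (congrFun h1 i) j)
    simp only [Matrix.add_apply, Matrix.smul_apply, smul_eq_mul, coeff_add, mul_coeff_zero,
      coeff_X_zero, zero_mul, add_zero] at this
    simp only [hN, map_apply, this, Matrix.smul_apply, smul_eq_mul, Matrix.one_apply]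
    split_ifs <;> simp [detCoeff, hP]
  have hNs : ∀ k, N (k + 1) = detCoeff M (k + 1) • 1 - M * N k := by
    intro k
    rw [eq_sub_iff_add_eq, ← hmul]
    ext i j
    have := congrArg (fun f => f.coeff (k + 1)) (congrFun (congrFun h1 i) j)
    simp only [Matrix.add_apply, Matrix.smul_apply, smul_eq_mul, coeff_add, coeff_X_mul] at this
    simp only [Matrix.add_apply, map_apply, hN, this, Matrix.smul_apply, smul_eq_mul,
      Matrix.one_apply]
    split_ifs <;> simp [detCoeff, hP]
  have hNk : ∀ k, N k = ∑ i ∈ Finset.range (k + 1), ((-1) ^ i * detCoeff M (k - i)) • M ^ i := by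
    intro k
    induction k with
    | zero => simp [hN0]
    | succ k ih =>
      rw [hNs, ih, Finset.sum_range_succ' _ (k + 1), Finset.mul_sum, sub_eq_neg_add,
        ← Finset.sum_neg_distrib]
      congr 1
      · refine Finset.sum_congr rfl fun i _ => ?_
        rw [mul_smul_comm, ← pow_succ', ← neg_smul, Nat.add_sub_add_right, pow_succ (-1 : R)]
        congr 1; ring
      · simp
  have hder : P.map derivative = M.map C := by
    ext i j : 2
    simp only [hP, map_apply, Matrix.add_apply, Matrix.smul_apply, smul_eq_mul, Matrix.one_apply]
    split_ifs <;> simp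
  have h2 := congrArg (fun f => f.coeff k) (derivative_det P)
  simp only [coeff_derivative, hder] at h2
  have h3 : (trace (P.adjugate * M.map C)).coeff k = trace (N k * M) := by
    simp [trace, Matrix.mul_apply, hN]
  rw [detCoeff, mul_comm, ← hP]
  rw [h2, h3, hNk, Finset.sum_mul, trace_sum]
  exact Finset.sum_congr rfl fun i _ => by rw [smul_mul_assoc, trace_smul, smul_eq_mul, pow_succ]

theorem trace_mul_pow_comm (a b : Matrix ι ι R) (k : ℕ) :
    trace ((b * a) ^ k) = trace ((a * b) ^ k) := by
  cases k with
  | zero => simp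
  | succ k =>
    have h : ∀ k, b * (a * b) ^ k = (b * a) ^ k * b := fun k =>
      (SemiconjBy.pow_right (show SemiconjBy b (a * b) (b * a) from (mul_assoc _ _ _).symm) k).eq
    rw [pow_succ, ← mul_assoc, ← h, trace_mul_comm, ← mul_assoc, ← pow_succ']

/-- The product of two skew matrices has a Pfaffian generating function. -/
theorem exists_half_detCoeff {R : Type*} [CommRing R] [IsDomain R] [CharZero R]
    [IsIntegrallyClosed R] (a b : Matrix ι ι R)
    (ha : aᵀ = -a) (hb : bᵀ = -b) : ∃ q : ℕ → R, q 0 = 1 ∧ (∀ k, Fintype.card ι < k → q k = 0) ∧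
      ∀ k : ℕ, 2 * (k + 1 : R) * q (k + 1) =
        ∑ i ∈ Finset.range (k + 1), (-1) ^ i * q (k - i) * trace ((a * b) ^ (i + 1)) := by
  set P : R[X] := det (1 + (X : R[X]) • (b * a).map C) with hP
  obtain ⟨y, hy⟩ : ∃ y : R[X], P = y * y := by
    let L := FractionRing R[X]
    let S : Matrix (ι ⊕ ι) (ι ⊕ ι) R[X] := fromBlocks (a.map C) 1 (-1) ((X : R[X]) • b.map C)
    have hJ : (fromBlocks 0 (-1) 1 0 : Matrix (ι ⊕ ι) (ι ⊕ ι) R[X]).det = 1 := by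
      have : (fromBlocks 0 (-1) 1 0 : Matrix (ι ⊕ ι) (ι ⊕ ι) R[X]) =
          fromBlocks 1 (-1) 0 1 * fromBlocks 1 0 1 1 * fromBlocks 1 (-1) 0 1 := by
        simp [fromBlocks_multiply]
      rw [this, det_mul, det_mul, det_fromBlocks_zero₂₁, det_fromBlocks_zero₁₂]
      simp
    have hS : S.det = P := by
      rw [← mul_one S.det, ← hJ, ← det_mul, fromBlocks_multiply]
      simp only [mul_zero, mul_one, zero_add, mul_neg, add_zero, neg_neg]
      rw [det_fromBlocks_one₁₁, hP, Matrix.map_mul]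
      simp
    have hSs : Sᵀ = -S := by
      simp only [S, fromBlocks_transpose, fromBlocks_neg, ← transpose_map, ha]
      simp [Matrix.map_neg, transpose_smul, ← transpose_map, hb]
    have hcz : CharZero L := charZero_of_injective_algebraMap (IsFractionRing.injective R[X] L)
    obtain ⟨z, hz⟩ := exists_det_eq_mul_self_of_skew (K := L) _ rfl
      (S.map (algebraMap R[X] L)) (by rw [← transpose_map, hSs, Matrix.map_neg]; simp)
    have hz2 : z ^ 2 = algebraMap R[X] L P := by
      rw [pow_two, ← hz, ← hS]; exact (RingHom.map_det _ _).symm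
    obtain ⟨y, hy⟩ := IsIntegrallyClosed.isIntegral_iff.1
      (IsIntegral.of_pow (n := 2) (by norm_num) (hz2 ▸ isIntegral_algebraMap) : IsIntegral R[X] z)
    refine ⟨y, IsFractionRing.injective R[X] L ?_⟩
    rw [map_mul, hy, ← pow_two, hz2]
  have hy0 : y.coeff 0 * y.coeff 0 = 1 := by
    rw [← mul_coeff_zero, ← hy]; exact detCoeff_zero _
  obtain ⟨y, hy, hy0⟩ : ∃ y : R[X], P = y * y ∧ y.coeff 0 = 1 := by
    rcases mul_self_eq_one_iff.1 hy0 with h | h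
    · exact ⟨y, hy, h⟩
    · exact ⟨-y, by rw [hy]; ring, by simp [h]⟩
  have hy1 : y ≠ 0 := by rintro rfl; simp at hy0
  refine ⟨y.coeff, hy0, fun k hk => coeff_eq_zero_of_natDegree_lt ?_, fun k => ?_⟩
  · have h1 : P.natDegree ≤ Fintype.card ι := natDegree_det_one_add_le _
    rw [hy, natDegree_mul hy1 hy1] at h1
    omega
  let Λ : PowerSeries R := PowerSeries.mk fun i => (-1) ^ i * trace ((a * b) ^ (i + 1))
  have hP' : ((derivative P : R[X]) : PowerSeries R) = Λ * (P : PowerSeries R) := by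
    ext m
    rw [PowerSeries.coeff_mul, Finset.Nat.sum_antidiagonal_eq_sum_range_succ_mk, coeff_coe,
      coeff_derivative, mul_comm]
    refine (detCoeff_succ (b * a) m).trans ?_
    refine Finset.sum_congr rfl fun i _ => ?_
    rw [PowerSeries.coeff_mk, coeff_coe, trace_mul_pow_comm]
    rw [detCoeff]; ring
  have hyΛ : (y : PowerSeries R) * (2 * (derivative y : R[X]) - Λ * y) = 0 := by
    rw [hy, derivative_mul] at hP'
    push_cast at hP'
    linear_combination hP'
  have h2 : 2 * ((derivative y : R[X]) : PowerSeries R) = Λ * y := by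
    rcases mul_eq_zero.1 hyΛ with h | h
    · exact absurd (coe_eq_zero_iff.1 h) hy1
    · exact sub_eq_zero.1 h
  have h3 := congrArg (PowerSeries.coeff k) h2
  rw [two_mul, map_add, coeff_coe, coeff_derivative, PowerSeries.coeff_mul,
    Finset.Nat.sum_antidiagonal_eq_sum_range_succ_mk] at h3
  rw [mul_assoc, mul_comm _ (y.coeff _), two_mul, h3]
  refine Finset.sum_congr rfl fun i _ => ?_
  rw [PowerSeries.coeff_mk, coeff_coe]
  ring

end NewtonDeterminant

section PositiveTrace

set_option linter.unusedSectionVars false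

variable {F A : Type*} [Field F] [LinearOrder F] [IsStrictOrderedRing F] [Ring A] [Algebra F A]

/-- An involution `σ` of an algebra together with a tracial linear form `τ` that is positive
definite with respect to it. -/
structure IsPositiveTrace (σ : A →ₗ[F] A) (τ : A →ₗ[F] F) : Prop where
  star_mul : ∀ a b, σ (a * b) = σ b * σ a
  star_star : ∀ a, σ (σ a) = a
  comm : ∀ a b, τ (a * b) = τ (b * a)
  star : ∀ a, τ (σ a) = τ a
  pos : ∀ a, a ≠ 0 → 0 < τ (σ a * a)

/-- Self-adjoint idempotents. -/
structure IsProj (σ : A →ₗ[F] A) (e : A) : Prop where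
  idem : e * e = e
  star : σ e = e

/-- Minimal nonzero self-adjoint idempotents. -/
structure IsMinProj (σ : A →ₗ[F] A) (e : A) : Prop extends IsProj σ e where
  ne_zero : e ≠ 0
  eq_of_mul : ∀ f, IsProj σ f → e * f = f → f ≠ 0 → f = e

variable {σ : A →ₗ[F] A} {τ : A →ₗ[F] F}

namespace IsPositiveTrace

theorem star_one (h : IsPositiveTrace σ τ) : σ 1 = 1 := by
  have h1 := h.star_mul 1 (σ 1)
  rw [one_mul, h.star_star, one_mul] at h1
  exact h1.symm

theorem eq_zero (h : IsPositiveTrace σ τ) {a : A} (ha : σ a * a = 0) : a = 0 := by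
  by_contra hne
  have := h.pos a hne
  simp [ha] at this

theorem nonneg (h : IsPositiveTrace σ τ) (a : A) : 0 ≤ τ (σ a * a) := by
  rcases eq_or_ne a 0 with rfl | ha
  · simp
  · exact (h.pos a ha).le

theorem star_pow (h : IsPositiveTrace σ τ) (a : A) (k : ℕ) : σ (a ^ k) = σ a ^ k := by
  induction k with
  | zero => simp [h.star_one]
  | succ k ih => rw [pow_succ, h.star_mul, ih, pow_succ']

theorem star_aeval (h : IsPositiveTrace σ τ) {a : A} (ha : σ a = a) (p : Polynomial F) :
    σ (Polynomial.aeval a p) = Polynomial.aeval a p := by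
  rw [Polynomial.aeval_eq_sum_range, map_sum]
  simp [h.star_pow, ha]

theorem proj_trace_pos (h : IsPositiveTrace σ τ) {e : A} (he : IsProj σ e) (h0 : e ≠ 0) :
    0 < τ e := by
  have := h.pos e h0
  rwa [he.star, he.idem] at this

theorem mul_of_mul (h : IsPositiveTrace σ τ) {e f : A} (he : σ e = e) (hf : σ f = f)
    (hef : e * f = f) : f * e = f := by
  rw [← hf, ← he, ← h.star_mul, hef]

theorem eq_zero_of_pow (h : IsPositiveTrace σ τ) {a : A} (ha : σ a = a) (k : ℕ)
    (hk : a ^ k = 0) : a = 0 := by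
  have h2 : ∀ m, a ^ (2 ^ m) = 0 → a = 0 := by
    intro m
    induction m with
    | zero => simp
    | succ m ih =>
      intro hm
      apply ih
      apply h.eq_zero
      rw [h.star_pow, ha, ← pow_add, ← two_mul, ← pow_succ', hm]
  refine h2 k ?_
  obtain ⟨c, hc⟩ := Nat.exists_eq_add_of_le (Nat.lt_two_pow_self (n := k)).le
  rw [hc, pow_add, hk, zero_mul]

/-- Self-adjoint algebraic elements have a polynomial von Neumann inverse. -/
theorem exists_eq_sq_mul (h : IsPositiveTrace σ τ) {b : A} (hb : σ b = b)
    (halg : ∃ p : Polynomial F, p ≠ 0 ∧ Polynomial.aeval b p = 0) :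
    ∃ p : Polynomial F, b = b * b * Polynomial.aeval b p := by
  obtain ⟨p, hp, hpb⟩ := halg
  obtain ⟨q, hq, hq0⟩ := Polynomial.exists_eq_pow_rootMultiplicity_mul_and_not_dvd p hp 0
  rw [Polynomial.C_0, sub_zero] at hq hq0
  set k := p.rootMultiplicity 0
  have hc : q.coeff 0 ≠ 0 := fun h0 => hq0 (Polynomial.X_dvd_iff.2 h0)
  have h1 : (b * Polynomial.aeval b q) = 0 := by
    have hcomm : Commute b (Polynomial.aeval b q) := by
      have := congrArg (Polynomial.aeval b) (mul_comm Polynomial.X q)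
      rw [map_mul, map_mul, Polynomial.aeval_X] at this
      exact this
    refine h.eq_zero_of_pow ?_ (k + 1) ?_
    · rw [h.star_mul, h.star_aeval hb, hb, hcomm.eq]
    · rw [hcomm.mul_pow, pow_succ, pow_succ', mul_assoc, ← mul_assoc b,
        hcomm.eq, ← mul_assoc, ← mul_assoc]
      have : b ^ k * Polynomial.aeval b q = 0 := by
        rw [← hpb, hq]; simp
      rw [this]; simp
  refine ⟨-Polynomial.C (q.coeff 0)⁻¹ * q.divX, ?_⟩
  have h2 : q = Polynomial.X * q.divX + Polynomial.C (q.coeff 0) :=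
    (Polynomial.X_mul_divX_add q).symm
  rw [h2] at h1
  simp only [map_add, map_mul, Polynomial.aeval_X, Polynomial.aeval_C, mul_add,
    Algebra.algebraMap_eq_smul_one, mul_smul_comm, mul_one] at h1
  have h3 : b = -((q.coeff 0)⁻¹ • (b * (b * Polynomial.aeval b q.divX))) := by
    rw [eq_neg_of_add_eq_zero_left h1, smul_neg, smul_smul, inv_mul_cancel₀ hc, one_smul, neg_neg]
  rw [map_mul, map_neg, Polynomial.aeval_C, Algebra.algebraMap_eq_smul_one]
  simp only [neg_mul, smul_mul_assoc, one_mul, mul_neg, mul_smul_comm, mul_assoc]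
  exact h3

theorem eq_zero_or_eq_zero_of_isMinProj (h : IsPositiveTrace σ τ)
    (halg : ∀ a, σ a = a → ∃ p : Polynomial F, p ≠ 0 ∧ Polynomial.aeval a p = 0)
    {e : A} (he : IsMinProj σ e) {b c : A} (hb : σ b = b) (heb : e * b = b) (hec : e * c = c)
    (hbc : b * c = 0) : b = 0 ∨ c = 0 := by
  by_contra! hne
  obtain ⟨p, hp⟩ := h.exists_eq_sq_mul hb (halg b hb)
  have hcomm : b * Polynomial.aeval b p = Polynomial.aeval b p * b := by
    have := congrArg (Polynomial.aeval b) (mul_comm Polynomial.X p)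
    rwa [map_mul, map_mul, Polynomial.aeval_X] at this
  set y := Polynomial.aeval b p
  have hf : b * y = e := by
    apply he.eq_of_mul
    · constructor
      · calc b * y * (b * y) = b * (y * b) * y := by simp only [mul_assoc]
          _ = b * b * y * y := by rw [← hcomm]; simp only [mul_assoc]
          _ = b * y := by rw [← hp]
      · rw [h.star_mul, h.star_aeval hb, hb, hcomm]
    · rw [← mul_assoc, heb]
    · intro h0
      apply hne.1
      rw [hp, mul_assoc, h0, mul_zero]
  apply hne.2
  rw [← hec, ← hf, hcomm, mul_assoc, hbc, mul_zero]

theorem exists_smul_of_isMinProj (hF : NoRealExtension F) (h : IsPositiveTrace σ τ)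
    (halg : ∀ a, σ a = a → ∃ p : Polynomial F, p ≠ 0 ∧ Polynomial.aeval a p = 0)
    {e : A} (he : IsMinProj σ e) {a : A} (ha : σ a = a) (hea : e * a = a) :
    ∃ c : F, a = c • e := by
  have hae := h.mul_of_mul he.star ha hea
  have hcomm : ∀ p : Polynomial F, e * Polynomial.aeval a p = Polynomial.aeval a p * e := by
    intro p
    induction p using Polynomial.induction_on' with
    | add p q hp hq => rw [map_add, mul_add, add_mul, hp, hq]
    | monomial k c =>
      have : e * a ^ k = a ^ k * e := (Commute.pow_right (show e * a = a * e by rw [hea, hae]) k).eq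
      rw [Polynomial.aeval_monomial, ← Algebra.smul_def, mul_smul_comm, smul_mul_assoc, this]
  have hstar : ∀ p : Polynomial F,
      σ (Polynomial.aeval a p * e) = Polynomial.aeval a p * e := by
    intro p
    rw [h.star_mul, he.star, h.star_aeval ha, hcomm]
  have hleft : ∀ p : Polynomial F, e * (Polynomial.aeval a p * e) = Polynomial.aeval a p * e := by
    intro p
    rw [← mul_assoc, hcomm, mul_assoc, he.idem]
  have hprod : ∀ p q : Polynomial F, Polynomial.aeval a (p * q) * e =
      Polynomial.aeval a p * e * (Polynomial.aeval a q * e) := by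
    intro p q
    rw [mul_assoc _ e, hleft, map_mul, mul_assoc]
  have hex : ∀ p : Polynomial F, p ≠ 0 → Polynomial.aeval a p * e = 0 →
      ∃ μ : Polynomial F, Irreducible μ ∧ Polynomial.aeval a μ * e = 0 := by
    intro p
    induction p using WfDvdMonoid.induction_on_irreducible with
    | zero => intro h0; exact absurd rfl h0
    | unit u hu =>
      intro _ h0
      exfalso
      obtain ⟨v, rfl⟩ := hu
      have := hprod ↑v⁻¹ v
      rw [h0, mul_zero, Units.inv_mul, map_one, one_mul] at this
      exact he.ne_zero this
    | mul p μ hp hμ ih =>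
      intro _ h0
      rw [hprod] at h0
      rcases h.eq_zero_or_eq_zero_of_isMinProj halg he (hstar _) (hleft _) (hleft _) h0 with h1 | h1
      · exact ⟨μ, hμ, h1⟩
      · exact ih hp h1
  obtain ⟨p, hp0, hp⟩ := halg a ha
  obtain ⟨μ, hμ, hμe⟩ := hex p hp0 (by rw [hp, zero_mul])
  have hdeg : μ.natDegree = 1 := by
    have h1 := hμ.natDegree_pos
    by_contra hne
    obtain ⟨s, hs, t, ht⟩ := hF μ hμ (by omega)
    have hnn : 0 ≤ τ (Polynomial.aeval a s * e) := by
      clear ht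
      induction hs using AddSubmonoid.closure_induction with
      | mem s hs =>
        obtain ⟨c, hc, g, rfl⟩ := hs
        have h2 := h.nonneg (Polynomial.aeval a g * e)
        rw [hstar, ← hprod, ← pow_two] at h2
        rw [map_mul (Polynomial.aeval a), Polynomial.aeval_C, Algebra.algebraMap_eq_smul_one,
          smul_mul_assoc, one_mul, smul_mul_assoc, map_smul, smul_eq_mul]
        exact mul_nonneg hc h2
      | zero => simp
      | add s t _ _ hs ht =>
        rw [map_add, add_mul, map_add]
        exact add_nonneg hs ht
    have h3 := hprod t μ
    rw [hμe, mul_zero, mul_comm, ← ht, map_add, map_one, add_mul, one_mul] at h3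
    have h4 := congrArg τ h3
    rw [map_add, map_zero] at h4
    have := h.proj_trace_pos he.toIsProj he.ne_zero
    linarith
  obtain ⟨u, hu, v, rfl⟩ := Polynomial.natDegree_eq_one.1 hdeg
  refine ⟨-(u⁻¹ * v), ?_⟩
  simp only [map_add, map_mul, Polynomial.aeval_C, Polynomial.aeval_X,
    Algebra.algebraMap_eq_smul_one, smul_mul_assoc, one_mul, add_mul, hae] at hμe
  rw [neg_smul, mul_smul, ← smul_neg, ← eq_neg_of_add_eq_zero_left hμe, smul_smul,
    inv_mul_cancel₀ hu, one_smul]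

end IsPositiveTrace

end PositiveTrace

section DivisionAlgebra

set_option linter.unusedSectionVars false

variable {F A : Type*} [Field F] [LinearOrder F] [IsStrictOrderedRing F] [Ring A] [Algebra F A]
  {σ : A →ₗ[F] A} {τ : A →ₗ[F] F}

namespace IsPositiveTrace

theorem trace_eq_zero_of_skew (h : IsPositiveTrace σ τ) {x : A} (hx : σ x = -x) : τ x = 0 := by
  have := h.star x
  rw [hx, map_neg] at this
  linarith

theorem mul_proj_of_skew (h : IsPositiveTrace σ τ) {e x : A} (he : σ e = e) (hx : σ x = -x)
    (hex : e * x = x) : x * e = x := by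
  have := congrArg σ hex
  rw [h.star_mul, hx, he, neg_mul, neg_inj] at this
  exact this

variable (hF : NoRealExtension F) (h : IsPositiveTrace σ τ)
  (halg : ∀ a, σ a = a → ∃ p : Polynomial F, p ≠ 0 ∧ Polynomial.aeval a p = 0)
  {e : A} (he : IsMinProj σ e)

include hF h halg he

theorem exists_unit_skew {x : A} (hx : σ x = -x) (hex : e * x = x) (hx0 : x ≠ 0) :
    ∃ b : F, (b • x) * (b • x) = -e := by
  obtain ⟨c, hc⟩ := h.exists_smul_of_isMinProj hF halg he (a := x * x)
    (by rw [h.star_mul, hx, neg_mul_neg]) (by rw [← mul_assoc, hex])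
  have h1 := h.pos x hx0
  rw [hx, neg_mul, hc, ← neg_smul, map_smul, smul_eq_mul] at h1
  have h2 := h.proj_trace_pos he.toIsProj he.ne_zero
  have hc0 : 0 < -c := pos_of_mul_pos_left h1 h2.le
  obtain ⟨b, -, hb⟩ := hF.polyIVT.exists_sqrt hc0.le
  refine ⟨b⁻¹, ?_⟩
  rw [smul_mul_smul_comm, hc, smul_smul, ← mul_inv, hb, inv_neg, neg_mul, inv_mul_cancel₀,
    neg_smul, one_smul]
  exact fun h0 => by simp [h0] at hc0

theorem anticomm_of_orthogonal {x y : A} (hx : σ x = -x) (hex : e * x = x) (hy : σ y = -y)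
    (hey : e * y = y) (hxy : τ (σ x * y) = 0) : x * y = -(y * x) := by
  obtain ⟨c, hc⟩ := h.exists_smul_of_isMinProj hF halg he (a := x * y + y * x)
    (by rw [map_add, h.star_mul, h.star_mul, hx, hy, neg_mul_neg, neg_mul_neg, add_comm])
    (by rw [mul_add, ← mul_assoc, ← mul_assoc, hex, hey])
  have h1 := congrArg τ hc
  rw [map_add, h.comm y, map_smul, smul_eq_mul] at h1
  rw [hx, neg_mul, map_neg, neg_eq_zero] at hxy
  rw [hxy, add_zero] at h1
  have h2 := (h.proj_trace_pos he.toIsProj he.ne_zero).ne'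
  have hc0 : c = 0 := by
    rcases mul_eq_zero.1 h1.symm with h3 | h3
    · exact h3
    · exact absurd h3 h2
  rw [hc0, zero_smul] at hc
  exact eq_neg_of_add_eq_zero_left hc

theorem eq_sum_of_complete {d : ℕ} {u : Fin d → A} (a₀ : Fin d) (hu0 : u a₀ = e)
    (hu : ∀ a, e * u a = u a ∧ u a * e = u a)
    (horth : ∀ a b, τ (σ (u a) * u b) = if a = b then τ e else 0)
    (hcompl : ∀ y, σ y = -y → e * y = y → (∀ a, τ (σ (u a) * y) = 0) → y = 0)
    {x : A} (hex : e * x = x) (hxe : x * e = x) :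
    x = ∑ a, (τ (σ (u a) * x) / τ e) • u a := by
  have h2 := (h.proj_trace_pos he.toIsProj he.ne_zero).ne'
  rw [← sub_eq_zero]
  set y := x - ∑ a, (τ (σ (u a) * x) / τ e) • u a with hy
  have hey : e * y = y := by
    simp only [hy, mul_sub, hex, Finset.mul_sum, mul_smul_comm, (hu _).1]
  have hye : y * e = y := by
    simp only [hy, sub_mul, hxe, Finset.sum_mul, smul_mul_assoc, (hu _).2]
  have hz : ∀ a, τ (σ (u a) * y) = 0 := by
    intro a
    simp only [hy, mul_sub, Finset.mul_sum, mul_smul_comm, map_sub, map_sum, map_smul, horth,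
      smul_eq_mul, mul_ite, mul_zero, Finset.sum_ite_eq, Finset.mem_univ, if_true]
    rw [div_mul_cancel₀ _ h2, sub_self]
  refine hcompl y ?_ hey hz
  obtain ⟨c, hc⟩ := h.exists_smul_of_isMinProj hF halg he (a := y + σ y)
    (by rw [map_add, h.star_star, add_comm]) (by
      rw [mul_add, hey]
      congr 1
      have := congrArg σ hye
      rwa [h.star_mul, he.star] at this)
  have h1 := congrArg τ hc
  have h3 := hz a₀
  rw [hu0, he.star, hey] at h3
  rw [map_add, h.star, h3, add_zero, map_smul, smul_eq_mul] at h1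
  have hc0 : c = 0 := by
    rcases mul_eq_zero.1 h1.symm with h3 | h3
    · exact h3
    · exact absurd h3 h2
  rw [hc0, zero_smul] at hc
  exact eq_neg_of_add_eq_zero_right hc

/-- The corner of a minimal projection has an orthonormal basis of unitary elements whose
cardinality divides the trace of the projection. -/
theorem exists_orthonormal_corner (h1 : ∃ m : ℕ, τ e = m)
    (h2 : ∀ i, e * i = i → σ i = -i → i * i = -e → ∃ m : ℕ, τ e = 2 * m)
    (h4 : ∀ i j, e * i = i → e * j = j → σ i = -i → σ j = -j → i * i = -e → j * j = -e →
      i * j = -(j * i) → ∃ m : ℕ, τ e = 4 * m) :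
    ∃ (d m : ℕ) (u : Fin d → A), 0 < d ∧ τ e = d * m ∧ (∀ a, e * u a = u a ∧ u a * e = u a) ∧
      (∀ a b, τ (σ (u a) * u b) = if a = b then τ e else 0) ∧
      (∀ x, e * x = x → x * e = x → x = ∑ a, (τ (σ (u a) * x) / τ e) • u a) ∧
      ∀ a, u a * σ (u a) = e := by
  have hee := he.idem
  have hse := he.star
  by_cases hi : ∃ i, e * i = i ∧ σ i = -i ∧ i * i = -e
  swap
  · obtain ⟨m, hm⟩ := h1
    have hu : ∀ a : Fin 1, e * (fun _ => e : Fin 1 → A) a = e ∧ (fun _ => e : Fin 1 → A) a * e = e :=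
      fun _ => ⟨hee, hee⟩
    have horth : ∀ a b : Fin 1, τ (σ ((fun _ => e : Fin 1 → A) a) * (fun _ => e : Fin 1 → A) b) =
        if a = b then τ e else 0 := by
      intro a b
      simp [hse, hee, Subsingleton.elim a b]
    refine ⟨1, m, fun _ => e, one_pos, by simpa using hm, hu, horth, fun x hex hxe => ?_,
      fun _ => by rw [hse, hee]⟩
    refine h.eq_sum_of_complete hF halg he (u := fun _ => e) 0 rfl hu horth
      (fun y hy hey _ => ?_) hex hxe
    by_contra hy0
    obtain ⟨b, hb⟩ := h.exists_unit_skew hF halg he hy hey hy0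
    exact hi ⟨b • y, by rw [mul_smul_comm, hey], by rw [map_smul, hy, smul_neg], hb⟩
  obtain ⟨i, hei, hsi, hii⟩ := hi
  have hie := h.mul_proj_of_skew hse hsi hei
  have hτi := h.trace_eq_zero_of_skew hsi
  by_cases hj : ∃ j, e * j = j ∧ σ j = -j ∧ j * j = -e ∧ i * j = -(j * i)
  swap
  · obtain ⟨m, hm⟩ := h2 i hei hsi hii
    have hu : ∀ a, e * (![e, i] : Fin 2 → A) a = (![e, i] : Fin 2 → A) a ∧
        (![e, i] : Fin 2 → A) a * e = (![e, i] : Fin 2 → A) a := by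
      intro a; fin_cases a <;> simp [hee, hei, hie]
    have horth : ∀ a b, τ (σ ((![e, i] : Fin 2 → A) a) * (![e, i] : Fin 2 → A) b) =
        if a = b then τ e else 0 := by
      intro a b
      fin_cases a <;> fin_cases b <;> simp [hee, hei, hie, hse, hsi, hii, hτi]
    refine ⟨2, m, ![e, i], two_pos, by simpa using hm, hu, horth, fun x hex hxe => ?_, ?_⟩
    · refine h.eq_sum_of_complete hF halg he (u := ![e, i]) 0 rfl hu horth
        (fun y hy hey hy1 => ?_) hex hxe
      have hanti := h.anticomm_of_orthogonal hF halg he hsi hei hy hey (hy1 1)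
      by_contra hy0
      obtain ⟨b, hb⟩ := h.exists_unit_skew hF halg he hy hey hy0
      exact hj ⟨b • y, by rw [mul_smul_comm, hey], by rw [map_smul, hy, smul_neg], hb,
        by rw [mul_smul_comm, smul_mul_assoc, hanti, smul_neg]⟩
    · intro a; fin_cases a <;> simp [hee, hse, hsi, hii]
  obtain ⟨j, hej, hsj, hjj, hij⟩ := hj
  have hje := h.mul_proj_of_skew hse hsj hej
  have hτj := h.trace_eq_zero_of_skew hsj
  obtain ⟨m, hm⟩ := h4 i j hei hej hsi hsj hii hjj hij
  obtain ⟨k, hk⟩ : ∃ k, k = i * j := ⟨_, rfl⟩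
  have hij' : i * j = k := hk.symm
  have hji : j * i = -k := by rw [hk, hij, neg_neg]
  have hek : e * k = k := by rw [hk, ← mul_assoc, hei]
  have hke : k * e = k := by rw [hk, mul_assoc, hje]
  have hik : i * k = -j := by rw [hk, ← mul_assoc, hii, neg_mul, hej]
  have hkj : k * j = -i := by rw [hk, mul_assoc, hjj, mul_neg, hie]
  have hki : k * i = j := by rw [hk, mul_assoc, hji, mul_neg, hik, neg_neg]
  have hjk : j * k = i := by rw [hk, ← mul_assoc, hji, neg_mul, hkj, neg_neg]
  have hkk : k * k = -e := by nth_rewrite 1 [hk]; rw [mul_assoc, hjk, hii]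
  have hsk : σ k = -k := by rw [hk, h.star_mul, hsi, hsj, neg_mul_neg, hji, hij']
  have hτk := h.trace_eq_zero_of_skew hsk
  have hu : ∀ a, e * (![e, i, j, k] : Fin 4 → A) a = (![e, i, j, k] : Fin 4 → A) a ∧
      (![e, i, j, k] : Fin 4 → A) a * e = (![e, i, j, k] : Fin 4 → A) a := by
    intro a; fin_cases a <;> simp [hee, hei, hie, hej, hje, hek, hke]
  have horth : ∀ a b, τ (σ ((![e, i, j, k] : Fin 4 → A) a) * (![e, i, j, k] : Fin 4 → A) b) =
      if a = b then τ e else 0 := by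
    intro a b
    fin_cases a <;> fin_cases b <;>
      simp [hee, hei, hie, hse, hsi, hii, hτi, hej, hje, hek, hke, hsj, hsk, hij', hji, hik, hki,
        hjk, hkj, hjj, hkk, hτj, hτk]
  refine ⟨4, m, ![e, i, j, k], by norm_num, by simpa using hm, hu, horth, fun x hex hxe => ?_, ?_⟩
  · refine h.eq_sum_of_complete hF halg he (u := ![e, i, j, k]) 0 rfl hu horth
      (fun y hy hey hy1 => ?_) hex hxe
    have h1 := h.anticomm_of_orthogonal hF halg he hsi hei hy hey (hy1 1)
    have h2 := h.anticomm_of_orthogonal hF halg he hsj hej hy hey (hy1 2)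
    have h3 := h.anticomm_of_orthogonal hF halg he hsk hek hy hey (hy1 3)
    have h5 : k * y = y * k := by
      rw [hk, mul_assoc, h2, mul_neg, ← mul_assoc, h1, neg_mul, neg_neg, mul_assoc]
    have h6 : k * y = 0 := by
      have h7 : k * y + k * y = 0 := by
        nth_rewrite 2 [h5]; rw [h3]; exact neg_add_cancel _
      rw [← two_smul F, smul_eq_zero] at h7
      exact h7.resolve_left two_ne_zero
    have h8 : -y = 0 := by
      rw [← hey, ← neg_mul, ← hkk, mul_assoc, h6, mul_zero]
    exact neg_eq_zero.1 h8
  · intro a; fin_cases a <;> simp [hee, hse, hsi, hii, hsj, hjj, hsk, hkk]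

end IsPositiveTrace

end DivisionAlgebra

section Frames

set_option linter.unusedSectionVars false

variable {F A : Type*} [Field F] [LinearOrder F] [IsStrictOrderedRing F] [Ring A] [Algebra F A]
  {σ : A →ₗ[F] A} {τ : A →ₗ[F] F}

namespace IsPositiveTrace

theorem exists_minProj_decomposition (h : IsPositiveTrace σ τ)
    (hnat : ∀ e, IsProj σ e → ∃ k : ℕ, τ e = k) (k : ℕ) :
    ∀ e, IsProj σ e → τ e = k → ∃ (ι : Type) (_ : Fintype ι) (p : ι → A),
      (∀ i, IsMinProj σ (p i)) ∧ (∀ i j, i ≠ j → p i * p j = 0) ∧ ∑ i, p i = e := by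
  induction k using Nat.strong_induction_on with
  | _ k ih =>
  intro e he hk
  rcases eq_or_ne e 0 with rfl | he0
  · exact ⟨Empty, inferInstance, Empty.elim, fun i => i.elim, fun i => i.elim, by simp⟩
  by_cases hmin : ∀ f, IsProj σ f → e * f = f → f ≠ 0 → f = e
  · exact ⟨Unit, inferInstance, fun _ => e, fun _ => ⟨he, he0, hmin⟩,
      fun i j hij => absurd (Subsingleton.elim i j) hij, by simp⟩
  push Not at hmin
  obtain ⟨f, hf, hef, hf0, hfe⟩ := hmin
  have hfe' := h.mul_of_mul he.star hf.star hef
  have hg : IsProj σ (e - f) :=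
    ⟨by rw [mul_sub, sub_mul, sub_mul, he.idem, hef, hfe', hf.idem]; abel,
      by rw [map_sub, he.star, hf.star]⟩
  obtain ⟨a, ha⟩ := hnat f hf
  obtain ⟨b, hb⟩ := hnat _ hg
  have hfpos := h.proj_trace_pos hf hf0
  have hgpos := h.proj_trace_pos hg (sub_ne_zero.2 hfe.symm)
  have hab : (k : F) = a + b := by rw [← hk, ← ha, ← hb, map_sub]; ring
  rw [ha] at hfpos
  rw [hb] at hgpos
  have hab' : k = a + b := by exact_mod_cast hab
  have ha0 : 0 < a := by exact_mod_cast hfpos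
  have hb0 : 0 < b := by exact_mod_cast hgpos
  obtain ⟨ι, _, p, hp, hpo, hps⟩ := ih a (by omega) f hf ha
  obtain ⟨κ, _, q, hq, hqo, hqs⟩ := ih b (by omega) _ hg hb
  have hpf : ∀ i, p i * f = p i := by
    intro i
    classical
    rw [← hps, Finset.mul_sum, Finset.sum_eq_single i (fun j _ hj => hpo _ _ hj.symm) (by simp),
      (hp i).idem]
  have hqg : ∀ i, q i * (e - f) = q i := by
    intro i
    classical
    rw [← hqs, Finset.mul_sum, Finset.sum_eq_single i (fun j _ hj => hqo _ _ hj.symm) (by simp),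
      (hq i).idem]
  have hpq : ∀ i j, p i * q j = 0 := by
    intro i j
    have h1 : (e - f) * q j = q j := by
      have := congrArg σ (hqg j)
      rwa [h.star_mul, hg.star, (hq j).star] at this
    rw [← hpf, ← h1, mul_assoc, ← mul_assoc f, mul_sub, hfe', hf.idem, sub_self, zero_mul, mul_zero]
  have hqp : ∀ i j, q i * p j = 0 := by
    intro i j
    have := congrArg σ (hpq j i)
    rwa [h.star_mul, (hp j).star, (hq i).star, map_zero] at this
  refine ⟨ι ⊕ κ, inferInstance, Sum.elim p q, ?_, ?_, ?_⟩
  · rintro (i | i)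
    exacts [hp i, hq i]
  · rintro (i | i) (j | j) hij
    exacts [hpo i j (by simpa using hij), hpq i j, hqp i j, hqo i j (by simpa using hij)]
  · simp [hps, hqs]

/-- A nonzero element between two minimal projections can be rescaled to a partial isometry. -/
theorem exists_partial_isometry (hF : NoRealExtension F) (h : IsPositiveTrace σ τ)
    (halg : ∀ a, σ a = a → ∃ p : Polynomial F, p ≠ 0 ∧ Polynomial.aeval a p = 0)
    {e f : A} (he : IsMinProj σ e) (hf : IsMinProj σ f) {x : A} (hx : x ≠ 0) (hex : e * x = x)
    (hxf : x * f = x) :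
    ∃ v, v * σ v = e ∧ σ v * v = f ∧ e * v = v ∧ v * f = v := by
  have hfx : f * σ x = σ x := by
    have := congrArg σ hxf
    rwa [h.star_mul, hf.star] at this
  obtain ⟨c, hc⟩ := h.exists_smul_of_isMinProj hF halg hf (a := σ x * x)
    (by rw [h.star_mul, h.star_star]) (by rw [← mul_assoc, hfx])
  obtain ⟨c', hc'⟩ := h.exists_smul_of_isMinProj hF halg he (a := x * σ x)
    (by rw [h.star_mul, h.star_star]) (by rw [← mul_assoc, hex])
  have h1 := h.pos x hx
  rw [hc, map_smul, smul_eq_mul] at h1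
  have hc0 : 0 < c := pos_of_mul_pos_left h1 (h.proj_trace_pos hf.toIsProj hf.ne_zero).le
  have hcc : c' = c := by
    have h2 : x * (σ x * x) = (x * σ x) * x := (mul_assoc _ _ _).symm
    rw [hc, hc', mul_smul_comm, smul_mul_assoc, hxf, hex] at h2
    exact (smul_left_injective F hx h2).symm
  obtain ⟨b, -, hb⟩ := hF.polyIVT.exists_sqrt hc0.le
  have hb0 : b⁻¹ * b⁻¹ * c = 1 := by
    rw [← mul_inv, hb, inv_mul_cancel₀ hc0.ne']
  refine ⟨b⁻¹ • x, ?_, ?_, ?_, ?_⟩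
  · rw [map_smul, smul_mul_smul_comm, hc', hcc, smul_smul, hb0, one_smul]
  · rw [map_smul, smul_mul_smul_comm, hc, smul_smul, hb0, one_smul]
  · rw [mul_smul_comm, hex]
  · rw [smul_mul_assoc, hxf]

end IsPositiveTrace

/-- An orthogonal family, partitioned by a key, that spans `A` blockwise and resolves the
identity. -/
structure IsFrame (σ : A →ₗ[F] A) (τ : A →ₗ[F] F) {P K : Type*} [Fintype P] [DecidableEq P]
    [DecidableEq K] (q : P → A) (key : P → K) (κ : K → F) : Prop where
  pos : ∀ p, 0 < κ (key p)
  orthogonal : ∀ p p', key p = key p' → τ (σ (q p) * q p') = if p = p' then κ (key p) else 0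
  expand : ∀ x p', x * q p' =
    ∑ p, if key p = key p' then (τ (σ (q p) * (x * q p')) / κ (key p)) • q p else 0
  resolve : ∑ p, (κ (key p))⁻¹ • (q p * σ (q p)) = 1

theorem IsPositiveTrace.exists_isFrame (hF : NoRealExtension F) (h : IsPositiveTrace σ τ)
    (halg : ∀ a, σ a = a → ∃ p : Polynomial F, p ≠ 0 ∧ Polynomial.aeval a p = 0)
    (h1 : ∀ e, IsProj σ e → ∃ k : ℕ, τ e = k)
    (h2 : ∀ e i, IsProj σ e → e * i = i → σ i = -i → i * i = -e → ∃ m : ℕ, τ e = 2 * m)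
    (h4 : ∀ e i j, IsProj σ e → e * i = i → e * j = j → σ i = -i → σ j = -j → i * i = -e →
      j * j = -e → i * j = -(j * i) → ∃ m : ℕ, τ e = 4 * m) :
    ∃ (P K : Type) (_ : Fintype P) (_ : DecidableEq P) (_ : DecidableEq K) (q : P → A)
      (key : P → K) (κ : K → F), IsFrame σ τ q key κ := by
  classical
  obtain ⟨k, hk⟩ := h1 1 ⟨one_mul 1, h.star_one⟩
  obtain ⟨ι, _, e, he, heo, hes⟩ :=
    h.exists_minProj_decomposition h1 k 1 ⟨one_mul 1, h.star_one⟩ hk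
  choose d m u hd hm hu horth hcompl hunit using fun i =>
    h.exists_orthonormal_corner hF halg (he i) (h1 _ (he i).toIsProj)
      (fun x => h2 _ x (he i).toIsProj) (fun x y => h4 _ x y (he i).toIsProj)
  let R : Setoid ι :=
    { r := fun i j => ∃ v, v * σ v = e i ∧ σ v * v = e j ∧ e i * v = v ∧ v * e j = v
      iseqv :=
        { refl := fun i => ⟨e i, by rw [(he i).star, (he i).idem], by rw [(he i).star, (he i).idem],
            (he i).idem, (he i).idem⟩
          symm := by
            rintro i j ⟨v, hv1, hv2, hv3, hv4⟩
            refine ⟨σ v, by rw [h.star_star, hv2], by rw [h.star_star, hv1], ?_, ?_⟩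
            · have := congrArg σ hv4
              rwa [h.star_mul, (he j).star] at this
            · have := congrArg σ hv3
              rwa [h.star_mul, (he i).star] at this
          trans := by
            rintro i j l ⟨v, hv1, hv2, hv3, hv4⟩ ⟨w, hw1, hw2, hw3, hw4⟩
            refine ⟨v * w, ?_, ?_, by rw [← mul_assoc, hv3], by rw [mul_assoc, hw4]⟩
            · rw [h.star_mul, mul_assoc, ← mul_assoc w, hw1, ← mul_assoc, hv4, hv1]
            · rw [h.star_mul, mul_assoc, ← mul_assoc (σ v), hv2, hw3, hw2] } }
  let r : ι → ι := fun i => (Quotient.mk R i).out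
  have hr : ∀ i, R.r i (r i) := fun i => R.symm (Quotient.mk_out i)
  have hrr : ∀ i j, R.r i j → r i = r j := fun i j hij => by
    simp only [r]; rw [Quotient.sound hij]
  choose v hv1 hv2 hv3 hv4 using hr
  have hlink : ∀ i j x, e i * x = x → x * e (r j) = x → r i ≠ r j → x = 0 := by
    intro i j x hix hxj hij
    by_contra hx
    apply hij
    rw [hrr i (r j) (h.exists_partial_isometry hF halg (he i) (he (r j)) hx hix hxj),
      ← hrr j (r j) ⟨v j, hv1 j, hv2 j, hv3 j, hv4 j⟩]
  have hκ : ∀ i, 0 < τ (e i) := fun i => h.proj_trace_pos (he i).toIsProj (he i).ne_zero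
  let P : Type := Σ i : ι, Fin (d (r i)) × Fin (m (r i))
  let q : P → A := fun p => v p.1 * u (r p.1) p.2.1
  let key : P → ι × ℕ := fun p => (r p.1, (p.2.2 : ℕ))
  refine ⟨P, ι × ℕ, inferInstance, inferInstance, inferInstance, q, key, fun c => τ (e c.1),
    ⟨fun p => hκ _, ?_, ?_, ?_⟩⟩
  · rintro ⟨i, a, l⟩ ⟨i', a', l'⟩ hkey
    obtain ⟨hk1, hk2⟩ := Prod.mk.inj hkey
    simp only [q, key]
    by_cases hii : i = i'
    · subst hii
      have hll : l = l' := Fin.ext hk2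
      subst hll
      rw [h.star_mul, mul_assoc, ← mul_assoc (σ (v i)), hv2, (hu _ _).1, horth]
      congr 1
      refine propext ⟨fun hs => by rw [hs], fun hs => ?_⟩
      exact (Prod.mk.inj (eq_of_heq (Sigma.mk.inj hs).2)).1
    · rw [if_neg (fun hp => hii (congrArg Sigma.fst hp)), h.star_mul, mul_assoc,
        ← mul_assoc (σ (v i)), ← hv3 i, ← hv3 i', h.star_mul, (he i).star, mul_assoc (σ (v i)),
        ← mul_assoc (e i), heo _ _ hii, zero_mul, mul_zero, zero_mul, mul_zero, map_zero]
  · rintro x ⟨j, b, l'⟩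
    have hxe : x * q ⟨j, b, l'⟩ * e (r j) = x * q ⟨j, b, l'⟩ := by
      simp only [q]
      rw [mul_assoc, mul_assoc, (hu _ _).2]
    generalize hy : x * q ⟨j, b, l'⟩ = y at hxe
    conv_lhs => rw [← one_mul y, ← hes, Finset.sum_mul]
    rw [Fintype.sum_sigma]
    refine Finset.sum_congr rfl fun i _ => ?_
    by_cases hij : r i = r j
    swap
    · rw [hlink i j (e i * y) (by rw [← mul_assoc, (he i).idem]) (by rw [mul_assoc, hxe]) hij]
      refine (Finset.sum_eq_zero fun s _ => if_neg fun hs => hij (Prod.mk.inj hs).1).symm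
    rw [Fintype.sum_prod_type]
    have h3 := hcompl (r i) (σ (v i) * y)
      (by
        rw [← mul_assoc]
        congr 1
        have := congrArg σ (hv4 i)
        rwa [h.star_mul, (he _).star] at this)
      (by rw [mul_assoc, hij, hxe])
    rw [← hv1 i, mul_assoc, h3, Finset.mul_sum]
    refine Finset.sum_congr rfl fun a _ => ?_
    have hl : (l' : ℕ) < m (r i) := by rw [hij]; exact l'.2
    rw [Finset.sum_eq_single ⟨l', hl⟩]
    · simp only [q, key, hij, if_true]
      rw [mul_smul_comm, h.star_mul, mul_assoc]
    · intro l _ hne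
      exact if_neg fun hs => hne (Fin.ext (Prod.mk.inj hs).2)
    · simp
  · rw [Fintype.sum_sigma, ← hes]
    refine Finset.sum_congr rfl fun i _ => ?_
    have h3 : ∀ s : Fin (d (r i)) × Fin (m (r i)), q ⟨i, s⟩ * σ (q ⟨i, s⟩) = e i := by
      intro s
      simp only [q]
      rw [h.star_mul, mul_assoc, ← mul_assoc (u _ _), hunit, ← mul_assoc, hv4, hv1]
    simp only [h3, key, Finset.sum_const, Finset.card_univ, Fintype.card_prod, Fintype.card_fin]
    rw [hm, ← Nat.cast_smul_eq_nsmul F, smul_smul, Nat.cast_mul, mul_inv_cancel₀, one_smul]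
    rw [← hm]
    exact (hκ _).ne'

end Frames

section Representation

set_option linter.unusedSectionVars false

variable {F A : Type*} [Field F] [LinearOrder F] [IsStrictOrderedRing F] [Ring A] [Algebra F A]
  {σ : A →ₗ[F] A} {τ : A →ₗ[F] F}
  {P K : Type*} [Fintype P] [DecidableEq P] [DecidableEq K] {q : P → A} {key : P → K} {κ : K → F}

namespace IsFrame

/-- The matrix coefficients of left multiplication with respect to a frame. -/
def repr (σ : A →ₗ[F] A) (τ : A →ₗ[F] F) (q : P → A) (key : P → K) (κ : K → F) :
    A →ₗ[F] Matrix P P F where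
  toFun x := Matrix.of fun p p' =>
    if key p = key p' then τ (σ (q p) * (x * q p')) / κ (key p) else 0
  map_add' x y := by
    ext p p'
    simp only [of_apply, Matrix.add_apply]
    split_ifs
    · rw [add_mul, mul_add, map_add, add_div]
    · rw [add_zero]
  map_smul' c x := by
    ext p p'
    simp only [of_apply, Matrix.smul_apply, smul_eq_mul, RingHom.id_apply]
    split_ifs
    · rw [smul_mul_assoc, mul_smul_comm, map_smul, smul_eq_mul, mul_div_assoc]
    · rw [mul_zero]

theorem repr_apply (x : A) (p p' : P) : repr σ τ q key κ x p p' =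
    if key p = key p' then τ (σ (q p) * (x * q p')) / κ (key p) else 0 := rfl

variable (hq : IsFrame σ τ q key κ)
include hq

theorem repr_one : repr σ τ q key κ 1 = 1 := by
  ext p p'
  rw [repr_apply, one_mul, Matrix.one_apply]
  by_cases hk : key p = key p'
  · rw [if_pos hk, hq.orthogonal _ _ hk]
    split_ifs
    · exact div_self (hq.pos p).ne'
    · rw [zero_div]
  · rw [if_neg hk, if_neg (fun h => hk (congrArg key h))]

theorem repr_mul (x y : A) :
    repr σ τ q key κ (x * y) = repr σ τ q key κ x * repr σ τ q key κ y := by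
  ext p p'
  rw [Matrix.mul_apply]
  simp only [repr_apply]
  split_ifs with hk
  · conv_lhs => rw [mul_assoc x, hq.expand y p']
    rw [Finset.mul_sum, Finset.mul_sum, map_sum, Finset.sum_div]
    refine Finset.sum_congr rfl fun s _ => ?_
    by_cases hs : key s = key p'
    · rw [if_pos hs, if_pos hs, if_pos (hk.trans hs.symm), mul_smul_comm, mul_smul_comm, map_smul,
        smul_eq_mul, mul_comm, mul_div_right_comm]
    · rw [if_neg hs, if_neg hs, mul_zero, mul_zero, mul_zero, map_zero, zero_div]
  · refine (Finset.sum_eq_zero fun s _ => ?_).symm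
    by_cases h1 : key p = key s
    · rw [if_neg (fun h2 => hk (h1.trans h2)), mul_zero]
    · rw [if_neg h1, zero_mul]

theorem repr_star (h : IsPositiveTrace σ τ) (x : A) :
    repr σ τ q key κ (σ x) = (repr σ τ q key κ x)ᵀ := by
  ext p p'
  rw [transpose_apply, repr_apply, repr_apply]
  by_cases hk : key p = key p'
  · rw [if_pos hk, if_pos hk.symm, hk]
    congr 1
    rw [← h.star (σ (q p') * (x * q p)), h.star_mul, h.star_mul, h.star_star, mul_assoc]
  · rw [if_neg hk, if_neg (Ne.symm hk)]

theorem trace_repr (h : IsPositiveTrace σ τ) (x : A) : trace (repr σ τ q key κ x) = τ x := by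
  calc trace (repr σ τ q key κ x) = τ (x * ∑ p, (κ (key p))⁻¹ • (q p * σ (q p))) := by
        simp only [trace, diag_apply, repr_apply, if_true, Finset.mul_sum, map_sum]
        refine Finset.sum_congr rfl fun p _ => ?_
        rw [mul_smul_comm, map_smul, smul_eq_mul, h.comm, mul_assoc, div_eq_inv_mul]
    _ = τ x := by rw [hq.resolve, mul_one]

theorem repr_nonneg {s : A} (hs : ∀ x, 0 ≤ τ (σ x * (s * x))) (w : P → F) :
    0 ≤ w ⬝ᵥ repr σ τ q key κ s *ᵥ w := by
  let y : K → A := fun c => ∑ p, if key p = c then w p • q p else 0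
  have key_sum : w ⬝ᵥ repr σ τ q key κ s *ᵥ w =
      ∑ c ∈ Finset.univ.image key, τ (σ (y c) * (s * y c)) / κ c := by
    have h1 : ∀ c, τ (σ (y c) * (s * y c)) / κ c = ∑ p, if key p = c then
        ∑ p', (if c = key p' then w p * (τ (σ (q p) * (s * q p')) / κ c * w p') else 0) else 0 := by
      intro c
      simp only [y, map_sum, Finset.sum_mul, Finset.sum_div]
      refine Finset.sum_congr rfl fun p _ => ?_
      split_ifs
      · simp only [Finset.mul_sum, map_sum, Finset.sum_div]
        refine Finset.sum_congr rfl fun p' _ => ?_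
        by_cases h2 : key p' = c
        · rw [if_pos h2, if_pos h2.symm, map_smul, smul_mul_assoc, mul_smul_comm, mul_smul_comm,
            map_smul, map_smul, smul_eq_mul, smul_eq_mul]
          ring
        · rw [if_neg h2, if_neg (Ne.symm h2), mul_zero, mul_zero, map_zero, zero_div]
      · simp
    simp only [h1]
    rw [Finset.sum_comm]
    refine Finset.sum_congr rfl fun p _ => ?_
    rw [Finset.sum_ite_eq, if_pos (Finset.mem_image_of_mem _ (Finset.mem_univ p)), mulVec,
      dotProduct, Finset.mul_sum]
    refine Finset.sum_congr rfl fun p' _ => ?_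
    rw [repr_apply]
    split_ifs
    · rfl
    · rw [zero_mul, mul_zero]
  rw [key_sum]
  refine Finset.sum_nonneg fun c hc => ?_
  obtain ⟨p, -, rfl⟩ := Finset.mem_image.1 hc
  exact div_nonneg (hs _) (hq.pos p).le

end IsFrame

/-- An algebra with positive trace satisfying the integrality conditions of `n × n` matrices has a
trace preserving `*`-representation on `n × n` matrices. -/
theorem IsPositiveTrace.exists_representation (hF : NoRealExtension F) (h : IsPositiveTrace σ τ)
    (halg : ∀ a, σ a = a → ∃ p : Polynomial F, p ≠ 0 ∧ Polynomial.aeval a p = 0)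
    {n : ℕ} (hn : τ 1 = n)
    (h1 : ∀ e, IsProj σ e → ∃ k : ℕ, τ e = k)
    (h2 : ∀ e i, IsProj σ e → e * i = i → σ i = -i → i * i = -e → ∃ m : ℕ, τ e = 2 * m)
    (h4 : ∀ e i j, IsProj σ e → e * i = i → e * j = j → σ i = -i → σ j = -j → i * i = -e →
      j * j = -e → i * j = -(j * i) → ∃ m : ℕ, τ e = 4 * m) :
    ∃ π : A →ₐ[F] Matrix (Fin n) (Fin n) F, (∀ x, π (σ x) = (π x)ᵀ) ∧
      (∀ x, trace (π x) = τ x) ∧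
      ∀ s, (∀ x, 0 ≤ τ (σ x * (s * x))) → ∀ w, 0 ≤ w ⬝ᵥ π s *ᵥ w := by
  obtain ⟨P, K, _, _, _, q, key, κ, hq⟩ := h.exists_isFrame hF halg h1 h2 h4
  have hcard : Fintype.card P = n := by
    have := hq.trace_repr h 1
    rw [hq.repr_one, trace_one, hn] at this
    exact_mod_cast this
  let E : P ≃ Fin n := Fintype.equivFinOfCardEq hcard
  let π₀ : A →ₐ[F] Matrix P P F :=
    AlgHom.ofLinearMap (IsFrame.repr σ τ q key κ) hq.repr_one hq.repr_mul
  refine ⟨(Matrix.reindexAlgEquiv F F E).toAlgHom.comp π₀, fun x => ?_, fun x => ?_,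
    fun s hs w => ?_⟩
  · change reindex E E (IsFrame.repr σ τ q key κ (σ x)) = (reindex E E (IsFrame.repr σ τ q key κ x))ᵀ
    rw [hq.repr_star h, transpose_reindex]
  · change trace (reindex E E (IsFrame.repr σ τ q key κ x)) = _
    rw [← hq.trace_repr h x]
    simp only [trace, diag_apply, reindex_apply, submatrix_apply]
    exact Equiv.sum_comp E.symm fun p => IsFrame.repr σ τ q key κ x p p
  · change 0 ≤ w ⬝ᵥ reindex E E (IsFrame.repr σ τ q key κ s) *ᵥ w
    have := hq.repr_nonneg hs (w ∘ E)
    rwa [reindex_apply, submatrix_mulVec_equiv, Equiv.symm_symm, dotProduct_comp_equiv_symm]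

end Representation

section Integrality

set_option linter.unusedSectionVars false

variable {F A : Type*} [Field F] [LinearOrder F] [IsStrictOrderedRing F] [Ring A] [Algebra F A]

theorem exists_eq_natCast_of_recursion {c : F} {r : F} {s : ℕ → F} {n : ℕ}
    (h0 : s 0 ≠ 0) (hn : ∀ k, n < k → s k = 0)
    (hs : ∀ k : ℕ, ∃ u : F, u * s (k + 1) = (r - c * k) * s k) : ∃ k : ℕ, r = c * k := by
  by_contra! hne
  have : ∀ k, s k ≠ 0 := by
    intro k
    induction k with
    | zero => exact h0
    | succ k ih =>
      intro h
      obtain ⟨u, hu⟩ := hs k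
      rw [h, mul_zero] at hu
      exact mul_ne_zero (sub_ne_zero.2 (hne k)) ih hu.symm
  exact this (n + 1) (hn _ (Nat.lt_succ_self n))

/-- The formal Newton and Pfaffian identities satisfied by the trace of `n × n` matrices. -/
structure HasTraceIdentities (σ : A →ₗ[F] A) (τ : A →ₗ[F] F) (n : ℕ) : Prop where
  newton : ∀ x : A, ∃ s : ℕ → F, s 0 = 1 ∧ (∀ k, n < k → s k = 0) ∧ ∀ k : ℕ,
    (k + 1 : F) * s (k + 1) =
      ∑ i ∈ Finset.range (k + 1), (-1) ^ i * s (k - i) * τ (x ^ (i + 1))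
  pfaffian : ∀ a b : A, σ a = -a → σ b = -b → ∃ q : ℕ → F, q 0 = 1 ∧ (∀ k, n < k → q k = 0) ∧
    ∀ k : ℕ, 2 * (k + 1 : F) * q (k + 1) =
      ∑ i ∈ Finset.range (k + 1), (-1) ^ i * q (k - i) * τ ((a * b) ^ (i + 1))

namespace HasTraceIdentities

variable {σ : A →ₗ[F] A} {τ : A →ₗ[F] F} {n : ℕ} (h : HasTraceIdentities σ τ n)
include h

theorem trace_proj {e : A} (he : e * e = e) : ∃ k : ℕ, τ e = k := by
  obtain ⟨s, h0, hn, hs⟩ := h.newton e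
  have hpow : ∀ i, e ^ (i + 1) = e := fun i => IsIdempotentElem.pow_succ_eq i he
  simp only [hpow] at hs
  have key : ∃ k : ℕ, τ e = 1 * k := by
    refine exists_eq_natCast_of_recursion (h0 ▸ one_ne_zero) hn (fun k => ⟨k + 1, ?_⟩)
    cases k with
    | zero => simpa [h0] using hs 0
    | succ k =>
      rw [hs (k + 1), Finset.sum_range_succ']
      simp only [Nat.add_sub_add_right, pow_succ, mul_neg, mul_one, neg_mul, Finset.sum_neg_distrib,
        ← hs k]
      push_cast
      simp only [pow_zero, one_mul]
      ring
  simpa only [one_mul] using key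

theorem trace_proj_complex {e i : A} (he : e * e = e) (hi : σ i = -i) (hii : i * i = -e) :
    ∃ k : ℕ, τ e = 2 * k := by
  obtain ⟨q, h0, hn, hq⟩ := h.pfaffian i i hi hi
  have hpow : ∀ k, τ ((i * i) ^ (k + 1)) = (-1) ^ (k + 1) * τ e := by
    intro k
    rw [hii, neg_pow, IsIdempotentElem.pow_succ_eq k he]
    rcases neg_one_pow_eq_or A (k + 1) with h1 | h1 <;>
      rcases Nat.even_or_odd (k + 1) with h2 | h2 <;> simp [h2.neg_one_pow]
  simp only [hpow] at hq
  refine exists_eq_natCast_of_recursion (c := 2) (r := τ e)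
    (h0 ▸ one_ne_zero) hn (fun k => ⟨-(2 * (k + 1)), ?_⟩)
  cases k with
  | zero =>
    have := hq 0
    simp at this
    simp [this, mul_comm]
  | succ k =>
    rw [neg_mul, hq (k + 1), Finset.sum_range_succ']
    simp only [Nat.add_sub_add_right]
    have : ∀ i, (-1 : F) ^ (i + 1) * q (k - i) * ((-1) ^ (i + 1 + 1) * τ e) =
        (-1) ^ i * q (k - i) * ((-1) ^ (i + 1) * τ e) := fun i => by ring
    simp only [this, ← hq k]
    push_cast
    simp only [pow_zero, one_mul]
    ring

theorem trace_proj_quaternion {e i j : A} (hσ : ∀ a b, σ (a * b) = σ b * σ a)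
    (hτ : ∀ a, τ (σ a) = τ a) (hei : e * i = i) (hie : i * e = i)
    (hi : σ i = -i) (hj : σ j = -j) (hii : i * i = -e) (hjj : j * j = -e)
    (hij : i * j = -(j * i)) : ∃ k : ℕ, τ e = 4 * k := by
  obtain ⟨q, h0, hn, hq⟩ := h.pfaffian i j hi hj
  have hk2 : (i * j) * (i * j) = -e := by
    calc (i * j) * (i * j) = -((i * j) * (j * i)) := by rw [← mul_neg, ← hij]
      _ = -(i * (j * j) * i) := by simp only [mul_assoc]
      _ = -e := by rw [hjj, mul_neg, neg_mul, hie, hii, neg_neg]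
  have hek : e * (i * j) = i * j := by rw [← mul_assoc, hei]
  have ht1 : τ ((i * j) ^ 1) = 0 := by
    have := hτ (i * j)
    rw [hσ, hi, hj, neg_mul_neg, ← neg_neg (j * i), ← hij, map_neg] at this
    rw [pow_one]; linarith
  have ht2 : τ ((i * j) ^ 2) = -τ e := by rw [pow_two, hk2, map_neg]
  have ht3 : ∀ k, τ ((i * j) ^ (k + 2 + 1)) = -τ ((i * j) ^ (k + 1)) := by
    intro k
    have : (i * j) ^ (k + 2 + 1) = (i * j) * (i * j) * (i * j) ^ (k + 1) := by
      rw [← pow_two, ← pow_add]; congr 1; ring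
    rw [this, hk2, neg_mul, pow_succ', ← mul_assoc, hek, map_neg]
  have key : ∀ k : ℕ, 2 * (k + 2 : F) * q (k + 2) = (τ e - 2 * k) * q k := by
    intro k
    cases k with
    | zero =>
      have := hq 1
      simp only [Finset.sum_range_succ, Finset.sum_range_zero] at this
      norm_num at this ht1 ht2 ⊢
      rw [ht1, ht2] at this
      linarith
    | succ k =>
      have := hq (k + 2)
      rw [Finset.sum_range_succ', Finset.sum_range_succ'] at this
      simp only [Nat.reduceAdd, zero_add, ht2, add_assoc, Nat.reduceSubDiff, one_add_one_eq_two] at this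
      have h5 : ∀ x, (-1 : F) ^ (x + 2) * q (k - x) * τ ((i * j) ^ (x + (2 + 1))) =
          -((-1) ^ x * q (k - x) * τ ((i * j) ^ (x + 1))) := by
        intro x
        rw [← add_assoc, ht3]; ring
      have h6 := hq k
      simp only [h5, Finset.sum_neg_distrib, ← h6] at this
      push_cast at this ⊢
      linear_combination this + q (k + 2) * ht1
  refine exists_eq_natCast_of_recursion (c := 4) (r := τ e) (s := fun k => q (2 * k))
    (n := n) (by simp [h0]) (fun k hk => hn _ (by omega)) (fun k => ⟨4 * (k + 1), ?_⟩)
  have := key (2 * k)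
  push_cast at this
  rw [mul_add 2 k 1, mul_one]
  linear_combination this

end HasTraceIdentities

end Integrality

section Separation

set_option linter.unusedSectionVars false

variable {F B : Type*} [Field F] [LinearOrder F] [IsStrictOrderedRing F] [Ring B] [Algebra F B]

/-- An involution together with an invariant tracial linear form that is positive semidefinite with
respect to it. -/
structure IsSemipositiveTrace (σ : B →ₗ[F] B) (τ : B →ₗ[F] F) : Prop where
  star_mul : ∀ a b, σ (a * b) = σ b * σ a
  star_star : ∀ a, σ (σ a) = a
  comm : ∀ a b, τ (a * b) = τ (b * a)
  star : ∀ a, τ (σ a) = τ a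
  nonneg : ∀ a, 0 ≤ τ (σ a * a)

namespace IsSemipositiveTrace

variable {σ : B →ₗ[F] B} {τ : B →ₗ[F] F} (h : IsSemipositiveTrace σ τ)

theorem eq_zero_of_star_mul_self (h : IsSemipositiveTrace σ τ) {x : B} (hx : τ (σ x * x) = 0)
    (y : B) : τ (y * x) = 0 := by
  have h1 : ∀ c : F, 0 ≤ 2 * c * τ (y * x) + c ^ 2 * τ (y * σ y) := by
    intro c
    have h2 := h.nonneg (x + c • σ y)
    have h3 : τ (σ x * σ y) = τ (y * x) := by rw [← h.star_mul, h.star]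
    simp only [map_add, map_smul, add_mul, mul_add, smul_mul_assoc, mul_smul_comm, h.star_star, hx,
      h3, smul_eq_mul] at h2
    linarith
  by_contra hne
  rcases (h.star_star y ▸ h.nonneg (σ y)).eq_or_lt with h0 | h0
  · have h2 := h1 (-τ (y * x))
    rw [← h0] at h2
    have := mul_self_pos.2 hne
    nlinarith
  · have h2 := h1 (-τ (y * x) / τ (y * σ y))
    have h3 : 2 * (-τ (y * x) / τ (y * σ y)) * τ (y * x) +
        (-τ (y * x) / τ (y * σ y)) ^ 2 * τ (y * σ y) = -(τ (y * x) ^ 2 / τ (y * σ y)) := by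
      field_simp; ring
    rw [h3] at h2
    have : 0 < τ (y * x) ^ 2 / τ (y * σ y) := by positivity
    linarith

/-- The ideal of elements orthogonal to everything. -/
def kernel (h : IsSemipositiveTrace σ τ) : Ideal B where
  carrier := {x | ∀ y, τ (y * x) = 0}
  add_mem' hx hy z := by rw [mul_add, map_add, hx z, hy z, add_zero]
  zero_mem' z := by rw [mul_zero, map_zero]
  smul_mem' a x hx z := by rw [smul_eq_mul, ← mul_assoc]; exact hx _

instance isTwoSided_kernel : h.kernel.IsTwoSided where
  mul_mem_of_left {a} b ha := fun y => by
    rw [← mul_assoc, h.comm, ← mul_assoc]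
    exact ha _

/-- The involution of the quotient by the kernel. -/
def quotientStar : (B ⧸ h.kernel) →ₗ[F] (B ⧸ h.kernel) :=
  Submodule.mapQ (h.kernel.restrictScalars F) (h.kernel.restrictScalars F) σ (by
    intro x hx y
    rw [← h.star, h.star_mul, h.star_star, h.comm]
    exact hx _)

/-- The trace of the quotient by the kernel. -/
def quotientTrace : (B ⧸ h.kernel) →ₗ[F] F :=
  Submodule.liftQ (h.kernel.restrictScalars F) τ (by
    intro x hx
    have := hx 1
    rwa [one_mul] at this)

theorem quotientStar_mk (x : B) : h.quotientStar (Ideal.Quotient.mk h.kernel x) =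
    Ideal.Quotient.mk h.kernel (σ x) := rfl

theorem quotientTrace_mk (x : B) : h.quotientTrace (Ideal.Quotient.mk h.kernel x) = τ x := rfl

theorem isPositiveTrace_quotient : IsPositiveTrace h.quotientStar h.quotientTrace where
  star_mul a b := by
    obtain ⟨a, rfl⟩ := Ideal.Quotient.mk_surjective a
    obtain ⟨b, rfl⟩ := Ideal.Quotient.mk_surjective b
    rw [← map_mul, quotientStar_mk, quotientStar_mk, quotientStar_mk, ← map_mul, h.star_mul]
  star_star a := by
    obtain ⟨a, rfl⟩ := Ideal.Quotient.mk_surjective a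
    rw [quotientStar_mk, quotientStar_mk, h.star_star]
  comm a b := by
    obtain ⟨a, rfl⟩ := Ideal.Quotient.mk_surjective a
    obtain ⟨b, rfl⟩ := Ideal.Quotient.mk_surjective b
    rw [← map_mul, ← map_mul, quotientTrace_mk, quotientTrace_mk, h.comm]
  star a := by
    obtain ⟨a, rfl⟩ := Ideal.Quotient.mk_surjective a
    rw [quotientStar_mk, quotientTrace_mk, quotientTrace_mk, h.star]
  pos a ha := by
    obtain ⟨a, rfl⟩ := Ideal.Quotient.mk_surjective a
    rw [quotientStar_mk, ← map_mul, quotientTrace_mk]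
    refine (h.nonneg a).lt_of_ne' fun h0 => ha ?_
    exact Ideal.Quotient.eq_zero_iff_mem.2 fun y => h.eq_zero_of_star_mul_self h0 y

theorem hasTraceIdentities_quotient {n : ℕ} (hid : HasTraceIdentities σ τ n) :
    HasTraceIdentities h.quotientStar h.quotientTrace n where
  newton x := by
    obtain ⟨x, rfl⟩ := Ideal.Quotient.mk_surjective x
    simpa only [← map_pow, quotientTrace_mk] using hid.newton x
  pfaffian a b ha hb := by
    have lift : ∀ a, h.quotientStar a = -a → ∃ x, σ x = -x ∧ Ideal.Quotient.mk h.kernel x = a := by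
      intro a ha
      obtain ⟨a, rfl⟩ := Ideal.Quotient.mk_surjective a
      refine ⟨(2⁻¹ : F) • (a - σ a), ?_, ?_⟩
      · rw [map_smul, map_sub, h.star_star, ← smul_neg, neg_sub]
      · rw [quotientStar_mk] at ha
        change Ideal.Quotient.mkₐ F h.kernel ((2⁻¹ : F) • (a - σ a)) = _
        rw [map_smul, map_sub]
        change (2⁻¹ : F) • (Ideal.Quotient.mk h.kernel a - Ideal.Quotient.mk h.kernel (σ a)) = _
        rw [ha, sub_neg_eq_add, ← two_smul F, smul_smul, inv_mul_cancel₀ two_ne_zero, one_smul]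
    obtain ⟨a, ha', rfl⟩ := lift a ha
    obtain ⟨b, hb', rfl⟩ := lift b hb
    simpa only [← map_pow, ← map_mul, quotientTrace_mk] using hid.pfaffian a b ha' hb'

include h in
/-- An algebra with a semipositive trace satisfying the formal identities of `n × n` matrices has a
trace preserving `*`-representation on `n × n` matrices. -/
theorem exists_representation (hF : NoRealExtension F) {n : ℕ} (hn : τ 1 = n)
    (hid : HasTraceIdentities σ τ n)
    (halg : ∀ x, ∃ p : Polynomial F, p ≠ 0 ∧ ∀ z, τ (z * Polynomial.aeval x p) = 0) :
    ∃ π : B →ₐ[F] Matrix (Fin n) (Fin n) F, (∀ x, π (σ x) = (π x)ᵀ) ∧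
      (∀ x, trace (π x) = τ x) ∧
      ∀ s, (∀ x, 0 ≤ τ (σ x * (s * x))) → ∀ w, 0 ≤ w ⬝ᵥ π s *ᵥ w := by
  have hq := h.isPositiveTrace_quotient
  have hid' := h.hasTraceIdentities_quotient hid
  obtain ⟨π, h1, h2, h3⟩ := hq.exists_representation hF
    (fun a _ => by
      obtain ⟨a, rfl⟩ := Ideal.Quotient.mk_surjective a
      obtain ⟨p, hp0, hp⟩ := halg a
      refine ⟨p, hp0, ?_⟩
      change Polynomial.aeval (Ideal.Quotient.mkₐ F h.kernel a) p = 0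
      rw [Polynomial.aeval_algHom_apply]
      exact Ideal.Quotient.eq_zero_iff_mem.2 hp)
    (n := n) (by rw [← map_one (Ideal.Quotient.mk h.kernel), quotientTrace_mk, hn])
    (fun e he => hid'.trace_proj he.idem)
    (fun e i he _ hi hii => hid'.trace_proj_complex he.idem hi hii)
    (fun e i j he hei _ hi hj hii hjj hij => hid'.trace_proj_quaternion hq.star_mul hq.star
      hei (hq.mul_proj_of_skew he.star hi hei) hi hj hii hjj hij)
  refine ⟨π.comp (Ideal.Quotient.mkₐ F h.kernel), fun x => h1 (Ideal.Quotient.mk h.kernel x),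
    fun x => h2 (Ideal.Quotient.mk h.kernel x), fun s hs w => h3 _ (fun x => ?_) w⟩
  obtain ⟨x, rfl⟩ := Ideal.Quotient.mk_surjective x
  exact hs x

end IsSemipositiveTrace

end Separation

section MatrixTraceIdentities

theorem charpoly_coeff_eq_detCoeff {R : Type*} [CommRing R] {ι : Type*} [Fintype ι] [DecidableEq ι]
    (M : Matrix ι ι R) {i : ℕ} (hi : i ≤ Fintype.card ι) :
    M.charpoly.coeff i = detCoeff (-M) (Fintype.card ι - i) := by
  nontriviality R
  have h1 : det (1 + (Polynomial.X : Polynomial R) • (-M).map Polynomial.C) = M.charpolyRev := by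
    rw [charpolyRev, Matrix.map_neg _ (map_neg _), smul_neg, sub_eq_add_neg]
  rw [detCoeff, h1, ← reverse_charpoly, Polynomial.coeff_reverse, charpoly_natDegree_eq_dim,
    Polynomial.revAt_le (Nat.sub_le _ _), Nat.sub_sub_self hi]

variable {F R : Type*} [Field F] [CommRing R] [Algebra F R]

theorem Subalgebra.mem_of_recursion (D : Subalgebra F R) {s t : ℕ → R} {c : ℕ → F}
    (hc : ∀ k, c k ≠ 0) (h0 : s 0 = 1) (ht : ∀ k, t k ∈ D)
    (hs : ∀ k, algebraMap F R (c k) * s (k + 1) =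
      ∑ i ∈ Finset.range (k + 1), (-1) ^ i * s (k - i) * t i) (k : ℕ) : s k ∈ D := by
  induction k using Nat.strong_induction_on with
  | _ k ih =>
  cases k with
  | zero => rw [h0]; exact D.one_mem
  | succ k =>
    have h1 : s (k + 1) = (c k)⁻¹ • (algebraMap F R (c k) * s (k + 1)) := by
      rw [← Algebra.smul_def, smul_smul, inv_mul_cancel₀ (hc k), one_smul]
    rw [h1, hs]
    refine D.smul_mem (D.sum_mem fun i hi => D.mul_mem (D.mul_mem ?_ (ih _ (by omega))) (ht i)) _
    exact D.pow_mem (D.neg_mem D.one_mem) _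

theorem detCoeff_mem [CharZero F] {ι : Type*} [Fintype ι] [DecidableEq ι] (D : Subalgebra F R)
    {M : Matrix ι ι R} (hM : ∀ k, trace (M ^ (k + 1)) ∈ D) (k : ℕ) : detCoeff M k ∈ D :=
  D.mem_of_recursion (c := fun k => k + 1) (fun k => Nat.cast_add_one_ne_zero k)
    (detCoeff_zero M) hM (fun k => by simpa using detCoeff_succ M k) k

variable {n : ℕ} (B : Subalgebra F (Matrix (Fin n) (Fin n) R))
  (hT : ∀ x ∈ B, xᵀ ∈ B) (D : Subalgebra F R) (htr : ∀ x ∈ B, trace x ∈ D) (Φ : D →ₐ[F] F)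

/-- The transposition on an algebra of matrices. -/
def transposeOn : B →ₗ[F] B where
  toFun x := ⟨xᵀ, hT x x.2⟩
  map_add' _ _ := rfl
  map_smul' _ _ := rfl

/-- The trace on an algebra of matrices, specialized along a character. -/
def traceOn : B →ₗ[F] F where
  toFun x := Φ ⟨trace (x : Matrix (Fin n) (Fin n) R), htr x x.2⟩
  map_add' x y := (congrArg Φ (Subtype.ext (trace_add x.1 y.1))).trans
    (map_add Φ ⟨trace x.1, htr x x.2⟩ ⟨trace y.1, htr y y.2⟩)
  map_smul' c x := (congrArg Φ (Subtype.ext (trace_smul c x.1))).trans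
    (map_smul Φ c ⟨trace x.1, htr x x.2⟩)

theorem traceOn_apply (x : B) (c : D) (hc : trace (x : Matrix (Fin n) (Fin n) R) = c) :
    traceOn B D htr Φ x = Φ c := congrArg Φ (Subtype.ext hc)

theorem hasTraceIdentities_of_matrix [CharZero F] [LinearOrder F] [IsStrictOrderedRing F]
    [IsDomain R] [IsIntegrallyClosed R] :
    HasTraceIdentities (transposeOn B hT) (traceOn B D htr Φ) n where
  newton x := by
    have hD := detCoeff_mem D (M := (x : Matrix (Fin n) (Fin n) R))
      (fun k => htr _ (B.pow_mem x.2 (k + 1)))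
    refine ⟨fun k => Φ ⟨detCoeff x.1 k, hD k⟩, ?_, fun k hk => ?_, fun k => ?_⟩
    · exact (congrArg Φ (Subtype.ext (detCoeff_zero x.1))).trans (map_one Φ)
    · exact (congrArg Φ (Subtype.ext (detCoeff_eq_zero x.1 (by simpa using hk)))).trans (map_zero Φ)
    · have h1 : (k + 1 : D) * ⟨detCoeff x.1 (k + 1), hD _⟩ = ∑ i ∈ Finset.range (k + 1),
          (-1) ^ i * ⟨detCoeff x.1 (k - i), hD _⟩ * ⟨trace (x.1 ^ (i + 1)),
            htr _ (B.pow_mem x.2 (i + 1))⟩ := by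
        apply Subtype.ext
        push_cast
        exact detCoeff_succ _ _
      have h2 := congrArg Φ h1
      simp only [map_mul, map_add, map_natCast, map_one, map_sum, map_pow, map_neg] at h2
      rw [h2]
      rfl
  pfaffian a b ha hb := by
    have hcz : CharZero R := charZero_of_injective_algebraMap (algebraMap F R).injective
    obtain ⟨q, h0, hn, hq⟩ := exists_half_detCoeff a.1 b.1 (congrArg Subtype.val ha)
      (congrArg Subtype.val hb)
    have hD := D.mem_of_recursion (c := fun k => 2 * (k + 1)) (s := q)
      (fun k => mul_ne_zero two_ne_zero (Nat.cast_add_one_ne_zero k)) h0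
      (fun k => htr _ (B.pow_mem (B.mul_mem a.2 b.2) (k + 1)))
      (fun k => by rw [map_mul, map_ofNat, map_add, map_natCast, map_one]; exact hq k)
    refine ⟨fun k => Φ ⟨q k, hD k⟩, ?_, fun k hk => ?_, fun k => ?_⟩
    · exact (congrArg Φ (Subtype.ext h0)).trans (map_one Φ)
    · exact (congrArg Φ (Subtype.ext (hn k (by simpa using hk)))).trans (map_zero Φ)
    · have h1 : 2 * (k + 1 : D) * ⟨q (k + 1), hD _⟩ = ∑ i ∈ Finset.range (k + 1),
          (-1) ^ i * ⟨q (k - i), hD _⟩ * ⟨trace ((a.1 * b.1) ^ (i + 1)),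
            htr _ (B.pow_mem (B.mul_mem a.2 b.2) (i + 1))⟩ := by
        apply Subtype.ext
        push_cast
        exact hq _
      have h2 := congrArg Φ h1
      simp only [map_mul, map_add, map_natCast, map_one, map_sum, map_pow, map_neg,
        map_ofNat] at h2
      rw [h2]
      rfl

theorem exists_annihilating_polynomial [CharZero F] [Nontrivial R] (x : B) :
    ∃ p : Polynomial F, p ≠ 0 ∧ ∀ z, traceOn B D htr Φ (z * Polynomial.aeval x p) = 0 := by
  have hD : ∀ i ≤ n, (x : Matrix (Fin n) (Fin n) R).charpoly.coeff i ∈ D := by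
    intro i hi
    rw [charpoly_coeff_eq_detCoeff _ (by simpa using hi)]
    exact detCoeff_mem D (fun k => htr _ (B.pow_mem (B.neg_mem x.2) (k + 1))) _
  let c : ℕ → D := fun i => if hi : i ≤ n then ⟨_, hD i hi⟩ else 0
  have hc : ∀ i ∈ Finset.range (n + 1), (c i : R) = (x : Matrix (Fin n) (Fin n) R).charpoly.coeff i := by
    intro i hi
    have : i ≤ n := by simpa [Nat.lt_succ_iff] using hi
    simp only [c, dif_pos this]
  have hdeg : (x : Matrix (Fin n) (Fin n) R).charpoly.natDegree = n := by
    rw [charpoly_natDegree_eq_dim, Fintype.card_fin]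
  refine ⟨∑ i ∈ Finset.range (n + 1), Polynomial.monomial i (Φ (c i)), ?_, fun z => ?_⟩
  · intro h0
    have h1 := congrArg (fun p => p.coeff n) h0
    simp only [Polynomial.finsetSum_coeff, Polynomial.coeff_monomial, Polynomial.coeff_zero] at h1
    rw [Finset.sum_ite_eq' , if_pos (by simp)] at h1
    have h2 : c n = 1 := by
      apply Subtype.ext
      rw [hc n (by simp)]
      have := charpoly_monic (x : Matrix (Fin n) (Fin n) R)
      rwa [Polynomial.Monic, Polynomial.leadingCoeff, hdeg] at this
    rw [h2, map_one] at h1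
    exact one_ne_zero h1
  · have h1 : ∀ i, traceOn B D htr Φ (z * (Φ (c i) • x ^ i)) =
        Φ (c i * ⟨trace (z.1 * x.1 ^ i), htr _ (B.mul_mem z.2 (B.pow_mem x.2 i))⟩) := by
      intro i
      rw [mul_smul_comm, map_smul, map_mul Φ]
      rfl
    simp only [map_sum, Polynomial.aeval_monomial, ← Algebra.smul_def, Finset.mul_sum, h1]
    rw [← map_sum, ← map_zero Φ]
    congr 1
    apply Subtype.ext
    have h2 := aeval_self_charpoly (x : Matrix (Fin n) (Fin n) R)
    rw [Polynomial.aeval_eq_sum_range, hdeg] at h2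
    have h3 := congrArg (fun y => trace (z.1 * y)) h2
    simp only [Finset.mul_sum, trace_sum, mul_smul_comm, trace_smul, mul_zero, trace_zero,
      smul_eq_mul] at h3
    push_cast
    rw [← h3]
    exact Finset.sum_congr rfl fun i hi => by rw [hc i hi]

end MatrixTraceIdentities

/-- A character of a real algebra of polynomials extends to the algebra it spans after extension of
scalars along the restriction of the character to the constants. -/
theorem exists_extension_character {σ F : Type*} [Field F] (C : Subalgebra ℝ (MvPolynomial σ ℝ))
    (φ : C →+* F) : ∃ (D : Subalgebra F (MvPolynomial σ F)) (Φ : D →ₐ[F] F), ∀ c : C,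
      ∃ h : MvPolynomial.map (φ.comp (algebraMap ℝ C)) c ∈ D, Φ ⟨_, h⟩ = φ c := by
  let _ : Algebra ℝ F := (φ.comp (algebraMap ℝ C)).toAlgebra
  let φ' : C →ₐ[ℝ] F := { φ with commutes' := fun _ => rfl }
  let j : TensorProduct ℝ F C →ₐ[F] MvPolynomial σ F :=
    (MvPolynomial.algebraTensorAlgEquiv ℝ F).toAlgHom.comp
      (Algebra.TensorProduct.map (AlgHom.id F F) C.val)
  have hj : Function.Injective j := by
    refine (MvPolynomial.algebraTensorAlgEquiv ℝ F).injective.comp ?_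
    exact Module.Flat.lTensor_preserves_injective_linearMap (M := F) C.val.toLinearMap
      Subtype.val_injective
  have hj1 : ∀ c : C, j (TensorProduct.tmul ℝ 1 c) =
      MvPolynomial.map (φ.comp (algebraMap ℝ C)) (c : MvPolynomial σ ℝ) := by
    intro c
    simp only [j, AlgHom.comp_apply, Algebra.TensorProduct.map_tmul, map_one]
    exact (MvPolynomial.algebraTensorAlgEquiv_tmul ℝ F (1 : F) (c : MvPolynomial σ ℝ)).trans
      (one_smul _ _)
  let Φ' : TensorProduct ℝ F C →ₐ[F] F :=
    Algebra.TensorProduct.lift (AlgHom.id F F) φ' fun _ _ => Commute.all _ _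
  refine ⟨j.range, Φ'.comp (AlgEquiv.ofInjective j hj).symm.toAlgHom, fun c => ?_⟩
  have hc : MvPolynomial.map (φ.comp (algebraMap ℝ C)) (c : MvPolynomial σ ℝ) ∈ j.range :=
    ⟨TensorProduct.tmul ℝ 1 c, hj1 c⟩
  refine ⟨hc, ?_⟩
  have : (⟨_, hc⟩ : j.range) = AlgEquiv.ofInjective j hj (TensorProduct.tmul ℝ 1 c) :=
    Subtype.ext (hj1 c).symm
  rw [this]
  simp [Φ', φ']

section Words

variable (n g : ℕ)

/-- The monoid of words in the generic matrices and their transposes. -/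
def wordMonoid : Submonoid (MatP n g) := Submonoid.closure (genSet n g)

/-- The algebra of pure trace polynomials. -/
def traceAlg : Subalgebra ℝ (PolyRing n g) :=
  Algebra.adjoin ℝ {p | ∃ w ∈ wordMonoid n g, p = trace w}

variable {n g}

theorem transpose_mem_genSet {m : MatP n g} (hm : m ∈ genSet n g) : mᵀ ∈ genSet n g := by
  rcases hm with ⟨j, rfl⟩ | ⟨j, rfl⟩
  · exact Or.inr ⟨j, rfl⟩
  · exact Or.inl ⟨j, (transpose_transpose _).symm⟩

theorem transpose_mem_wordMonoid {m : MatP n g} (hm : m ∈ wordMonoid n g) :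
    mᵀ ∈ wordMonoid n g := by
  induction hm using Submonoid.closure_induction with
  | mem x hx => exact Submonoid.subset_closure (transpose_mem_genSet hx)
  | one => rw [transpose_one]; exact one_mem _
  | mul x y _ _ hx hy => rw [transpose_mul]; exact mul_mem hy hx

theorem trace_mem_traceAlg_of_word {w : MatP n g} (hw : w ∈ wordMonoid n g) :
    trace w ∈ traceAlg n g := Algebra.subset_adjoin ⟨w, hw, rfl⟩

theorem wordMonoid_subset_traceRing {w : MatP n g} (hw : w ∈ wordMonoid n g) :
    w ∈ traceRing n g :=
  (Submonoid.closure_le (S := (traceRing n g).toSubmonoid)).2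
    (fun _ hx => Algebra.subset_adjoin (Or.inl hx)) hw

theorem smul_one_mem_traceRing {c : PolyRing n g} (hc : c ∈ traceAlg n g) :
    c • (1 : MatP n g) ∈ traceRing n g := by
  have h : ∀ p : PolyRing n g, p • (1 : MatP n g) = Algebra.ofId (PolyRing n g) (MatP n g) p :=
    fun p => (Algebra.algebraMap_eq_smul_one p).symm
  have : traceAlg n g ≤ (traceRing n g).comap
      ((Algebra.ofId (PolyRing n g) (MatP n g)).restrictScalars ℝ) := by
    refine Algebra.adjoin_le ?_
    rintro _ ⟨w, hw, rfl⟩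
    refine Algebra.subset_adjoin (Or.inr ⟨w, hw, ?_⟩)
    exact (h _).symm
  rw [h]
  exact this hc

theorem smul_mem_traceRing {c : PolyRing n g} (hc : c ∈ traceAlg n g) {h : MatP n g}
    (hh : h ∈ traceRing n g) : c • h ∈ traceRing n g := by
  rw [← one_mul h, ← smul_mul_assoc]
  exact mul_mem (smul_one_mem_traceRing hc) hh

theorem mul_mem_span_word {x y : MatP n g}
    (hx : x ∈ Submodule.span (traceAlg n g) (wordMonoid n g : Set (MatP n g)))
    (hy : y ∈ Submodule.span (traceAlg n g) (wordMonoid n g : Set (MatP n g))) :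
    x * y ∈ Submodule.span (traceAlg n g) (wordMonoid n g : Set (MatP n g)) := by
  induction hx using Submodule.span_induction with
  | zero => rw [zero_mul]; exact zero_mem _
  | add a b _ _ ha hb => rw [add_mul]; exact add_mem ha hb
  | smul c a _ ha => rw [smul_mul_assoc]; exact Submodule.smul_mem _ c ha
  | mem v hv =>
    induction hy using Submodule.span_induction with
    | zero => rw [mul_zero]; exact zero_mem _
    | add a b _ _ ha hb => rw [mul_add]; exact add_mem ha hb
    | smul c a _ ha => rw [mul_smul_comm]; exact Submodule.smul_mem _ c ha
    | mem w hw => exact Submodule.subset_span (mul_mem hv hw)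

theorem mem_span_of_mem_traceRing {h : MatP n g} (hh : h ∈ traceRing n g) :
    h ∈ Submodule.span (traceAlg n g) (wordMonoid n g : Set (MatP n g)) := by
  have h1 : ∀ c ∈ traceAlg n g, c • (1 : MatP n g) ∈
      Submodule.span (traceAlg n g) (wordMonoid n g : Set (MatP n g)) := fun c hc =>
    Submodule.smul_mem _ (⟨c, hc⟩ : traceAlg n g)
      (Submodule.subset_span (one_mem (wordMonoid n g)))
  induction hh using Algebra.adjoin_induction with
  | mem x hx =>
    rcases hx with hx | ⟨w, hw, rfl⟩
    · exact Submodule.subset_span (Submonoid.subset_closure hx)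
    · exact h1 _ (trace_mem_traceAlg_of_word hw)
  | algebraMap r =>
    have := h1 _ ((traceAlg n g).algebraMap_mem r)
    rwa [algebraMap_smul, ← Algebra.algebraMap_eq_smul_one] at this
  | add x y _ _ hx hy => exact add_mem hx hy
  | mul x y _ _ hx hy => exact mul_mem_span_word hx hy

theorem exists_eq_sum_of_mem_traceRing {h : MatP n g} (hh : h ∈ traceRing n g) :
    ∃ (m : ℕ) (c : Fin m → traceAlg n g) (w : Fin m → wordMonoid n g),
      h = ∑ k, (c k : PolyRing n g) • (w k : MatP n g) := by
  obtain ⟨m, c, w, rfl⟩ := (Submodule.mem_span_set' ..).1 (mem_span_of_mem_traceRing hh)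
  exact ⟨m, c, w, rfl⟩

theorem trace_mem_traceAlg {h : MatP n g} (hh : h ∈ traceRing n g) : trace h ∈ traceAlg n g := by
  obtain ⟨m, c, w, rfl⟩ := exists_eq_sum_of_mem_traceRing hh
  rw [trace_sum]
  refine sum_mem fun k _ => ?_
  rw [trace_smul]
  exact mul_mem (c k).2 (trace_mem_traceAlg_of_word (w k).2)

theorem transpose_mem_traceRing {h : MatP n g} (hh : h ∈ traceRing n g) : hᵀ ∈ traceRing n g := by
  obtain ⟨m, c, w, rfl⟩ := exists_eq_sum_of_mem_traceRing hh
  rw [transpose_sum]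
  refine sum_mem fun k _ => ?_
  rw [transpose_smul]
  exact smul_mem_traceRing (c k).2
    (wordMonoid_subset_traceRing (transpose_mem_wordMonoid (w k).2))

end Words

section TracePoint

variable {F : Type*} [Field F] {n g : ℕ} (φ : traceAlg n g →+* F)

/-- Extension of scalars of matrices of polynomials along a character of the trace algebra. -/
def wordMap : MatP n g →+* Matrix (Fin n) (Fin n) (MvPolynomial (Fin g × Fin n × Fin n) F) :=
  (MvPolynomial.map (φ.comp (algebraMap ℝ (traceAlg n g)))).mapMatrix

/-- The algebra of generic matrices and their transposes after extension of scalars. -/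
def wordAlg : Subalgebra F (Matrix (Fin n) (Fin n) (MvPolynomial (Fin g × Fin n × Fin n) F)) :=
  Algebra.adjoin F (wordMap φ '' genSet n g)

theorem trace_wordMap (m : MatP n g) :
    trace (wordMap φ m) = MvPolynomial.map (φ.comp (algebraMap ℝ (traceAlg n g))) (trace m) := by
  simp [wordMap, trace, map_sum]

theorem wordMap_mem {w : MatP n g} (hw : w ∈ wordMonoid n g) : wordMap φ w ∈ wordAlg φ :=
  (Submonoid.closure_le (S := (wordAlg φ).toSubmonoid.comap (wordMap φ))).2
    (fun x hx => Algebra.subset_adjoin ⟨x, hx, rfl⟩) hw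

theorem exists_eq_sum_of_mem_wordAlg {x} (hx : x ∈ wordAlg φ) :
    ∃ (m : ℕ) (c : Fin m → F) (w : Fin m → wordMonoid n g), x = ∑ k, c k • wordMap φ (w k) := by
  have h1 : x ∈ Subalgebra.toSubmodule (wordAlg φ) := hx
  rw [wordAlg, Algebra.adjoin_eq_span] at h1
  have h2 := MonoidHom.map_mclosure (wordMap φ).toMonoidHom (genSet n g)
  rw [show (wordMap φ '' genSet n g) = (wordMap φ).toMonoidHom '' genSet n g from rfl,
    ← h2] at h1
  obtain ⟨m, c, w, rfl⟩ := (Submodule.mem_span_set' ..).1 h1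
  choose v hv hvw using fun k => (w k).2
  exact ⟨m, c, fun k => ⟨v k, hv k⟩, Finset.sum_congr rfl fun k _ => congrArg _ (hvw k).symm⟩

theorem transpose_mem_wordAlg {x} (hx : x ∈ wordAlg φ) : xᵀ ∈ wordAlg φ := by
  obtain ⟨m, c, w, rfl⟩ := exists_eq_sum_of_mem_wordAlg φ hx
  rw [transpose_sum]
  refine sum_mem fun k _ => ?_
  rw [transpose_smul]
  exact (wordAlg φ).smul_mem (wordMap_mem φ (transpose_mem_wordMonoid (w k).2)) _

theorem trace_mem_of_mem_wordAlg {D : Subalgebra F (MvPolynomial (Fin g × Fin n × Fin n) F)}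
    (hD : ∀ c : traceAlg n g, MvPolynomial.map (φ.comp (algebraMap ℝ (traceAlg n g)))
      (c : PolyRing n g) ∈ D) {x} (hx : x ∈ wordAlg φ) : trace x ∈ D := by
  obtain ⟨m, c, w, rfl⟩ := exists_eq_sum_of_mem_wordAlg φ hx
  rw [trace_sum]
  refine sum_mem fun k _ => ?_
  rw [trace_smul, trace_wordMap]
  exact D.smul_mem (hD ⟨_, trace_mem_traceAlg_of_word (w k).2⟩) _

/-- A word, viewed in the algebra of generic matrices after extension of scalars. -/
def wordIncl : wordMonoid n g →* wordAlg φ where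
  toFun w := ⟨wordMap φ w, wordMap_mem φ w.2⟩
  map_one' := Subtype.ext (map_one (wordMap φ))
  map_mul' v w := Subtype.ext (map_mul (wordMap φ) v.1 w.1)

theorem exists_eq_sum_wordIncl (x : wordAlg φ) : ∃ (m : ℕ) (c : Fin m → F)
    (w : Fin m → wordMonoid n g), x = ∑ k, c k • wordIncl φ (w k) := by
  obtain ⟨m, c, w, h⟩ := exists_eq_sum_of_mem_wordAlg φ x.2
  refine ⟨m, c, w, Subtype.ext ?_⟩
  rw [h]
  push_cast
  rfl

/-- A trace functional on `wordAlg φ` induced by `φ`. -/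
theorem exists_trace_wordAlg : ∃ (D : Subalgebra F (MvPolynomial (Fin g × Fin n × Fin n) F))
    (htr : ∀ x ∈ wordAlg φ, trace x ∈ D) (Φ : D →ₐ[F] F), ∀ (w : wordMonoid n g)
      (c : traceAlg n g), (c : PolyRing n g) = trace (w : MatP n g) →
        traceOn (wordAlg φ) D htr Φ (wordIncl φ w) = φ c := by
  obtain ⟨D, Φ, h⟩ := exists_extension_character (traceAlg n g) φ
  choose hD hΦ using h
  refine ⟨D, fun x hx => trace_mem_of_mem_wordAlg φ hD hx, Φ, fun w c hc => ?_⟩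
  rw [← hΦ c]
  refine traceOn_apply _ _ _ _ _ ⟨_, hD c⟩ ?_
  exact (trace_wordMap φ w.1).trans (congrArg _ hc.symm)

theorem tau_sandwich {τ : wordAlg φ →ₗ[F] F} (hτ : ∀ (w : wordMonoid n g)
      (c : traceAlg n g), (c : PolyRing n g) = trace (w : MatP n g) → τ (wordIncl φ w) = φ c)
    {m : ℕ} (f : Fin m → traceAlg n g) (v : Fin m → wordMonoid n g) {s : MatP n g}
    (hs : s = ∑ k, (f k : PolyRing n g) • (v k : MatP n g)) (u w : wordMonoid n g)
    (c : traceAlg n g) (hc : (c : PolyRing n g) = trace ((u : MatP n g) * (s * (w : MatP n g)))) :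
    τ (wordIncl φ u * ((∑ k, φ (f k) • wordIncl φ (v k)) * wordIncl φ w)) = φ c := by
  have hc' : c = ∑ k, f k * ⟨trace ((u : MatP n g) * ((v k : MatP n g) * (w : MatP n g))),
      trace_mem_traceAlg_of_word (mul_mem u.2 (mul_mem (v k).2 w.2))⟩ := by
    apply Subtype.ext
    rw [hc, hs]
    push_cast
    simp only [Finset.sum_mul, Finset.mul_sum, trace_sum, smul_mul_assoc, mul_smul_comm,
      trace_smul, smul_eq_mul]
  rw [hc', map_sum, Finset.sum_mul, Finset.mul_sum, map_sum]
  refine Finset.sum_congr rfl fun k _ => ?_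
  rw [smul_mul_assoc, mul_smul_comm, map_smul, map_mul φ, smul_eq_mul,
    ← map_mul (wordIncl φ), ← map_mul (wordIncl φ)]
  exact congrArg _ (hτ _ _ rfl)

variable [LinearOrder F]

theorem tau_nonneg {τ : wordAlg φ →ₗ[F] F} (hτ : ∀ (w : wordMonoid n g)
      (c : traceAlg n g), (c : PolyRing n g) = trace (w : MatP n g) → τ (wordIncl φ w) = φ c)
    (P : Set (traceAlg n g))
    (hP : ∀ (m : ℕ) (G : Matrix (Fin m) (Fin m) (traceAlg n g)), Gᵀ = G →
      (∀ c, c ⬝ᵥ G *ᵥ c ∈ P) → ∀ x : Fin m → F, 0 ≤ x ⬝ᵥ G.map φ *ᵥ x)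
    {m : ℕ} (f : Fin m → traceAlg n g) (v : Fin m → wordMonoid n g) {s : MatP n g}
    (hs : s = ∑ k, (f k : PolyRing n g) • (v k : MatP n g)) (hsym : sᵀ = s)
    (hsP : ∀ h ∈ traceRing n g, ∀ c : traceAlg n g,
      (c : PolyRing n g) = trace (hᵀ * (s * h)) → c ∈ P) (x : wordAlg φ) :
    0 ≤ τ (transposeOn (wordAlg φ) (fun _ => transpose_mem_wordAlg φ) x *
      ((∑ k, φ (f k) • wordIncl φ (v k)) * x)) := by
  obtain ⟨l, a, w, rfl⟩ := exists_eq_sum_wordIncl φ x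
  have hsT : s ∈ traceRing n g := by
    rw [hs]
    exact sum_mem fun k _ => smul_mem_traceRing (f k).2 (wordMonoid_subset_traceRing (v k).2)
  let G : Matrix (Fin l) (Fin l) (traceAlg n g) := Matrix.of fun i j =>
    ⟨trace ((w i : MatP n g)ᵀ * (s * (w j : MatP n g))), trace_mem_traceAlg (mul_mem
      (transpose_mem_traceRing (wordMonoid_subset_traceRing (w i).2))
      (mul_mem hsT (wordMonoid_subset_traceRing (w j).2)))⟩
  have hG : Gᵀ = G := by
    ext i j : 2
    change trace ((w j : MatP n g)ᵀ * (s * (w i : MatP n g))) =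
      trace ((w i : MatP n g)ᵀ * (s * (w j : MatP n g)))
    rw [← trace_transpose, transpose_mul, transpose_mul, transpose_transpose, hsym,
      Matrix.mul_assoc]
  have h1 := hP l G hG (fun c => hsP (∑ k, (c k : PolyRing n g) • (w k : MatP n g))
    (sum_mem fun k _ => smul_mem_traceRing (c k).2 (wordMonoid_subset_traceRing (w k).2)) _ (by
      simp only [dotProduct, mulVec, G, Matrix.of_apply, Finset.mul_sum, Finset.sum_mul,
        transpose_sum, transpose_smul, trace_sum, smul_mul_assoc, mul_smul_comm, trace_smul,
        smul_eq_mul]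
      push_cast
      rw [Finset.sum_comm]
      exact Finset.sum_congr rfl fun i _ => Finset.sum_congr rfl fun j _ => by ring)) a
  refine h1.trans_eq ?_
  have h2 : transposeOn (wordAlg φ) (fun _ => transpose_mem_wordAlg φ)
      (∑ k, a k • wordIncl φ (w k)) =
        ∑ k, a k • wordIncl φ ⟨(w k : MatP n g)ᵀ, transpose_mem_wordMonoid (w k).2⟩ := by
    rw [map_sum]
    exact Finset.sum_congr rfl fun k _ => map_smul _ (a k) _
  rw [h2]
  simp only [dotProduct, mulVec, Matrix.map_apply, Finset.mul_sum (ι := Fin l),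
    Finset.sum_mul (ι := Fin l), map_sum τ]
  rw [Finset.sum_comm]
  refine Finset.sum_congr rfl fun i _ => Finset.sum_congr rfl fun j _ => ?_
  rw [mul_smul_comm, mul_smul_comm, smul_mul_assoc, map_smul, map_smul,
    tau_sandwich φ hτ f v hs ⟨(w j : MatP n g)ᵀ, transpose_mem_wordMonoid (w j).2⟩ (w i) (G j i) rfl,
    smul_eq_mul, smul_eq_mul]
  ring

end TracePoint

section ProcesiSchacher

variable {F : Type*} [Field F] [LinearOrder F] [IsStrictOrderedRing F] {n g : ℕ}

/-- **Procesi–Schacher**: a character of the trace algebra which is positive on the trace forms comes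
from a tuple of matrices. -/
theorem exists_point_of_character (hF : NoRealExtension F) (φ : traceAlg n g →+* F)
    (P : Set (traceAlg n g))
    (hP : ∀ (m : ℕ) (G : Matrix (Fin m) (Fin m) (traceAlg n g)), Gᵀ = G →
      (∀ c, c ⬝ᵥ G *ᵥ c ∈ P) → ∀ x : Fin m → F, 0 ≤ x ⬝ᵥ G.map φ *ᵥ x)
    (hsq : ∀ h ∈ traceRing n g, ∀ c : traceAlg n g,
      (c : PolyRing n g) = trace (hᵀ * h) → c ∈ P) :
    ∃ x : Fin g × Fin n × Fin n → F,
      (∀ c : traceAlg n g,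
        MvPolynomial.eval₂ (φ.comp (algebraMap ℝ (traceAlg n g))) x c = φ c) ∧
      ∀ s ∈ traceRing n g, sᵀ = s → (∀ h ∈ traceRing n g, ∀ c : traceAlg n g,
        (c : PolyRing n g) = trace (hᵀ * (s * h)) → c ∈ P) →
        ∀ w : Fin n → F, 0 ≤ w ⬝ᵥ (s.map
          (MvPolynomial.eval₂ (φ.comp (algebraMap ℝ (traceAlg n g))) x)) *ᵥ w := by
  obtain ⟨D, htr, Φ, hτ⟩ := exists_trace_wordAlg φ
  set τ := traceOn (wordAlg φ) D htr Φ
  have hT : ∀ x ∈ wordAlg φ, xᵀ ∈ wordAlg φ := fun _ => transpose_mem_wordAlg φ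
  have hτ1 : τ 1 = n := by
    refine (traceOn_apply _ _ _ _ _ (n : D) ?_).trans (map_natCast Φ n)
    push_cast
    rw [trace_one, Fintype.card_fin]
  have hpos : IsSemipositiveTrace (transposeOn (wordAlg φ) hT) τ :=
    { star_mul := fun a b => Subtype.ext (transpose_mul a.1 b.1)
      star_star := fun a => Subtype.ext (transpose_transpose a.1)
      comm := fun a b => congrArg Φ (Subtype.ext (trace_mul_comm a.1 b.1))
      star := fun a => congrArg Φ (Subtype.ext (trace_transpose a.1))
      nonneg := fun a => by
        have := tau_nonneg φ hτ P hP (m := 1) (fun _ => 1) (fun _ => 1) (s := 1) (by simp)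
          transpose_one (fun h hh c hc => hsq h hh c (by rwa [one_mul] at hc)) a
        simpa using this }
  obtain ⟨π, h1, h2, h3⟩ := hpos.exists_representation hF hτ1
    (hasTraceIdentities_of_matrix _ _ _ _ _) (exists_annihilating_polynomial _ _ _ _)
  let x : Fin g × Fin n × Fin n → F := fun v => π (wordIncl φ ⟨genMat n g v.1,
    Submonoid.subset_closure (Or.inl ⟨v.1, rfl⟩)⟩) v.2.1 v.2.2
  let i : ℝ →+* F := φ.comp (algebraMap ℝ (traceAlg n g))
  have hgen : ∀ j, (genMat n g j).map (MvPolynomial.eval₂Hom i x) =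
      π (wordIncl φ ⟨genMat n g j, Submonoid.subset_closure (Or.inl ⟨j, rfl⟩)⟩) := by
    intro j
    ext a b
    simp [genMat, x]
  have hword : ∀ w (hw : w ∈ wordMonoid n g),
      (MvPolynomial.eval₂Hom i x).mapMatrix w = π (wordIncl φ ⟨w, hw⟩) := by
    intro w hw
    induction hw using Submonoid.closure_induction with
    | mem w hw =>
      rcases hw with ⟨j, rfl⟩ | ⟨j, rfl⟩
      · exact hgen j
      · exact (congrArg transpose (hgen j)).trans (h1 _).symm
    | one =>
      rw [map_one]
      exact ((congrArg π (map_one (wordIncl φ))).trans (map_one π)).symm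
    | mul v w hv hw hv' hw' =>
      rw [map_mul, hv', hw', ← map_mul, ← map_mul]
      rfl
  have hchar : ∀ c : traceAlg n g, MvPolynomial.eval₂Hom i x c = φ c := by
    rintro ⟨c, hc⟩
    induction hc using Algebra.adjoin_induction with
    | mem c hc =>
      obtain ⟨w, hw, rfl⟩ := hc
      rw [← hτ ⟨w, hw⟩ _ rfl, ← h2, ← hword]
      simp [trace, map_sum]
    | algebraMap r =>
      exact MvPolynomial.eval₂_C _ _ _
    | add c d hc hd hc' hd' =>
      exact (map_add _ _ _).trans ((congrArg₂ _ hc' hd').trans (map_add φ _ _).symm)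
    | mul c d hc hd hc' hd' =>
      exact (map_mul _ _ _).trans ((congrArg₂ _ hc' hd').trans (map_mul φ _ _).symm)
  refine ⟨x, hchar, fun s hs hsym hsP w => ?_⟩
  obtain ⟨m, f, v, hfv⟩ := exists_eq_sum_of_mem_traceRing hs
  have h4 := h3 _ (tau_nonneg φ hτ P hP f v hfv hsym hsP) w
  refine h4.trans_eq ?_
  congr 2
  change _ = (MvPolynomial.eval₂Hom i x).mapMatrix s
  rw [hfv, map_sum, map_sum]
  refine Finset.sum_congr rfl fun k _ => ?_
  rw [map_smul, ← hword _ (v k).2, ← hchar]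
  ext a b
  simp

end ProcesiSchacher

section CenterPart

variable {n g : ℕ}

/-- The trace polynomials whose associated scalar matrices lie in `T`. -/
def centerPart (T : Set (MatP n g)) : Set (traceAlg n g) :=
  {c | (c : PolyRing n g) • (1 : MatP n g) ∈ T}

namespace IsCyclicPreordering

variable {T : Set (MatP n g)} (hT : IsCyclicPreordering n g T)
include hT

theorem one_mem_center : 1 ∈ centerPart T := by
  simpa [centerPart] using hT.1.2.1

theorem add_mem_center {c d : traceAlg n g} (hc : c ∈ centerPart T) (hd : d ∈ centerPart T) :
    c + d ∈ centerPart T := by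
  have := hT.1.2.2.1 _ hc _ hd
  rwa [← add_smul] at this

theorem mul_mem_center {c d : traceAlg n g} (hc : c ∈ centerPart T) (hd : d ∈ centerPart T) :
    c * d ∈ centerPart T := by
  have := hT.2 _ ⟨hc, smul_one_mem_traceRing c.2, c, rfl⟩ _ ⟨hd, smul_one_mem_traceRing d.2, d, rfl⟩
  rwa [smul_mul_smul_comm, mul_one] at this

theorem sq_mem_center (c : traceAlg n g) : c * c ∈ centerPart T := by
  have := hT.1.2.2.2.1 _ (smul_one_mem_traceRing c.2) _ hT.1.2.1
  rwa [transpose_smul, transpose_one, mul_one, smul_mul_smul_comm, mul_one] at this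

theorem zero_mem_center : 0 ∈ centerPart T := by
  simpa using hT.sq_mem_center 0

theorem trace_mem_center {q : MatP n g} (hq : q ∈ T) {c : traceAlg n g}
    (hc : (c : PolyRing n g) = trace q) : c ∈ centerPart T := by
  have := hT.1.2.2.2.2 q hq
  rwa [← hc] at this

theorem trace_sandwich_mem_center {s : MatP n g} (hs : s ∈ T) {h : MatP n g}
    (hh : h ∈ traceRing n g) {c : traceAlg n g} (hc : (c : PolyRing n g) = trace (hᵀ * (s * h))) :
    c ∈ centerPart T := by
  refine hT.trace_mem_center (hT.1.2.2.2.1 hᵀ (transpose_mem_traceRing hh) s hs) ?_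
  rw [hc, transpose_transpose, Matrix.mul_assoc]

end IsCyclicPreordering

/-- The evaluation point of the polynomial ring determined by a tuple of matrices. -/
abbrev pointOf (X : Fin g → Matrix (Fin n) (Fin n) ℝ) : Fin g × Fin n × Fin n → ℝ :=
  fun v => X v.1 v.2.1 v.2.2

/-- The sign conditions describing a positive semidefinite point transfer to the reals. -/
theorem exists_real_psd_point {F : Type*} [Field F] [LinearOrder F] [IsStrictOrderedRing F]
    (hF : NoRealExtension F) (i : ℝ →+* F) {S : Set (MatP n g)} (hSfin : S.Finite)
    (x : Fin g × Fin n × Fin n → F) (hsym : ∀ s ∈ S, sᵀ = s)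
    (hx : ∀ s ∈ S, ∀ w : Fin n → F, 0 ≤ w ⬝ᵥ (s.map (MvPolynomial.eval₂ i x)) *ᵥ w)
    (c : PolyRing n g) (hc : MvPolynomial.eval₂ i x c ≤ 0) :
    ∃ X ∈ KSet n g S, MvPolynomial.eval (pointOf X) c ≤ 0 := by
  classical
  have hdec : ∀ s : S, ∃ (W : Matrix (Fin n) (Fin n) F) (d : Fin n → F),
      (s : MatP n g).map (MvPolynomial.eval₂ i x) = Wᵀ * diagonal d * W ∧ ∀ k, 0 ≤ d k := by
    intro s
    obtain ⟨W, d, h1, h2⟩ := exists_eq_transpose_diagonal_mul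
      ((s : MatP n g).map (MvPolynomial.eval₂ i x)) (by rw [← transpose_map, hsym s s.2])
    refine ⟨W, d, h1, fun k => ?_⟩
    obtain ⟨w, hw⟩ := h2 k
    rw [hw]
    exact hx s s.2 w
  choose W d hWd hd using hdec
  have := hSfin.fintype
  let V := (Fin g × Fin n × Fin n) ⊕ (S × Fin n × Fin n) ⊕ (S × Fin n)
  let vW : S → Fin n → Fin n → MvPolynomial V ℝ := fun s k a => .X (.inr (.inl (s, k, a)))
  let vd : S → Fin n → MvPolynomial V ℝ := fun s k => .X (.inr (.inr (s, k)))
  let pe : S × Fin n × Fin n → MvPolynomial V ℝ := fun t =>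
    MvPolynomial.rename .inl ((t.1 : MatP n g) t.2.1 t.2.2) -
      ∑ k, vW t.1 k t.2.1 * vd t.1 k * vW t.1 k t.2.2
  let z : V → F := Sum.elim x (Sum.elim (fun t => W t.1 t.2.1 t.2.2) fun t => d t.1 t.2)
  obtain ⟨y, hy⟩ := exists_real_point hF.polyIVT i
    (insert (MvPolynomial.rename .inl c)
      (Finset.univ.image pe ∪ Finset.univ.image fun t : S × Fin n => vd t.1 t.2)) z
  let X : Fin g → Matrix (Fin n) (Fin n) ℝ := fun j => Matrix.of fun a b => y (.inl (j, a, b))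
  have hzx : z ∘ Sum.inl = x := rfl
  have hzW : ∀ s k a, z (.inr (.inl (s, k, a))) = W s k a := fun _ _ _ => rfl
  have hzd : ∀ s k, z (.inr (.inr (s, k))) = d s k := fun _ _ => rfl
  have hyX : y ∘ Sum.inl = pointOf X := rfl
  refine ⟨X, fun s hs => ?_, ?_⟩
  · have hdy : ∀ k, 0 ≤ y (.inr (.inr (⟨s, hs⟩, k))) := by
      intro k
      have h1 := hy (vd ⟨s, hs⟩ k) (by simp)
      simp only [vd, MvPolynomial.eval_X, MvPolynomial.eval₂_X, hzd] at h1
      rw [← sign_nonneg_iff, h1, sign_nonneg_iff]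
      exact hd _ _
    have hE : evalMat n g X s = (Matrix.of fun k a => y (.inr (.inl (⟨s, hs⟩, k, a))))ᵀ *
        diagonal (fun k => y (.inr (.inr (⟨s, hs⟩, k)))) *
        (Matrix.of fun k a => y (.inr (.inl (⟨s, hs⟩, k, a)))) := by
      ext a b
      have h1 := hy (pe (⟨s, hs⟩, a, b)) (by simp)
      have h2 := congrFun (congrFun (hWd ⟨s, hs⟩) a) b
      simp only [pe, vW, vd, map_sub, map_sum, map_mul, MvPolynomial.eval_X, MvPolynomial.eval₂_sub,
        MvPolynomial.eval₂_sum, MvPolynomial.eval₂_mul, MvPolynomial.eval₂_X, hzW, hzd,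
        MvPolynomial.eval_rename, MvPolynomial.eval₂_rename, hzx, hyX] at h1
      rw [Matrix.mul_apply] at h2
      simp only [Matrix.map_apply, mul_diagonal, transpose_apply] at h2
      rw [h2, sub_self, sign_zero, sign_eq_zero_iff, sub_eq_zero] at h1
      rw [Matrix.mul_apply]
      simp only [mul_diagonal, transpose_apply, Matrix.of_apply]
      exact h1
    rw [hE, ← conjTranspose_eq_transpose_of_trivial]
    exact (PosSemidef.diagonal hdy).conjTranspose_mul_mul_same _
  · have h1 := hy (MvPolynomial.rename .inl c) (by simp)
    rw [MvPolynomial.eval_rename, MvPolynomial.eval₂_rename, hyX, hzx] at h1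
    rw [← sign_nonpos_iff, h1, sign_nonpos_iff]
    exact hc

/-- **Krivine–Stengle** for trace polynomials. -/
theorem IsCyclicPreordering.exists_mul_eq_one_add {T S : Set (MatP n g)}
    (hT : IsCyclicPreordering n g T) (hST : S ⊆ T) (hSfin : S.Finite) (c : traceAlg n g)
    (hc : ∀ X ∈ KSet n g S, 0 < MvPolynomial.eval (pointOf X) (c : PolyRing n g)) :
    ∃ u ∈ centerPart T, ∃ v ∈ centerPart T, c * u = 1 + v := by
  by_contra hcon
  have h0 := hT.zero_mem_center
  have hle : ∀ p ∈ centerPart T, ∃ p₁ ∈ centerPart T, ∃ p₂ ∈ centerPart T, p = p₁ - c * p₂ :=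
    fun p hp => ⟨p, hp, 0, h0, by ring⟩
  let P : RingPreordering (traceAlg n g) :=
    { carrier := {x | ∃ p₁ ∈ centerPart T, ∃ p₂ ∈ centerPart T, x = p₁ - c * p₂}
      mul_mem' := by
        rintro _ _ ⟨p, hp, q, hq, rfl⟩ ⟨p', hp', q', hq', rfl⟩
        exact ⟨p * p' + c * c * (q * q'), hT.add_mem_center (hT.mul_mem_center hp hp')
          (hT.mul_mem_center (hT.sq_mem_center c) (hT.mul_mem_center hq hq')), p * q' + q * p',
          hT.add_mem_center (hT.mul_mem_center hp hq') (hT.mul_mem_center hq hp'), by ring⟩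
      one_mem' := hle 1 hT.one_mem_center
      add_mem' := by
        rintro _ _ ⟨p, hp, q, hq, rfl⟩ ⟨p', hp', q', hq', rfl⟩
        exact ⟨_, hT.add_mem_center hp hp', _, hT.add_mem_center hq hq', by ring⟩
      zero_mem' := hle 0 h0
      mem_of_isSquare' := by
        rintro _ ⟨y, rfl⟩
        exact hle _ (hT.sq_mem_center y)
      neg_one_notMem' := by
        rintro ⟨p, hp, q, hq, h⟩
        exact hcon ⟨q, hq, p, hp, by linear_combination h⟩ }
  obtain ⟨F, _, _, _, φ, hφ, hF, hgram⟩ := P.exists_ringHom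
  have hPle : ∀ p ∈ centerPart T, p ∈ P := hle
  obtain ⟨x, hx, hxs⟩ := exists_point_of_character hF φ (P : Set (traceAlg n g)) hgram
    (fun h hh c hc => hPle _ (hT.trace_sandwich_mem_center hT.1.2.1 hh (by rwa [one_mul])))
  have hc0 : φ c ≤ 0 := by
    have h1 := hφ (-c) ⟨0, h0, 1, hT.one_mem_center, by ring⟩
    rwa [map_neg, neg_nonneg] at h1
  obtain ⟨X, hX, hXc⟩ := exists_real_psd_point hF _ hSfin x (fun s hs => (hT.1.1 s (hST hs)).2)
    (fun s hs => hxs s (hT.1.1 s (hST hs)).1 (hT.1.1 s (hST hs)).2 fun h hh c hc =>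
      hPle _ (hT.trace_sandwich_mem_center (hST hs) hh hc)) c ((hx c).trans_le hc0)
  exact absurd (hc X hX) hXc.not_gt

end CenterPart

section StrictPart

variable {n g : ℕ} {T : Set (MatP n g)}

/-- The sums of hermitian squares weighted by the central elements of `T`. -/
def squarePart (T : Set (MatP n g)) : AddSubmonoid (MatP n g) :=
  AddSubmonoid.closure {x | ∃ c ∈ centerPart T, ∃ h ∈ traceRing n g,
    x = (c : PolyRing n g) • (h * hᵀ)}

theorem smul_mul_transpose_mem_squarePart {c : traceAlg n g} (hc : c ∈ centerPart T)
    {h : MatP n g} (hh : h ∈ traceRing n g) :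
    (c : PolyRing n g) • (h * hᵀ) ∈ squarePart T :=
  AddSubmonoid.subset_closure ⟨c, hc, h, hh, rfl⟩

theorem smul_one_mem_squarePart {c : traceAlg n g} (hc : c ∈ centerPart T) :
    (c : PolyRing n g) • (1 : MatP n g) ∈ squarePart T := by
  simpa using smul_mul_transpose_mem_squarePart hc (one_mem (traceRing n g))

theorem sandwich_mem_squarePart {k q : MatP n g} (hk : k ∈ traceRing n g)
    (hq : q ∈ squarePart T) : k * q * kᵀ ∈ squarePart T := by
  induction hq using AddSubmonoid.closure_induction with
  | mem x hx =>
    obtain ⟨c, hc, h, hh, rfl⟩ := hx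
    have := smul_mul_transpose_mem_squarePart hc (mul_mem hk hh)
    rwa [transpose_mul, Matrix.mul_assoc, ← Matrix.mul_assoc h, ← Matrix.mul_assoc, ← smul_mul_assoc,
      ← mul_smul_comm] at this
  | zero => rw [mul_zero, zero_mul]; exact zero_mem _
  | add x y _ _ hx hy => rw [mul_add, add_mul]; exact add_mem hx hy

namespace IsCyclicPreordering

variable (hT : IsCyclicPreordering n g T)
include hT

theorem mem_of_mem_squarePart {q : MatP n g} (hq : q ∈ squarePart T) : q ∈ T := by
  induction hq using AddSubmonoid.closure_induction with
  | mem x hx =>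
    obtain ⟨c, hc, h, hh, rfl⟩ := hx
    have := hT.1.2.2.2.1 h hh _ hc
    rwa [mul_smul_comm, mul_one, smul_mul_assoc] at this
  | zero => simpa [centerPart] using hT.zero_mem_center
  | add x y _ _ hx hy => exact hT.1.2.2.1 x hx y hy

theorem smul_mem_squarePart {c : traceAlg n g} (hc : c ∈ centerPart T) {q : MatP n g}
    (hq : q ∈ squarePart T) : (c : PolyRing n g) • q ∈ squarePart T := by
  induction hq using AddSubmonoid.closure_induction with
  | mem x hx =>
    obtain ⟨d, hd, h, hh, rfl⟩ := hx
    rw [smul_smul]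
    exact smul_mul_transpose_mem_squarePart (hT.mul_mem_center hc hd) hh
  | zero => rw [smul_zero]; exact zero_mem _
  | add x y _ _ hx hy => rw [smul_add]; exact add_mem hx hy

theorem mem_center_of_mem_squarePart {c : traceAlg n g}
    (hc : (c : PolyRing n g) • (1 : MatP n g) ∈ squarePart T) : c ∈ centerPart T :=
  hT.mem_of_mem_squarePart hc

theorem isCyclicQM_squarePart : IsCyclicQM n g (squarePart T) := by
  refine ⟨fun q hq => hT.1.1 q (hT.mem_of_mem_squarePart hq), ?_, fun a ha b hb => add_mem ha hb,
    fun h hh q hq => sandwich_mem_squarePart hh hq, fun q hq => ?_⟩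
  · have := smul_one_mem_squarePart hT.one_mem_center
    rwa [OneMemClass.coe_one, one_smul] at this
  · have hq' := hT.mem_of_mem_squarePart hq
    exact smul_one_mem_squarePart (c := ⟨_, trace_mem_traceAlg (hT.1.1 q hq').1⟩)
      (hT.trace_mem_center hq' rfl)

theorem algebraMap_mem_center {r : ℝ} (hr : 0 ≤ r) : algebraMap ℝ (traceAlg n g) r ∈ centerPart T := by
  have := hT.sq_mem_center (algebraMap ℝ (traceAlg n g) √r)
  rwa [← map_mul, Real.mul_self_sqrt hr] at this

end IsCyclicPreordering

end StrictPart

section Bounded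

variable {n g : ℕ}

theorem transpose_algebraMap_matP (r : ℝ) :
    (algebraMap ℝ (MatP n g) r)ᵀ = algebraMap ℝ (MatP n g) r := by
  rw [Algebra.algebraMap_eq_smul_one, transpose_smul, transpose_one]

namespace IsCyclicQM

variable {Q : Set (MatP n g)} (hQ : IsCyclicQM n g Q)
include hQ

theorem add_mem {a b : MatP n g} (ha : a ∈ Q) (hb : b ∈ Q) : a + b ∈ Q := hQ.2.2.1 a ha b hb

theorem mul_transpose_mem {h : MatP n g} (hh : h ∈ traceRing n g) : h * hᵀ ∈ Q := by
  have := hQ.2.2.2.1 h hh 1 hQ.2.1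
  rwa [mul_one] at this

theorem smul_mem {r : ℝ} (hr : 0 ≤ r) {q : MatP n g} (hq : q ∈ Q) : r • q ∈ Q := by
  have := hQ.2.2.2.1 (algebraMap ℝ _ √r) ((traceRing n g).algebraMap_mem _) q hq
  rwa [transpose_algebraMap_matP, Algebra.algebraMap_eq_smul_one, smul_one_mul, smul_mul_assoc,
    mul_smul_comm, mul_one, smul_smul, Real.mul_self_sqrt hr] at this

theorem zero_mem : 0 ∈ Q := by simpa using hQ.smul_mem le_rfl hQ.2.1

theorem sum_mem {ι : Type*} {s : Finset ι} {f : ι → MatP n g} (h : ∀ i ∈ s, f i ∈ Q) :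
    ∑ i ∈ s, f i ∈ Q := by
  classical
  induction s using Finset.induction_on with
  | empty => exact hQ.zero_mem
  | insert a s ha ih =>
    rw [Finset.sum_insert ha]
    exact hQ.add_mem (h a (by simp)) (ih fun i hi => h i (by simp [hi]))

/-- The elements bounded with respect to a cyclic quadratic module. -/
def IsBounded (_ : IsCyclicQM n g Q) (h : MatP n g) : Prop :=
  ∃ M : ℝ, 0 ≤ M ∧ M • (1 : MatP n g) - h * hᵀ ∈ Q

theorem isBounded_mul {h k : MatP n g} (hh : h ∈ traceRing n g) (h1 : hQ.IsBounded h)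
    (h2 : hQ.IsBounded k) : hQ.IsBounded (h * k) := by
  obtain ⟨M, hM, h1⟩ := h1
  obtain ⟨N, hN, h2⟩ := h2
  refine ⟨N * M, mul_nonneg hN hM, ?_⟩
  convert hQ.add_mem (hQ.2.2.2.1 h hh _ h2) (hQ.smul_mem hN h1) using 1
  rw [mul_sub, sub_mul, mul_smul_comm, mul_one, smul_mul_assoc, smul_sub, smul_smul, transpose_mul]
  simp only [Matrix.mul_assoc]
  abel

theorem isBounded_add {h k : MatP n g} (hh : h ∈ traceRing n g) (hk : k ∈ traceRing n g)
    (h1 : hQ.IsBounded h) (h2 : hQ.IsBounded k) : hQ.IsBounded (h + k) := by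
  obtain ⟨M, hM, h1⟩ := h1
  obtain ⟨N, hN, h2⟩ := h2
  refine ⟨2 * M + 2 * N, by positivity, ?_⟩
  convert hQ.add_mem (hQ.add_mem (hQ.smul_mem zero_le_two h1) (hQ.smul_mem zero_le_two h2))
    (hQ.mul_transpose_mem (sub_mem hh hk)) using 1
  rw [transpose_add, transpose_sub, add_smul, smul_sub, smul_sub, smul_smul, smul_smul, two_smul,
    two_smul]
  noncomm_ring

theorem isBounded_algebraMap (r : ℝ) : hQ.IsBounded (algebraMap ℝ _ r) := by
  refine ⟨r * r, mul_self_nonneg r, ?_⟩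
  rw [transpose_algebraMap_matP, ← map_mul, ← Algebra.algebraMap_eq_smul_one, sub_self]
  exact hQ.zero_mem

theorem isBounded_trace (hn : 0 < n) {w : MatP n g} (hw : w ∈ traceRing n g)
    (h : hQ.IsBounded w) : hQ.IsBounded (trace w • (1 : MatP n g)) := by
  obtain ⟨M, hM, h⟩ := h
  have hn0 : (n : ℝ) ≠ 0 := by positivity
  refine ⟨n * (n * M), by positivity, ?_⟩
  let t : MatP n g := trace w • 1
  have ht : t ∈ traceRing n g := smul_one_mem_traceRing (trace_mem_traceAlg hw)
  let y : MatP n g := w - (n : ℝ)⁻¹ • t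
  have hy : y ∈ traceRing n g := sub_mem hw ((traceRing n g).smul_mem ht _)
  have h1 := hQ.smul_mem (Nat.cast_nonneg n) (hQ.2.2.2.2 _ (hQ.mul_transpose_mem hy))
  have h2 := hQ.smul_mem (Nat.cast_nonneg n) (hQ.2.2.2.2 _ h)
  convert hQ.add_mem h2 h1 using 1
  let c : PolyRing n g := MvPolynomial.C ((n : ℝ)⁻¹)
  have hc : c * n = 1 := by
    rw [← map_natCast MvPolynomial.C, ← map_mul, inv_mul_cancel₀ hn0, map_one]
  have hs : ∀ (r : ℝ) (p : PolyRing n g), r • p • (1 : MatP n g) = (MvPolynomial.C r * p) • 1 :=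
    fun r p => by rw [← smul_assoc, MvPolynomial.smul_eq_C_mul]
  have h3 : trace (y * yᵀ) = trace (w * wᵀ) - c * (trace w * trace w) := by
    simp only [y, t, transpose_sub, transpose_smul, transpose_one, sub_mul, mul_sub, trace_sub,
      trace_smul, smul_mul_assoc, mul_smul_comm, one_mul, mul_one, trace_transpose, trace_one,
      Fintype.card_fin, smul_eq_mul, MvPolynomial.smul_eq_C_mul]
    linear_combination (c * trace w * trace w) * hc
  have h5 : (n * (n * M)) • (1 : MatP n g) =
      ((n : PolyRing n g) * ((n : PolyRing n g) * MvPolynomial.C M)) • 1 := by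
    have := hs (n * (n * M)) 1
    rwa [one_smul, mul_one, map_mul, map_mul, map_natCast] at this
  rw [h3, hs, hs, h5, transpose_smul, transpose_one, smul_mul_smul_comm, mul_one, ← sub_smul,
    ← add_smul, trace_sub, trace_smul, trace_one, Fintype.card_fin, MvPolynomial.smul_eq_C_mul,
    map_natCast]
  congr 1
  linear_combination (trace w * trace w) * hc

theorem isBounded_of_generators (hn : 0 < n)
    (h : ∀ m ∈ genSet n g, hQ.IsBounded m) {x : MatP n g} (hx : x ∈ traceRing n g) :
    hQ.IsBounded x := by
  have hword : ∀ w ∈ wordMonoid n g, hQ.IsBounded w := by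
    intro w hw
    induction hw using Submonoid.closure_induction with
    | mem w hw => exact h w hw
    | one => simpa using hQ.isBounded_algebraMap 1
    | mul v w hv hw hv' hw' =>
      exact hQ.isBounded_mul (wordMonoid_subset_traceRing hv) hv' hw'
  induction hx using Algebra.adjoin_induction with
  | mem x hx =>
    rcases hx with hx | ⟨w, hw, rfl⟩
    · exact h x hx
    · exact hQ.isBounded_trace hn (wordMonoid_subset_traceRing hw) (hword w hw)
  | algebraMap r => exact hQ.isBounded_algebraMap r
  | add x y hx hy hx' hy' => exact hQ.isBounded_add hx hy hx' hy'
  | mul x y hx hy hx' hy' => exact hQ.isBounded_mul hx hx' hy'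

theorem exists_sub_mem_of_isBounded {x : MatP n g} (hx : x ∈ traceRing n g) (hsym : xᵀ = x)
    (h : hQ.IsBounded x) : ∃ M : ℝ, 0 ≤ M ∧ M • (1 : MatP n g) - x ∈ Q := by
  obtain ⟨M, hM, h⟩ := h
  refine ⟨2⁻¹ + 2⁻¹ * M, by positivity, ?_⟩
  have h2 := hQ.mul_transpose_mem (sub_mem (one_mem (traceRing n g)) hx)
  convert hQ.smul_mem (r := 2⁻¹) (by norm_num) (hQ.add_mem h h2) using 1
  have h3 : x = (2⁻¹ : ℝ) • (x + x) := by rw [← two_smul ℝ x, smul_smul]; norm_num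
  rw [transpose_sub, transpose_one, hsym, add_smul, mul_smul]
  nth_rewrite 1 [h3]
  rw [← smul_add, ← smul_sub]
  congr 1
  noncomm_ring

/-- The sum of the hermitian squares of the generic matrices and their transposes. -/
def _root_.squareSum (n g : ℕ) : MatP n g :=
  ∑ j, (genMat n g j * (genMat n g j)ᵀ + (genMat n g j)ᵀ * genMat n g j)

theorem exists_sub_mem_of_squareSum (hn : 0 < n) {M : ℝ} (hM : 0 ≤ M)
    (h : M • (1 : MatP n g) - squareSum n g ∈ Q) {x : MatP n g} (hx : x ∈ traceRing n g)
    (hsym : xᵀ = x) : ∃ N : ℝ, 0 ≤ N ∧ N • (1 : MatP n g) - x ∈ Q := by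
  refine hQ.exists_sub_mem_of_isBounded hx hsym (hQ.isBounded_of_generators hn ?_ hx)
  have hg : ∀ j, genMat n g j ∈ traceRing n g := fun j =>
    Algebra.subset_adjoin (Or.inl (Or.inl ⟨j, rfl⟩))
  have h1 : ∀ j, genMat n g j * (genMat n g j)ᵀ ∈ Q := fun j => hQ.mul_transpose_mem (hg j)
  have h2 : ∀ j, (genMat n g j)ᵀ * genMat n g j ∈ Q := fun j => by
    simpa using hQ.mul_transpose_mem (transpose_mem_traceRing (hg j))
  have h3 : ∀ j, squareSum n g - (genMat n g j * (genMat n g j)ᵀ +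
      (genMat n g j)ᵀ * genMat n g j) ∈ Q := by
    intro j
    rw [squareSum, ← Finset.sum_erase_add _ _ (Finset.mem_univ j), add_sub_cancel_right]
    exact hQ.sum_mem fun i _ => hQ.add_mem (h1 i) (h2 i)
  rintro m (⟨j, rfl⟩ | ⟨j, rfl⟩)
  · refine ⟨M, hM, ?_⟩
    convert hQ.add_mem (hQ.add_mem h (h3 j)) (h2 j) using 1
    abel
  · refine ⟨M, hM, ?_⟩
    convert hQ.add_mem (hQ.add_mem h (h3 j)) (h1 j) using 1
    rw [transpose_transpose]
    abel

end IsCyclicQM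

end Bounded

section CharpolyPositivity

open Polynomial in
theorem coeff_prod_X_add_C_pos {ι : Type*} (s : Finset ι) {ν : ι → ℝ} (hν : ∀ i ∈ s, 0 < ν i)
    {k : ℕ} (hk : k ≤ s.card) : 0 < (∏ i ∈ s, (X + C (ν i))).coeff k := by
  classical
  have hcoeff : ∀ (a : ℝ) (p : ℝ[X]) (j : ℕ),
      ((X + C a) * p).coeff (j + 1) = p.coeff j + a * p.coeff (j + 1) := by
    intro a p j
    rw [add_mul, coeff_add, coeff_X_mul, coeff_C_mul]
  induction s using Finset.induction_on generalizing k with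
  | empty =>
    obtain rfl : k = 0 := by simpa using hk
    simp
  | insert a s ha ih =>
    have ih' : ∀ {k : ℕ}, k ≤ s.card → 0 < (∏ i ∈ s, (X + C (ν i))).coeff k :=
      fun hk => ih (fun i hi => hν i (by simp [hi])) hk
    have ha0 := hν a (by simp)
    rw [Finset.prod_insert ha]
    rw [Finset.card_insert_of_notMem ha] at hk
    cases k with
    | zero =>
      rw [mul_coeff_zero]
      simpa using mul_pos ha0 (ih' (Nat.zero_le _))
    | succ k =>
      rw [hcoeff]
      rcases (Nat.lt_or_ge k s.card) with h | h
      · exact add_pos (ih' (by omega)) (mul_pos ha0 (ih' (by omega)))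
      · have h0 : (∏ i ∈ s, (X + C (ν i))).coeff (k + 1) = 0 := by
          refine coeff_eq_zero_of_natDegree_lt ?_
          rw [natDegree_prod_of_monic _ _ fun i _ => monic_X_add_C _]
          simp only [natDegree_X_add_C, Finset.sum_const, smul_eq_mul, mul_one]
          omega
        rw [h0, mul_zero, add_zero]
        exact ih' (by omega)

theorem Matrix.PosDef.coeff_charpoly_neg_pos {ι : Type*} [Fintype ι] [DecidableEq ι]
    {A : Matrix ι ι ℝ} (hA : A.PosDef) {k : ℕ} (hk : k ≤ Fintype.card ι) :
    0 < (-A).charpoly.coeff k := by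
  have hH : (-A).IsHermitian := hA.isHermitian.neg
  have hneg : ∀ i, hH.eigenvalues i < 0 := by
    intro i
    rw [hH.eigenvalues_eq]
    have h0 : (hH.eigenvectorBasis i).ofLp ≠ 0 := by
      intro h
      exact hH.eigenvectorBasis.orthonormal.ne_zero i (by ext j; exact congrFun h j)
    have := hA.dotProduct_mulVec_pos h0
    rw [neg_mulVec, dotProduct_neg]
    simpa using this
  have := coeff_prod_X_add_C_pos Finset.univ (ν := fun i => -hH.eigenvalues i)
    (fun i _ => neg_pos.2 (hneg i)) (k := k) hk
  rw [hH.charpoly_eq]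
  simpa [← sub_eq_add_neg] using this

end CharpolyPositivity

section Denominators

variable {n g : ℕ}

theorem coeff_charpoly_mem_traceAlg {h : MatP n g} (hh : h ∈ traceRing n g) (i : ℕ) :
    h.charpoly.coeff i ∈ traceAlg n g := by
  rcases le_or_gt i (Fintype.card (Fin n)) with hi | hi
  · rw [charpoly_coeff_eq_detCoeff h hi]
    exact detCoeff_mem _ (fun k => trace_mem_traceAlg (pow_mem (neg_mem hh) _)) _
  · rw [Polynomial.coeff_eq_zero_of_natDegree_lt]
    · exact zero_mem _
    · rwa [charpoly_natDegree_eq_dim]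

theorem aeval_mem_traceRing {p : Polynomial (PolyRing n g)} (hp : ∀ i, p.coeff i ∈ traceAlg n g)
    {h : MatP n g} (hh : h ∈ traceRing n g) : Polynomial.aeval h p ∈ traceRing n g := by
  rw [Polynomial.aeval_eq_sum_range]
  exact sum_mem fun i _ => smul_mem_traceRing (hp i) (pow_mem hh i)

/-- Up to a central factor, an element of the trace ring is invertible inside the trace ring. -/
theorem exists_mul_eq_charpoly_coeff_smul_one {h : MatP n g} (hh : h ∈ traceRing n g) :
    ∃ k ∈ traceRing n g, k * h = h.charpoly.coeff 0 • (1 : MatP n g) := by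
  refine ⟨-Polynomial.aeval h h.charpoly.divX, neg_mem (aeval_mem_traceRing (fun i => ?_) hh), ?_⟩
  · rw [Polynomial.coeff_divX]
    exact coeff_charpoly_mem_traceAlg hh _
  · have h1 := aeval_self_charpoly h
    rw [← Polynomial.divX_mul_X_add h.charpoly, map_add, map_mul, Polynomial.aeval_X,
      Polynomial.aeval_C, Algebra.algebraMap_eq_smul_one] at h1
    rw [neg_mul, neg_eq_iff_add_eq_zero]
    exact h1

theorem evalMat_eq_mapMatrix (X : Fin g → Matrix (Fin n) (Fin n) ℝ) (h : MatP n g) :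
    evalMat n g X h = (MvPolynomial.eval (pointOf X)).mapMatrix h := rfl

theorem evalMat_smul (X : Fin g → Matrix (Fin n) (Fin n) ℝ) (c : PolyRing n g) (h : MatP n g) :
    evalMat n g X (c • h) = MvPolynomial.eval (pointOf X) c • evalMat n g X h := by
  ext a b
  simp [evalMat]

theorem sum_range_two_mul {M : Type*} [AddCommMonoid M] (f : ℕ → M) (m : ℕ) :
    ∑ i ∈ Finset.range (2 * m), f i =
      ∑ i ∈ Finset.range m, f (2 * i) + ∑ i ∈ Finset.range m, f (2 * i + 1) := by
  induction m with
  | zero => simp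
  | succ m ih =>
    rw [show 2 * (m + 1) = 2 * m + 1 + 1 by ring, Finset.sum_range_succ, Finset.sum_range_succ, ih,
      Finset.sum_range_succ, Finset.sum_range_succ]
    abel

/-- The Cayley–Hamilton identity of `-f`, separated into even and odd parts. -/
theorem mul_sum_charpoly_neg_odd (f : MatP n g) :
    f * ∑ m ∈ Finset.range (n + 1), (-f).charpoly.coeff (2 * m + 1) • f ^ (2 * m) =
      ∑ m ∈ Finset.range (n + 1), (-f).charpoly.coeff (2 * m) • f ^ (2 * m) := by
  have h1 := aeval_self_charpoly (-f)
  have hdeg : (-f).charpoly.natDegree < 2 * (n + 1) := by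
    rw [charpoly_natDegree_eq_dim, Fintype.card_fin]
    omega
  rw [Polynomial.aeval_eq_sum_range' hdeg, sum_range_two_mul] at h1
  have heven : ∀ m : ℕ, (-f) ^ (2 * m) = f ^ (2 * m) := fun m => (even_two_mul m).neg_pow f
  have hodd : ∀ m : ℕ, (-f) ^ (2 * m + 1) = -(f * f ^ (2 * m)) := by
    intro m
    rw [pow_succ', heven, neg_mul]
  simp only [heven, hodd, smul_neg, Finset.sum_neg_distrib, ← mul_smul_comm] at h1
  rw [Finset.mul_sum]
  exact (sub_eq_zero.1 ((sub_eq_add_neg _ _).trans h1)).symm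

end Denominators

section CommonDenominator

variable {n g : ℕ} {T S : Set (MatP n g)}

namespace IsCyclicPreordering

variable (hT : IsCyclicPreordering n g T)
include hT

theorem prod_mem_center {ι : Type*} {s : Finset ι} {w : ι → traceAlg n g}
    (hw : ∀ i ∈ s, w i ∈ centerPart T) : ∏ i ∈ s, w i ∈ centerPart T :=
  Finset.prod_induction w (· ∈ centerPart T) (fun _ _ => hT.mul_mem_center) hT.one_mem_center hw

theorem exists_one_add_mul_charpoly_coeff_mem (hST : S ⊆ T) (hSfin : S.Finite) {f : MatP n g}
    (hpos : ∀ X ∈ KSet n g S, (evalMat n g X f).PosDef) (p : traceAlg n g)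
    (i : ℕ) (hp : (p : PolyRing n g) = (-f).charpoly.coeff i) :
    ∃ w ∈ centerPart T, (1 + w) * p ∈ centerPart T := by
  rcases le_or_gt i n with hi | hi
  · obtain ⟨u, hu, v, hv, huv⟩ := hT.exists_mul_eq_one_add hST hSfin p fun X hX => by
      rw [hp, ← Polynomial.coeff_map, ← charpoly_map, Matrix.map_neg _ (map_neg _)]
      exact (hpos X hX).coeff_charpoly_neg_pos (by simpa using hi)
    refine ⟨v, hv, ?_⟩
    rw [← huv, show p * u * p = p * p * u by ring]
    exact hT.mul_mem_center (hT.sq_mem_center p) hu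
  · refine ⟨0, hT.zero_mem_center, ?_⟩
    have : p = 0 := Subtype.ext (hp.trans (Polynomial.coeff_eq_zero_of_natDegree_lt
      (by rwa [charpoly_natDegree_eq_dim, Fintype.card_fin])))
    rw [this, mul_zero]
    exact hT.zero_mem_center

/-- A symmetric element which is positive definite on the semialgebraic set belongs, up to a
central denominator, to the strict part of the preordering. -/
theorem exists_one_add_smul_mem_squarePart (hST : S ⊆ T) (hSfin : S.Finite) (hn : 0 < n)
    (hnn : ∀ c ∈ centerPart T, ∀ X ∈ KSet n g S,
      0 ≤ MvPolynomial.eval (pointOf X) (c : PolyRing n g))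
    {f : MatP n g} (hf : f ∈ traceRing n g) (hsym : fᵀ = f)
    (hpos : ∀ X ∈ KSet n g S, (evalMat n g X f).PosDef) :
    ∃ w ∈ centerPart T, ((1 + w : traceAlg n g) : PolyRing n g) • f ∈ squarePart T := by
  let p : ℕ → traceAlg n g := fun i =>
    ⟨(-f).charpoly.coeff i, coeff_charpoly_mem_traceAlg (neg_mem hf) i⟩
  choose w hw hwp using fun i =>
    hT.exists_one_add_mul_charpoly_coeff_mem hST hSfin hpos (p i) i rfl
  let E : traceAlg n g := ∏ i ∈ Finset.range (2 * (n + 1)), (1 + w i)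
  have hE : ∀ i < 2 * (n + 1), E * p i ∈ centerPart T := by
    intro i hi
    have : E * p i = (∏ j ∈ (Finset.range (2 * (n + 1))).erase i, (1 + w j)) *
        ((1 + w i) * p i) := by
      rw [← mul_assoc, Finset.prod_erase_mul _ _ (Finset.mem_range.2 hi)]
    rw [this]
    exact hT.mul_mem_center (hT.prod_mem_center fun j _ =>
      hT.add_mem_center hT.one_mem_center (hw j)) (hwp i)
  have hft : ∀ m : ℕ, (f ^ m)ᵀ = f ^ m := fun m => by rw [transpose_pow, hsym]
  let u : MatP n g := ∑ m ∈ Finset.range (n + 1),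
    ((E * p (2 * m + 1) : traceAlg n g) : PolyRing n g) • f ^ (2 * m)
  let v : MatP n g := ∑ m ∈ Finset.range (n + 1),
    ((E * p (2 * m) : traceAlg n g) : PolyRing n g) • f ^ (2 * m)
  have hfu : f * u = v := by
    have h1 := congrArg (fun x => (E : PolyRing n g) • x) (mul_sum_charpoly_neg_odd f)
    simp only [← mul_smul_comm, Finset.smul_sum, smul_smul] at h1
    exact h1
  have huT : u ∈ traceRing n g :=
    sum_mem fun m _ => smul_mem_traceRing (SetLike.coe_mem _) (pow_mem hf _)
  have hut : uᵀ = u := by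
    simp only [u, transpose_sum, transpose_smul, hft]
  have huv : u * v ∈ squarePart T := by
    simp only [u, v, Finset.sum_mul_sum]
    refine sum_mem fun i hi => sum_mem fun j hj => ?_
    have h1 := smul_mul_transpose_mem_squarePart (hT.mul_mem_center
      (hE (2 * i + 1) (by simp at hi; omega)) (hE (2 * j) (by simp at hj; omega)))
      (pow_mem hf (i + j))
    rwa [hft, ← pow_add, show i + j + (i + j) = 2 * i + 2 * j by ring, pow_add,
      MulMemClass.coe_mul, ← smul_mul_smul_comm] at h1
  obtain ⟨k, hk, hku⟩ := exists_mul_eq_charpoly_coeff_smul_one huT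
  let D : traceAlg n g := ⟨u.charpoly.coeff 0, coeff_charpoly_mem_traceAlg huT 0⟩
  have hDf : ((D * D : traceAlg n g) : PolyRing n g) • f ∈ squarePart T := by
    have h1 := sandwich_mem_squarePart hk huv
    rw [← hfu] at h1
    have h2 : k * (u * (f * u)) * kᵀ = (k * u) * f * (k * u)ᵀ := by
      rw [transpose_mul, hut]; simp only [Matrix.mul_assoc]
    rwa [h2, hku, transpose_smul, transpose_one, smul_one_mul, mul_smul_comm, mul_one, smul_smul] at h1
  have hD : ∀ X ∈ KSet n g S,
      0 < MvPolynomial.eval (pointOf X) ((D * D : traceAlg n g) : PolyRing n g) := by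
    intro X hX
    rw [MulMemClass.coe_mul, map_mul (MvPolynomial.eval (pointOf X))]
    have hEX : 0 < MvPolynomial.eval (pointOf X) (E : PolyRing n g) := by
      simp only [E, SubmonoidClass.coe_finsetProd, map_prod]
      refine Finset.prod_pos fun i _ => ?_
      rw [AddMemClass.coe_add, OneMemClass.coe_one, map_add, map_one]
      exact add_pos_of_pos_of_nonneg one_pos (hnn _ (hw i) X hX)
    have hp1 : 0 < MvPolynomial.eval (pointOf X) (p 1 : PolyRing n g) := by
      simp only [p]
      rw [← Polynomial.coeff_map, ← charpoly_map, Matrix.map_neg _ (map_neg _)]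
      exact (hpos X hX).coeff_charpoly_neg_pos (by rwa [Fintype.card_fin])
    have hu : (evalMat n g X u).PosDef := by
      rw [evalMat_eq_mapMatrix, map_sum, Finset.sum_range_succ']
      simp only [← evalMat_eq_mapMatrix, evalMat_smul]
      refine PosDef.posSemidef_add (Matrix.posSemidef_sum _ fun m hm => ?_) ?_
      · refine PosSemidef.smul ?_ (hnn _ (hE _ (by simp at hm; omega)) X hX)
        have h1 := posSemidef_self_mul_conjTranspose (evalMat n g X (f ^ (m + 1)))
        rwa [conjTranspose_eq_transpose_of_trivial, evalMat, ← transpose_map, hft, ← evalMat,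
          evalMat_eq_mapMatrix, ← map_mul, ← pow_add, ← two_mul] at h1
      · rw [mul_zero, pow_zero, evalMat_eq_mapMatrix, map_one]
        refine PosDef.smul PosDef.one ?_
        rw [MulMemClass.coe_mul, map_mul (MvPolynomial.eval (pointOf X))]
        exact mul_pos hEX hp1
    have hne : MvPolynomial.eval (pointOf X) (D : PolyRing n g) ≠ 0 := by
      intro h0
      have h1 := hu.det_pos
      rw [det_eq_sign_charpoly_coeff, evalMat, charpoly_map, Polynomial.coeff_map, h0, mul_zero] at h1
      exact lt_irrefl _ h1
    exact mul_self_pos.2 hne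
  obtain ⟨a, ha, b, hb, hab⟩ := hT.exists_mul_eq_one_add hST hSfin (D * D) hD
  refine ⟨b, hb, ?_⟩
  have h1 := hT.smul_mem_squarePart ha hDf
  rwa [smul_smul, ← MulMemClass.coe_mul, mul_comm a, hab] at h1

end IsCyclicPreordering

end CommonDenominator

section Compactness

variable {n g : ℕ} {K : Set (Fin g → Matrix (Fin n) (Fin n) ℝ)}

theorem transpose_evalMat (X : Fin g → Matrix (Fin n) (Fin n) ℝ) (f : MatP n g) :
    (evalMat n g X f)ᵀ = evalMat n g X fᵀ := rfl

theorem evalMat_sub (X : Fin g → Matrix (Fin n) (Fin n) ℝ) (f h : MatP n g) :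
    evalMat n g X (f - h) = evalMat n g X f - evalMat n g X h := by
  simp only [evalMat_eq_mapMatrix, map_sub]

theorem evalMat_smul_one (X : Fin g → Matrix (Fin n) (Fin n) ℝ) (r : ℝ) :
    evalMat n g X (r • (1 : MatP n g)) = r • (1 : Matrix (Fin n) (Fin n) ℝ) := by
  rw [← algebraMap_smul (PolyRing n g) r (1 : MatP n g), evalMat_smul, evalMat_eq_mapMatrix, map_one,
    MvPolynomial.algebraMap_eq, MvPolynomial.eval_C]

theorem continuous_dotProduct_evalMat_mulVec (f : MatP n g) :
    Continuous fun y : (Fin g → Matrix (Fin n) (Fin n) ℝ) × (Fin n → ℝ) =>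
      y.2 ⬝ᵥ evalMat n g y.1 f *ᵥ y.2 := by
  have : Continuous fun y : (Fin g → Matrix (Fin n) (Fin n) ℝ) × (Fin n → ℝ) =>
      evalMat n g y.1 f := by
    refine continuous_matrix fun a b => (MvPolynomial.continuous_eval (f a b)).comp ?_
    refine continuous_pi fun v => ?_
    exact ((continuous_apply v.1).comp continuous_fst).matrix_elem _ _
  exact continuous_snd.dotProduct (this.matrix_mulVec continuous_snd)

theorem continuousOn_rayleigh (f : MatP n g) :
    ContinuousOn (fun y : (Fin g → Matrix (Fin n) (Fin n) ℝ) × (Fin n → ℝ) =>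
      (y.2 ⬝ᵥ evalMat n g y.1 f *ᵥ y.2) / (y.2 ⬝ᵥ y.2)) (K ×ˢ Metric.sphere 0 1) := by
  refine (continuous_dotProduct_evalMat_mulVec f).continuousOn.div
    (continuous_snd.dotProduct continuous_snd).continuousOn fun y hy h0 => ?_
  rw [dotProduct_self_eq_zero] at h0
  have := hy.2
  simp [h0] at this

theorem evalMat_posDef_of_sphere {f : MatP n g} (hsym : fᵀ = f)
    {X : Fin g → Matrix (Fin n) (Fin n) ℝ}
    (h : ∀ v ∈ Metric.sphere (0 : Fin n → ℝ) 1, 0 < v ⬝ᵥ evalMat n g X f *ᵥ v) :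
    (evalMat n g X f).PosDef := by
  refine PosDef.of_dotProduct_mulVec_pos ?_ fun v hv => ?_
  · rw [IsHermitian, conjTranspose_eq_transpose_of_trivial, transpose_evalMat, hsym]
  · have hv' : 0 < ‖v‖ := norm_pos_iff.2 hv
    have h1 := h (‖v‖⁻¹ • v) (by simp [norm_smul, hv'.ne'])
    rw [mulVec_smul, dotProduct_smul, smul_dotProduct, smul_smul, smul_eq_mul] at h1
    rw [star_trivial]
    exact pos_of_mul_pos_right h1 (by positivity)

theorem dotProduct_smul_one_mulVec (r : ℝ) (v : Fin n → ℝ) :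
    v ⬝ᵥ (r • (1 : Matrix (Fin n) (Fin n) ℝ)) *ᵥ v = r * (v ⬝ᵥ v) := by
  rw [smul_mulVec, one_mulVec, dotProduct_smul, smul_eq_mul]

theorem dotProduct_self_pos_of_mem_sphere {v : Fin n → ℝ}
    (hv : v ∈ Metric.sphere (0 : Fin n → ℝ) 1) : 0 < v ⬝ᵥ v := by
  have h0 : v ≠ 0 := by
    rintro rfl
    simp at hv
  have := dotProduct_star_self_pos_iff.2 h0
  rwa [star_trivial] at this

theorem exists_pos_sub_smul_one_posDef (hK : IsCompact K) {f : MatP n g} (hsym : fᵀ = f)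
    (hpos : ∀ X ∈ K, (evalMat n g X f).PosDef) :
    ∃ ε : ℝ, 0 < ε ∧ ∀ X ∈ K, (evalMat n g X (f - ε • (1 : MatP n g))).PosDef := by
  obtain ⟨ε, hε, h⟩ := (hK.prod (isCompact_sphere (0 : Fin n → ℝ) 1)).exists_forall_le'
    (continuousOn_rayleigh f) (a := 0) fun y hy => by
      have hy2 := dotProduct_self_pos_of_mem_sphere hy.2
      have h0 : y.2 ≠ 0 := by
        intro h0
        simp [h0] at hy2
      have := (hpos _ hy.1).dotProduct_mulVec_pos h0
      rw [star_trivial] at this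
      exact div_pos this hy2
  refine ⟨ε / 2, by positivity, fun X hX => evalMat_posDef_of_sphere ?_ fun v hv => ?_⟩
  · rw [transpose_sub, hsym, transpose_smul, transpose_one]
  · have hv2 := dotProduct_self_pos_of_mem_sphere hv
    have h1 := h (X, v) ⟨hX, hv⟩
    rw [le_div_iff₀ hv2] at h1
    rw [evalMat_sub, evalMat_smul_one, sub_mulVec, dotProduct_sub, dotProduct_smul_one_mulVec]
    have := mul_pos hε hv2
    simp only at h1
    linarith

theorem exists_smul_one_sub_posDef (hK : IsCompact K) {f : MatP n g} (hsym : fᵀ = f) :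
    ∃ M : ℝ, 0 ≤ M ∧ ∀ X ∈ K, (evalMat n g X (M • (1 : MatP n g) - f)).PosDef := by
  obtain ⟨M, hM⟩ := (hK.prod (isCompact_sphere (0 : Fin n → ℝ) 1)).bddAbove_image
    (continuousOn_rayleigh f)
  refine ⟨max M 0 + 1, by positivity, fun X hX => evalMat_posDef_of_sphere ?_ fun v hv => ?_⟩
  · rw [transpose_sub, hsym, transpose_smul, transpose_one]
  · have hv2 := dotProduct_self_pos_of_mem_sphere hv
    have h1 := hM ⟨(X, v), ⟨hX, hv⟩, rfl⟩
    simp only [div_le_iff₀ hv2] at h1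
    rw [evalMat_sub, evalMat_smul_one, sub_mulVec, dotProduct_sub, dotProduct_smul_one_mulVec]
    have := mul_le_mul_of_nonneg_right (le_max_left M 0) hv2.le
    linarith

end Compactness

section Archimedean

variable {n g : ℕ} {T S : Set (MatP n g)}

theorem coe_algebraMap_smul (r : ℝ) (x : MatP n g) :
    ((algebraMap ℝ (traceAlg n g) r : traceAlg n g) : PolyRing n g) • x = r • x := by
  rw [Subalgebra.coe_algebraMap, algebraMap_smul]

theorem transpose_squareSum : (squareSum n g)ᵀ = squareSum n g := by
  simp [squareSum, transpose_sum]

theorem IsCyclicQM.squareSum_mem {Q : Set (MatP n g)} (hQ : IsCyclicQM n g Q) :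
    squareSum n g ∈ Q := by
  have hgen : ∀ j, genMat n g j ∈ traceRing n g := fun j =>
    Algebra.subset_adjoin (Or.inl (Or.inl ⟨j, rfl⟩))
  refine hQ.sum_mem fun j _ => hQ.add_mem (hQ.mul_transpose_mem (hgen j)) ?_
  have := hQ.mul_transpose_mem (transpose_mem_traceRing (hgen j))
  rwa [transpose_transpose] at this

namespace IsCyclicPreordering

variable (hT : IsCyclicPreordering n g T)
include hT

theorem pow_mem_center {c : traceAlg n g} (hc : c ∈ centerPart T) (k : ℕ) :
    c ^ k ∈ centerPart T := by
  induction k with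
  | zero => rw [pow_zero]; exact hT.one_mem_center
  | succ k ih => rw [pow_succ]; exact hT.mul_mem_center ih hc

/-- The symmetric elements carried into the strict part by a power of `z` form a cyclic quadratic
module. -/
theorem isCyclicQM_localized {z : traceAlg n g} (hz : z ∈ centerPart T) :
    IsCyclicQM n g {x | x ∈ traceRing n g ∧ xᵀ = x ∧
      ∃ k : ℕ, ((z ^ k : traceAlg n g) : PolyRing n g) • x ∈ squarePart T} := by
  refine ⟨fun q hq => ⟨hq.1, hq.2.1⟩, ⟨one_mem _, transpose_one, 0, ?_⟩, ?_, ?_, ?_⟩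
  · exact smul_one_mem_squarePart (hT.pow_mem_center hz 0)
  · rintro x ⟨hx, hxs, k, hk⟩ y ⟨hy, hys, l, hl⟩
    refine ⟨add_mem hx hy, by rw [transpose_add, hxs, hys], k + l, ?_⟩
    have h1 := hT.smul_mem_squarePart (hT.pow_mem_center hz l) hk
    have h2 := hT.smul_mem_squarePart (hT.pow_mem_center hz k) hl
    rw [smul_smul, ← MulMemClass.coe_mul, ← pow_add] at h1 h2
    rw [smul_add]
    rw [add_comm l k] at h1
    exact add_mem h1 h2
  · rintro h hh q ⟨hq, hqs, k, hk⟩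
    refine ⟨mul_mem (mul_mem hh hq) (transpose_mem_traceRing hh), ?_, k, ?_⟩
    · rw [transpose_mul, transpose_mul, transpose_transpose, hqs, Matrix.mul_assoc]
    · have := sandwich_mem_squarePart hh hk
      rwa [mul_smul_comm, smul_mul_assoc] at this
  · rintro q ⟨hq, hqs, k, hk⟩
    refine ⟨smul_one_mem_traceRing (trace_mem_traceAlg hq), ?_, k, ?_⟩
    · rw [transpose_smul, transpose_one]
    · have := hT.isCyclicQM_squarePart.2.2.2.2 _ hk
      rwa [trace_smul, smul_assoc] at this

theorem exists_sub_mem_center {z : traceAlg n g} (k : ℕ) {N : ℝ}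
    (hN : z ^ k * (algebraMap ℝ _ N - z) ∈ centerPart T) (hz : z ∈ centerPart T) :
    ∃ N' : ℝ, algebraMap ℝ _ N' - z ∈ centerPart T := by
  induction k generalizing N with
  | zero => exact ⟨N, by rwa [pow_zero, one_mul] at hN⟩
  | succ k ih =>
    refine ih (N := (N + 1) ^ 2 / 4) ?_
    have h1 := hT.add_mem_center hN (hT.mul_mem_center (hT.pow_mem_center hz k)
      (hT.sq_mem_center (z - algebraMap ℝ _ ((N + 1) / 2))))
    convert h1 using 1
    have e1 : algebraMap ℝ (traceAlg n g) ((N + 1) ^ 2 / 4) =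
        algebraMap ℝ _ ((N + 1) / 2) * algebraMap ℝ _ ((N + 1) / 2) := by
      rw [← map_mul]; congr 1; ring
    have e2 : algebraMap ℝ (traceAlg n g) N =
        algebraMap ℝ _ ((N + 1) / 2) + algebraMap ℝ _ ((N + 1) / 2) - 1 := by
      rw [← map_add, ← map_one (algebraMap ℝ (traceAlg n g)), ← map_sub]; congr 1; ring
    rw [e1, e2]
    ring

theorem sub_mem_center_of_le {z : traceAlg n g} {N N' : ℝ} (h : N ≤ N')
    (hN : algebraMap ℝ _ N - z ∈ centerPart T) : algebraMap ℝ _ N' - z ∈ centerPart T := by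
  have := hT.add_mem_center hN (hT.algebraMap_mem_center (sub_nonneg.2 h))
  convert this using 1
  rw [map_sub]
  ring

/-- The strict part of the preordering is archimedean. -/
theorem exists_smul_one_sub_mem_squarePart (hn : 0 < n) {w : traceAlg n g} (hw : w ∈ centerPart T)
    {M : ℝ} (hM : 0 ≤ M) (h : ((1 + w : traceAlg n g) : PolyRing n g) •
      (M • (1 : MatP n g) - squareSum n g) ∈ squarePart T)
    {x : MatP n g} (hx : x ∈ traceRing n g) (hxs : xᵀ = x) :
    ∃ N : ℝ, 0 ≤ N ∧ N • (1 : MatP n g) - x ∈ squarePart T := by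
  set z : traceAlg n g := 1 + w with hzdef
  have hz : z ∈ centerPart T := hT.add_mem_center hT.one_mem_center hw
  have hQ := hT.isCyclicQM_squarePart
  have hB : squareSum n g ∈ traceRing n g := (hQ.1 _ hQ.squareSum_mem).1
  obtain ⟨N, -, -, -, k, hk⟩ := (hT.isCyclicQM_localized hz).exists_sub_mem_of_squareSum hn hM
    ⟨sub_mem (Subalgebra.smul_mem _ (one_mem _) _) hB,
      by rw [transpose_sub, transpose_smul, transpose_one, transpose_squareSum], 1,
      by rwa [pow_one]⟩
    (smul_one_mem_traceRing z.2) (by rw [transpose_smul, transpose_one])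
  have hk' : z ^ k * (algebraMap ℝ _ N - z) ∈ centerPart T := by
    refine hT.mem_center_of_mem_squarePart ?_
    rwa [MulMemClass.coe_mul, ← smul_smul, AddSubgroupClass.coe_sub, sub_smul, coe_algebraMap_smul]
  obtain ⟨N', hN'⟩ := hT.exists_sub_mem_center k hk' hz
  have hN'' := hT.sub_mem_center_of_le (le_max_left N' 0) hN'
  refine hQ.exists_sub_mem_of_squareSum hn (M := max N' 0 * M) (by positivity) ?_ hx hxs
  have h1 := hQ.add_mem (hQ.add_mem (hQ.smul_mem hM (smul_one_mem_squarePart hN'')) h)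
    (hT.smul_mem_squarePart hw hQ.squareSum_mem)
  convert h1 using 1
  have hzw : (z : PolyRing n g) • squareSum n g = squareSum n g + (w : PolyRing n g) • squareSum n g := by
    rw [hzdef, AddMemClass.coe_add, OneMemClass.coe_one, add_smul, one_smul]
  rw [AddSubgroupClass.coe_sub, sub_smul, coe_algebraMap_smul, smul_sub, smul_sub, hzw, smul_smul,
    mul_comm M, smul_comm M]
  abel

/-- In an archimedean situation, strict positivity up to a central denominator can be cleared. -/
theorem mem_squarePart_of_one_add_smul
    (harch : ∀ x ∈ traceRing n g, xᵀ = x →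
      ∃ N : ℝ, 0 ≤ N ∧ N • (1 : MatP n g) - x ∈ squarePart T)
    {w : traceAlg n g} (hw : w ∈ centerPart T) {a : MatP n g} (ha : a ∈ traceRing n g)
    (has : aᵀ = a) {ε : ℝ} (hε : 0 < ε)
    (h : ((1 + w : traceAlg n g) : PolyRing n g) • (a - ε • (1 : MatP n g)) ∈ squarePart T) :
    a ∈ squarePart T := by
  have hQ := hT.isCyclicQM_squarePart
  obtain ⟨N, hN, hNw⟩ := harch _ (smul_one_mem_traceRing (1 + w).2)
    (by rw [transpose_smul, transpose_one])
  have hNw' : algebraMap ℝ _ N - (1 + w) ∈ centerPart T := by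
    refine hT.mem_center_of_mem_squarePart ?_
    rwa [AddSubgroupClass.coe_sub, sub_smul, coe_algebraMap_smul]
  replace hNw' := hT.sub_mem_center_of_le (N' := N + 1) (by linarith) hNw'
  obtain ⟨r, hr, hra⟩ := harch (-a) (neg_mem ha) (by rw [transpose_neg, has])
  have hstep : ∀ r : ℝ, 0 ≤ r → a + r • (1 : MatP n g) ∈ squarePart T →
      a + (r - ε / (N + 1)) • (1 : MatP n g) ∈ squarePart T := by
    intro r hr hra
    have h1 := hQ.add_mem (hQ.add_mem (hQ.add_mem (hT.smul_mem_squarePart hNw' hra) h)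
      (hQ.smul_mem (add_nonneg hε.le hr) (smul_one_mem_squarePart hw))) (hQ.smul_mem hr hQ.2.1)
    have h2 := hQ.smul_mem (r := (N + 1)⁻¹) (by positivity) h1
    suffices h3 : a + (r - ε / (N + 1)) • (1 : MatP n g) = _ from h3 ▸ h2
    have hN1 : N + 1 ≠ 0 := by positivity
    rw [eq_inv_smul_iff₀ hN1, AddSubgroupClass.coe_sub, sub_smul (R := PolyRing n g), coe_algebraMap_smul,
      AddMemClass.coe_add, OneMemClass.coe_one, add_smul 1, add_smul 1, one_smul, one_smul]
    have e : (N + 1) * (r - ε / (N + 1)) = (N + 1) * r - ε := by field_simp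
    rw [smul_add, smul_smul, e]
    simp only [smul_add, smul_sub, sub_smul, add_smul, smul_smul, smul_comm (w : PolyRing n g)]
    abel
  have hind : ∀ k : ℕ, ∀ r : ℝ, 0 ≤ r → r ≤ k * (ε / (N + 1)) →
      a + r • (1 : MatP n g) ∈ squarePart T → a ∈ squarePart T := by
    intro k
    induction k with
    | zero =>
      intro r hr hrk hra
      obtain rfl : r = 0 := le_antisymm (by simpa using hrk) hr
      rwa [zero_smul, add_zero] at hra
    | succ k ih =>
      intro r hr hrk hra
      have h1 := hstep r hr hra
      push_cast at hrk
      rcases le_or_gt 0 (r - ε / (N + 1)) with h0 | h0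
      · exact ih _ h0 (by linarith) h1
      · have h2 := hQ.add_mem h1 (hQ.smul_mem (neg_nonneg.2 h0.le) hQ.2.1)
        rwa [neg_smul, add_neg_cancel_right] at h2
  obtain ⟨k, hk⟩ := exists_nat_ge (r / (ε / (N + 1)))
  refine hind k r hr ?_ ?_
  · rwa [div_le_iff₀ (by positivity)] at hk
  · rwa [sub_neg_eq_add, add_comm] at hra

end IsCyclicPreordering

/-- The elements of the trace ring which are positive semidefinite on a semialgebraic set. -/
theorem isCyclicPreordering_nonneg (hn : 0 < n) (K : Set (Fin g → Matrix (Fin n) (Fin n) ℝ)) :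
    IsCyclicPreordering n g {q | (q ∈ traceRing n g ∧ qᵀ = q) ∧
      ∀ X ∈ K, (evalMat n g X q).PosSemidef} := by
  have hone : ∀ X, evalMat n g X 1 = 1 := fun X => by rw [evalMat_eq_mapMatrix, map_one]
  have hscal : ∀ r : ℝ, 0 ≤ r → (r • (1 : Matrix (Fin n) (Fin n) ℝ)).PosSemidef :=
    fun r hr => PosSemidef.one.smul hr
  refine ⟨⟨fun q hq => hq.1, ⟨⟨one_mem _, transpose_one⟩, fun X _ => ?_⟩, ?_, ?_, ?_⟩, ?_⟩
  · rw [hone]; exact PosSemidef.one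
  · rintro a ⟨⟨ha, has⟩, ha'⟩ b ⟨⟨hb, hbs⟩, hb'⟩
    refine ⟨⟨add_mem ha hb, by rw [transpose_add, has, hbs]⟩, fun X hX => ?_⟩
    rw [evalMat_eq_mapMatrix, map_add]
    exact (ha' X hX).add (hb' X hX)
  · rintro h hh q ⟨⟨hq, hqs⟩, hq'⟩
    refine ⟨⟨mul_mem (mul_mem hh hq) (transpose_mem_traceRing hh), ?_⟩, fun X hX => ?_⟩
    · rw [transpose_mul, transpose_mul, transpose_transpose, hqs, Matrix.mul_assoc]
    · rw [evalMat_eq_mapMatrix, map_mul, map_mul]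
      simp only [← evalMat_eq_mapMatrix]
      rw [← transpose_evalMat, ← conjTranspose_eq_transpose_of_trivial]
      exact (hq' X hX).mul_mul_conjTranspose_same _
  · rintro q ⟨⟨hq, hqs⟩, hq'⟩
    refine ⟨⟨smul_one_mem_traceRing (trace_mem_traceAlg hq), ?_⟩, fun X hX => ?_⟩
    · rw [transpose_smul, transpose_one]
    · rw [evalMat_smul, hone, AddMonoidHom.map_trace]
      exact hscal _ (hq' X hX).trace_nonneg
  · rintro _ ⟨⟨⟨ha, -⟩, ha'⟩, -, p, rfl⟩ _ ⟨⟨⟨hb, -⟩, hb'⟩, -, q, rfl⟩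
    have hmul : (p • (1 : MatP n g)) * (q • (1 : MatP n g)) = (p * q) • (1 : MatP n g) := by
      rw [smul_mul_smul_comm, mul_one]
    have hval : ∀ (X) (r : PolyRing n g), (evalMat n g X (r • (1 : MatP n g))).PosSemidef →
        0 ≤ MvPolynomial.eval (pointOf X) r := by
      intro X r h
      rw [evalMat_smul, hone] at h
      simpa using h.diag_nonneg (i := ⟨0, hn⟩)
    refine ⟨⟨mul_mem ha hb, ?_⟩, fun X hX => ?_⟩
    · rw [hmul, transpose_smul, transpose_one]
    · rw [hmul, evalMat_smul, hone, map_mul (MvPolynomial.eval (pointOf X))]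
      exact hscal _ (mul_nonneg (hval X p (ha' X hX)) (hval X q (hb' X hX)))

theorem IsCyclicPreordering.inter {T₁ T₂ : Set (MatP n g)} (h₁ : IsCyclicPreordering n g T₁)
    (h₂ : IsCyclicPreordering n g T₂) : IsCyclicPreordering n g (T₁ ∩ T₂) :=
  ⟨⟨fun q hq => h₁.1.1 q hq.1, ⟨h₁.1.2.1, h₂.1.2.1⟩,
    fun a ha b hb => ⟨h₁.1.2.2.1 a ha.1 b hb.1, h₂.1.2.2.1 a ha.2 b hb.2⟩,
    fun h hh q hq => ⟨h₁.1.2.2.2.1 h hh q hq.1, h₂.1.2.2.2.1 h hh q hq.2⟩,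
    fun q hq => ⟨h₁.1.2.2.2.2 q hq.1, h₂.1.2.2.2.2 q hq.2⟩⟩,
    fun a ha b hb => ⟨h₁.2 a ⟨ha.1.1, ha.2⟩ b ⟨hb.1.1, hb.2⟩,
      h₂.2 a ⟨ha.1.2, ha.2⟩ b ⟨hb.1.2, hb.2⟩⟩⟩

end Archimedean

/-- Schmüdgen's Positivstellensatz for trace polynomials. -/
theorem stmt3 (n g : ℕ) (hn : 0 < n) (hg : 0 < g)
    (S : Set (MatP n g)) (hSfin : S.Finite)
    (hS : ∀ s ∈ S, s ∈ traceRing n g ∧ sᵀ = s)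
    (a : MatP n g) (haT : a ∈ traceRing n g) (haSym : aᵀ = a)
    (hcpt : IsCompact (KSet n g S))
    (hpos : ∀ X ∈ KSet n g S, (evalMat n g X a).PosDef) :
    a ∈ TtrS n g S := by
  intro T₀ hT₀ hST₀
  have hT := hT₀.inter (isCyclicPreordering_nonneg hn (KSet n g S))
  have hST : S ⊆ T₀ ∩ {q | (q ∈ traceRing n g ∧ qᵀ = q) ∧
      ∀ X ∈ KSet n g S, (evalMat n g X q).PosSemidef} :=
    fun s hs => ⟨hST₀ hs, hS s hs, fun X hX => hX s hs⟩
  set T := T₀ ∩ {q | (q ∈ traceRing n g ∧ qᵀ = q) ∧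
      ∀ X ∈ KSet n g S, (evalMat n g X q).PosSemidef} with hTdef
  have hnn : ∀ c ∈ centerPart T, ∀ X ∈ KSet n g S,
      0 ≤ MvPolynomial.eval (pointOf X) (c : PolyRing n g) := by
    intro c hc X hX
    have h := hc.2.2 X hX
    rw [evalMat_smul, evalMat_eq_mapMatrix, map_one] at h
    simpa using h.diag_nonneg (i := ⟨0, hn⟩)
  have hQ := hT.isCyclicQM_squarePart
  obtain ⟨M, hM, hMpos⟩ := exists_smul_one_sub_posDef hcpt (transpose_squareSum (n := n) (g := g))
  obtain ⟨w, hw, hwM⟩ := hT.exists_one_add_smul_mem_squarePart hST hSfin hn hnn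
    (sub_mem (Subalgebra.smul_mem _ (one_mem _) M) (hQ.1 _ hQ.squareSum_mem).1)
    (by rw [transpose_sub, transpose_smul, transpose_one, transpose_squareSum]) hMpos
  obtain ⟨ε, hε, hεpos⟩ := exists_pos_sub_smul_one_posDef hcpt haSym hpos
  obtain ⟨v, hv, hva⟩ := hT.exists_one_add_smul_mem_squarePart hST hSfin hn hnn
    (sub_mem haT (Subalgebra.smul_mem _ (one_mem _) ε))
    (by rw [transpose_sub, haSym, transpose_smul, transpose_one]) hεpos
  exact (hT.mem_of_mem_squarePart (hT.mem_squarePart_of_one_add_smul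
    (fun x hx hxs => hT.exists_smul_one_sub_mem_squarePart hn hw hM hwM hx hxs)
    hv haT haSym hε hva)).1
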